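/- Let φ be a nontrivial classical solution of the linear parabolic equation φₜ = a(t,x) φₓₓ + b(t,x) φₓ + c(t,x) φ on (0,∞) × ℝ, 2π-periodic in x. Then for every t > 0 the set {x ∈ [0, 2π) : φ(t,x) = 0} is finite, i.e. z(φ(t,·)) < ∞. -/

import Mathlib

open Real Set Filter

noncomputable def zeroNum (u : ℝ → ℝ) : ℕ∞ :=
  {x ∈ Set.Ico (0 : ℝ) (2 * Real.pi) | u x = 0}.encard

open Real Set Filter

lemma sin_trap (θ : ℝ → ℝ) (hθ : Continuous θ) (hs : ∀ s, 0 ≤ Real.sin (θ s))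
    (h0 : θ 0 ∈ Icc 0 π) (s : ℝ) : θ s ∈ Icc 0 π := by
  have key : ∀ v, v ∈ uIcc (θ 0) (θ s) → 0 ≤ Real.sin v := by
    intro v hv
    obtain ⟨r, -, hr⟩ := intermediate_value_uIcc hθ.continuousOn hv
    rw [← hr]; exact hs r
  by_contra hcon
  rw [mem_Icc, not_and_or, not_le, not_le] at hcon
  have hpi := Real.pi_pos
  rcases hcon with h | h
  · have h1 : max (θ s) (-(π/2)) < 0 := max_lt h (by linarith)
    have := key (max (θ s) (-(π/2))) (by
      rw [mem_uIcc]; right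
      exact ⟨le_max_left _ _, by linarith [h0.1]⟩)
    have h2 := Real.sin_neg_of_neg_of_neg_pi_lt h1 (by
      have := le_max_right (θ s) (-(π/2)); linarith)
    linarith
  · have h1 : π < min (θ s) (3*π/2) := lt_min h (by linarith)
    have := key (min (θ s) (3*π/2)) (by
      rw [mem_uIcc]; left
      exact ⟨by linarith [h0.2], min_le_left _ _⟩)
    have h2 : Real.sin (min (θ s) (3*π/2) - π) > 0 := Real.sin_pos_of_pos_of_lt_pi (by linarith) (by
      have := min_le_right (θ s) (3*π/2); linarith)
    rw [Real.sin_sub_pi] at h2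
    linarith

/-- planar crossing lemma, points are `(t, x)` -/
lemma cross_aux (γ η : ℝ → ℝ × ℝ) (hγ : Continuous γ) (hη : Continuous η)
    (t1 t0 y z y' : ℝ) (hyz : y < z) (hzy : z < y')
    (hγ0 : γ 0 = (t0, y)) (hγ1 : γ 1 = (t0, y')) (hη0 : η 0 = (t0, z)) (hη1 : (η 1).1 = t1)
    (h1 : ∀ s, (γ s).1 ≤ t0) (h2 : ∀ s, t1 ≤ (γ s).1) (h3 : ∀ s, (η s).1 ≤ t0) :
    ∃ s s', γ s = η s' := by
  by_contra hcon
  push Not at hcon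
  set f : ℝ × ℝ → ℂ := fun p => ⟨(γ p.1).2 - (η p.2).2, (γ p.1).1 - (η p.2).1⟩ with hf
  have hfc : Continuous f := by
    have e : f = fun p => (((γ p.1).2 - (η p.2).2 : ℝ) : ℂ) + (((γ p.1).1 - (η p.2).1 : ℝ) : ℂ) * Complex.I := by
      funext p; apply Complex.ext <;> simp [hf]
    rw [e]; fun_prop
  have hf0 : ∀ p, f p ≠ 0 := by
    intro p hp
    apply hcon p.1 p.2
    have hr := congrArg Complex.re hp
    have hi := congrArg Complex.im hp
    simp only [hf, Complex.zero_re, Complex.zero_im] at hr hi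
    exact Prod.ext (by linarith) (by linarith)
  have hsc : SimplyConnectedSpace (ℝ × ℝ) := inferInstance
  obtain ⟨g, ⟨-, hg⟩, -⟩ := Complex.isCoveringMapOn_exp.existsUnique_continuousMap_lifts
    ⟨f, hfc⟩ (Complex.exp_log (hf0 (0,0))) (fun p => hf0 p)
  have hge : ∀ p, Complex.exp (g p) = f p := fun p => congrFun hg p
  have him : ∀ p, (f p).im = Real.exp (g p).re * Real.sin (g p).im := by
    intro p; rw [← hge p, Complex.exp_im]
  have hre : ∀ p, (f p).re = Real.exp (g p).re * Real.cos (g p).im := by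
    intro p; rw [← hge p, Complex.exp_re]
  have hgc : Continuous (fun p => (g p).im) := Complex.continuous_im.comp (map_continuous g)
  have f00r : (f (0,0)).re < 0 := by simp [hf, hγ0, hη0, hyz]
  have f00i : (f (0,0)).im = 0 := by simp [hf, hγ0, hη0]
  have f10r : 0 < (f (1,0)).re := by simp [hf, hγ1, hη0, hzy]
  have s00 : Real.sin (g (0,0)).im = 0 := by
    rw [him] at f00i
    exact (mul_eq_zero.1 f00i).resolve_left (Real.exp_pos _).ne'
  have c00 : Real.cos (g (0,0)).im < 0 := by
    rw [hre] at f00r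
    by_contra hc; push Not at hc
    have := mul_nonneg (Real.exp_pos (g (0,0)).re).le hc
    linarith
  obtain ⟨n, hn⟩ := Real.sin_eq_zero_iff.1 s00
  have hc' : Real.cos (g (0,0)).im = -1 := by
    rcases Real.sin_eq_zero_iff_cos_eq.1 s00 with h | h <;> linarith
  set A : ℝ := (g (0,0)).im - π with hA
  have hAs : ∀ v, Real.sin (v - A) = Real.sin v := by
    intro v
    have e1 : Real.cos A = 1 := by rw [hA, Real.cos_sub_pi, hc']; norm_num
    have e2 : Real.sin A = 0 := by rw [hA, Real.sin_sub_pi, s00]; norm_num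
    rw [Real.sin_sub, e1, e2]; ring
  have hAc : ∀ v, Real.cos (v - A) = Real.cos v := by
    intro v
    have e1 : Real.cos A = 1 := by rw [hA, Real.cos_sub_pi, hc']; norm_num
    have e2 : Real.sin A = 0 := by rw [hA, Real.sin_sub_pi, s00]; norm_num
    rw [Real.cos_sub, e1, e2]; ring
  have hsin : ∀ p, 0 ≤ (f p).im → 0 ≤ Real.sin ((g p).im - A) := by
    intro p hp
    rw [hAs]; rw [him] at hp
    exact nonneg_of_mul_nonneg_right hp (Real.exp_pos _)
  have hsin' : ∀ p, (f p).im ≤ 0 → 0 ≤ Real.sin ((g p).im - A - π) := by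
    intro p hp
    rw [Real.sin_sub_pi, hAs]; rw [him] at hp
    by_contra hc; push Not at hc
    have := mul_pos (Real.exp_pos (g p).re) (show 0 < Real.sin (g p).im by linarith)
    linarith
  -- bottom edge
  have E0 := sin_trap (fun s => (g (s,0)).im - A - π) (by fun_prop) (fun s => hsin' _ (by
    simp only [hf, hη0]; linarith [h1 s])) (by simp [hA, Real.pi_pos.le]) 1
  have E1 := sin_trap (fun r => (g (0,r)).im - A) (by fun_prop) (fun r => hsin _ (by
    simp only [hf, hγ0]; linarith [h3 r])) (by simp [hA, Real.pi_pos.le]) 1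
  have E2 := sin_trap (fun s => (g (s,1)).im - A) (by fun_prop) (fun s => hsin _ (by
    simp only [hf, hη1]; linarith [h2 s])) E1 1
  have E3 := sin_trap (fun r => (g (1,1-r)).im - A) (by fun_prop) (fun r => hsin _ (by
    simp only [hf, hγ1]; linarith [h3 (1-r)])) (by simpa using E2) 1
  simp only [sub_self, mem_Icc] at E3 E0
  have e : (g (1,0)).im - A = π := by linarith [E0.1, E3.2]
  have e2 := hAc (g (1,0)).im
  rw [e, Real.cos_pi] at e2
  rw [hre, ← e2] at f10r
  have := Real.exp_pos (g (1,0)).re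
  linarith

lemma cross_joined {S T : Set (ℝ × ℝ)} (t1 t0 y z y' x1 : ℝ) (hyz : y < z) (hzy : z < y')
    (hS : JoinedIn S (t0, y) (t0, y')) (hT : JoinedIn T (t0, z) (t1, x1))
    (h1 : ∀ p ∈ S, p.1 ≤ t0) (h2 : ∀ p ∈ S, t1 ≤ p.1) (h3 : ∀ p ∈ T, p.1 ≤ t0) :
    ∃ p, p ∈ S ∧ p ∈ T := by
  obtain ⟨γ, hγ⟩ := hS
  obtain ⟨η, hη⟩ := hT
  have hγ' : ∀ s, γ.extend s ∈ S := by
    intro s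
    have : γ.extend s ∈ range γ := by rw [← Path.extend_range]; exact mem_range_self s
    obtain ⟨r, hr⟩ := this; rw [← hr]; exact hγ r
  have hη' : ∀ s, η.extend s ∈ T := by
    intro s
    have : η.extend s ∈ range η := by rw [← Path.extend_range]; exact mem_range_self s
    obtain ⟨r, hr⟩ := this; rw [← hr]; exact hη r
  obtain ⟨s, s', h⟩ := cross_aux γ.extend η.extend γ.continuous_extend η.continuous_extend
    t1 t0 y z y' hyz hzy (by simp) (by simp) (by simp) (by simp) (fun s => h1 _ (hγ' s))
    (fun s => h2 _ (hγ' s)) (fun s => h3 _ (hη' s))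
  exact ⟨γ.extend s, hγ' s, h ▸ hη' s'⟩

open Real Set Filter

structure Sol (δ K : ℝ) (a b c u ut ux uxx : ℝ → ℝ → ℝ) : Prop where
  hδ : 0 < δ
  hK : 0 < K
  ha : ∀ t > (0:ℝ), ∀ x, δ ≤ a t x
  hb : ∀ t > (0:ℝ), ∀ x, |b t x| ≤ K
  hc0 : ∀ t > (0:ℝ), ∀ x, c t x ≤ 0
  hcK : ∀ t > (0:ℝ), ∀ x, |c t x| ≤ K
  cu : ContinuousOn (fun p : ℝ × ℝ => u p.1 p.2) (Set.Ioi 0 ×ˢ Set.univ)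
  cut : ContinuousOn (fun p : ℝ × ℝ => ut p.1 p.2) (Set.Ioi 0 ×ˢ Set.univ)
  cux : ContinuousOn (fun p : ℝ × ℝ => ux p.1 p.2) (Set.Ioi 0 ×ˢ Set.univ)
  cuxx : ContinuousOn (fun p : ℝ × ℝ => uxx p.1 p.2) (Set.Ioi 0 ×ˢ Set.univ)
  dt : ∀ t > (0:ℝ), ∀ x : ℝ, HasDerivAt (fun s => u s x) (ut t x) t
  dx : ∀ t > (0:ℝ), ∀ x : ℝ, HasDerivAt (fun y => u t y) (ux t x) x
  dxx : ∀ t > (0:ℝ), ∀ x : ℝ, HasDerivAt (fun y => ux t y) (uxx t x) x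
  eq : ∀ t > (0:ℝ), ∀ x : ℝ, ut t x = a t x * uxx t x + b t x * ux t x + c t x * u t x

lemma Sol.neg {δ K : ℝ} {a b c u ut ux uxx : ℝ → ℝ → ℝ} (h : Sol δ K a b c u ut ux uxx) :
    Sol δ K a b c (fun t x => - u t x) (fun t x => - ut t x) (fun t x => - ux t x)
      (fun t x => - uxx t x) where
  hδ := h.hδ
  hK := h.hK
  ha := h.ha
  hb := h.hb
  hc0 := h.hc0
  hcK := h.hcK
  cu := h.cu.neg
  cut := h.cut.neg
  cux := h.cux.neg
  cuxx := h.cuxx.neg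
  dt := fun t ht x => (h.dt t ht x).neg
  dx := fun t ht x => (h.dx t ht x).neg
  dxx := fun t ht x => (h.dxx t ht x).neg
  eq := fun t ht x => by rw [h.eq t ht x]; ring

lemma comp_open {B S : Set (ℝ × ℝ)} (hB : Convex ℝ B) (hSB : S ⊆ B)
    (hS : ∀ r ∈ S, ∃ ε > 0, Metric.ball r ε ∩ B ⊆ S) {x r : ℝ × ℝ} (h : JoinedIn S x r) :
    ∃ ε > 0, Metric.ball r ε ∩ B ⊆ {r | JoinedIn S x r} := by
  obtain ⟨ε, hε, hs⟩ := hS r h.target_mem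
  refine ⟨ε, hε, fun y hy => h.trans (JoinedIn.of_segment_subset ?_)⟩
  refine (((convex_ball r ε).inter hB).segment_subset ⟨Metric.mem_ball_self hε, hSB h.target_mem⟩ hy).trans hs

lemma comp_closed {B S : Set (ℝ × ℝ)} (hB : Convex ℝ B) (hSB : S ⊆ B)
    (hS : ∀ r ∈ S, ∃ ε > 0, Metric.ball r ε ∩ B ⊆ S) {x y : ℝ × ℝ} (hy : y ∈ S)
    (h : y ∈ closure {r | JoinedIn S x r}) : JoinedIn S x y := by
  obtain ⟨ε, hε, hs⟩ := hS y hy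
  obtain ⟨z, hz, hd⟩ := Metric.mem_closure_iff.1 h ε hε
  refine JoinedIn.trans hz (JoinedIn.of_segment_subset ?_)
  refine (((convex_ball y ε).inter hB).segment_subset ⟨?_, hSB hz.target_mem⟩
    ⟨Metric.mem_ball_self hε, hSB hy⟩).trans hs
  rwa [Metric.mem_ball, dist_comm]

lemma second_test {g g' : ℝ → ℝ} {g2 x : ℝ} (hg : ∀ y, HasDerivAt g (g' y) y)
    (hg' : HasDerivAt g' g2 x) (hmin : IsLocalMin g x) : g' x = 0 ∧ 0 ≤ g2 := by
  have h0 : g' x = 0 := hmin.hasDerivAt_eq_zero (hg x)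
  refine ⟨h0, ?_⟩
  by_contra hneg
  push Not at hneg
  have h1 := (hasDerivAt_iff_tendsto_slope.1 hg')
  have h2 : ∀ᶠ y in nhdsWithin x {x}ᶜ, slope g' x y < 0 := h1.eventually (gt_mem_nhds hneg)
  rw [eventually_nhdsWithin_iff] at h2
  obtain ⟨ε, hε, h3⟩ := Metric.eventually_nhds_iff_ball.1 (h2.and hmin)
  have h4 : StrictAntiOn g (Icc x (x + ε / 2)) := by
    apply strictAntiOn_of_deriv_neg (convex_Icc _ _)
    · exact fun y _ => (hg y).continuousAt.continuousWithinAt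
    · intro y hy
      rw [interior_Icc] at hy
      rw [(hg y).deriv]
      have := (h3 y (by rw [Metric.mem_ball, Real.dist_eq, abs_lt]; constructor <;> linarith [hy.1, hy.2])).1 (by simpa using hy.1.ne')
      rw [slope_def_field, h0, sub_zero] at this
      by_contra h5
      push Not at h5
      have : 0 ≤ g' y / (y - x) := div_nonneg h5 (by linarith [hy.1])
      linarith
  have h5 := h4 (left_mem_Icc.2 (by linarith)) (right_mem_Icc.2 (by linarith)) (by linarith)
  have h6 := (h3 (x + ε/2) (by rw [Metric.mem_ball, Real.dist_eq, abs_lt]; constructor <;> linarith)).2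
  linarith

lemma left_test {h : ℝ → ℝ} {h' t ε : ℝ} (hε : 0 < ε) (hd : HasDerivAt h h' t)
    (hm : ∀ s, t - ε < s → s < t → h t ≤ h s) : h' ≤ 0 := by
  have h1 : Tendsto (slope h t) (nhdsWithin t (Iio t)) (nhds h') :=
    (hasDerivAt_iff_tendsto_slope.1 hd).mono_left (nhdsWithin_mono _ (fun y hy => ne_of_lt hy))
  refine le_of_tendsto h1 ?_
  filter_upwards [Ioo_mem_nhdsLT (show t - ε < t by linarith)] with s hs
  rw [slope_def_field]
  exact div_nonpos_of_nonneg_of_nonpos (by linarith [hm s hs.1 hs.2]) (by linarith [hs.2])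

lemma rel_open {B : Set (ℝ × ℝ)} {f : ℝ × ℝ → ℝ} (hf : ContinuousOn f B) {d : ℝ} :
    ∀ r ∈ {r ∈ B | f r < d}, ∃ ε > 0, Metric.ball r ε ∩ B ⊆ {r ∈ B | f r < d} := by
  intro r hr
  have h := (hf r hr.1).eventually (gt_mem_nhds hr.2)
  obtain ⟨ε, hε, h⟩ := Metric.mem_nhdsWithin_iff.1 h
  exact ⟨ε, hε, fun y hy => ⟨hy.2, h hy⟩⟩

lemma box_sub {t1 t0 p q : ℝ} (h : 0 < t1) :
    Icc t1 t0 ×ˢ Icc p q ⊆ (Set.Ioi (0:ℝ) ×ˢ Set.univ : Set (ℝ × ℝ)) :=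
  fun r hr => ⟨lt_of_lt_of_le h hr.1.1, trivial⟩

lemma reach {δ K : ℝ} {a b c u ut ux uxx : ℝ → ℝ → ℝ} (hu : Sol δ K a b c u ut ux uxx)
    {t1 t0 p q z d : ℝ} (ht1 : 0 < t1) (ht : t1 < t0) (hK : K * (t0 - t1) < 1)
    (hz : z ∈ Icc p q) (hz0 : u t0 z ≤ 0) (hzd : u t0 z < d)
    (hs : ∀ s, s = p ∨ s = q → (∀ t ∈ Icc t1 t0, d ≤ u t s) ∨ (∀ t ∈ Icc t1 t0, u t s < d)) :
    ∃ x1, JoinedIn {r ∈ Icc t1 t0 ×ˢ Icc p q | u r.1 r.2 < d} (t0, z) (t1, x1) := by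
  set B : Set (ℝ × ℝ) := Icc t1 t0 ×ˢ Icc p q with hBdef
  set S : Set (ℝ × ℝ) := {r ∈ B | u r.1 r.2 < d} with hSdef
  have hpq : p ≤ q := hz.1.trans hz.2
  have hBc : Convex ℝ B := (convex_Icc _ _).prod (convex_Icc _ _)
  have hSB : S ⊆ B := fun r hr => hr.1
  have hcont : ContinuousOn (fun r : ℝ × ℝ => u r.1 r.2) B := hu.cu.mono (box_sub ht1)
  have hSo := rel_open (d := d) hcont
  by_contra hno
  push Not at hno
  set τ := t0 - t1 with hτ
  have hτ0 : 0 < τ := by simp only [hτ]; linarith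
  set κ := (d - u t0 z) / (2 * τ) with hκ
  have hκ0 : 0 < κ := by apply div_pos <;> linarith
  set G : Set (ℝ × ℝ) := {r | JoinedIn S (t0, z) r} with hG
  have hGB : G ⊆ B := fun r hr => hSB hr.target_mem
  have hBcomp : IsCompact B := isCompact_Icc.prod isCompact_Icc
  have hclB : closure G ⊆ B := closure_minimal hGB hBcomp.isClosed
  have hclc : IsCompact (closure G) := hBcomp.of_isClosed_subset isClosed_closure hclB
  have hz0S : (t0, z) ∈ S := ⟨⟨⟨ht.le, le_rfl⟩, hz⟩, hzd⟩
  have hz0G : (t0, z) ∈ G := JoinedIn.refl hz0S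
  set f : ℝ × ℝ → ℝ := fun r => u r.1 r.2 + κ * (r.1 - t1) with hf
  have hfc : ContinuousOn f (closure G) :=
    (hcont.mono hclB).add (by fun_prop)
  obtain ⟨r, hr, hrmin⟩ := hclc.exists_isMinOn ⟨_, subset_closure hz0G⟩ hfc
  have hrB := hclB hr
  have hfr : f r ≤ f (t0, z) := hrmin (subset_closure hz0G)
  have hκτ : κ * τ = (d - u t0 z) / 2 := by rw [hκ]; field_simp
  have hfr' : u r.1 r.2 + κ * (r.1 - t1) ≤ u t0 z + κ * τ := hfr
  have hrt : 0 ≤ κ * (r.1 - t1) := mul_nonneg hκ0.le (by linarith [hrB.1.1])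
  have hrS : r ∈ S := ⟨hrB, by linarith⟩
  have hrG : JoinedIn S (t0, z) r := comp_closed hBc hSB hSo hrS hr
  obtain ⟨ε, hε, hball⟩ := comp_open hBc hSB hSo hrG
  obtain ⟨rt, rx⟩ := r
  have hrt1 : rt ≠ t1 := by
    intro h; subst h
    exact hno rx hrG
  have hrt1' : t1 < rt := lt_of_le_of_ne hrB.1.1 (Ne.symm hrt1)
  have hside : ∀ s, s = p ∨ s = q → rx ≠ s := by
    intro s hsp h
    subst h
    have hlt : ∀ t ∈ Icc t1 t0, u t rx < d := by
      rcases hs rx hsp with h | h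
      · exact absurd hrS.2 (not_lt.2 (h rt hrB.1))
      · exact h
    refine hno rx (hrG.trans (JoinedIn.of_segment_subset ?_))
    intro y hy
    have h1 : segment ℝ (rt, rx) (t1, rx) ⊆ Icc t1 t0 ×ˢ {rx} :=
      ((convex_Icc t1 t0).prod (convex_singleton rx)).segment_subset
        ⟨hrB.1, rfl⟩ ⟨⟨le_rfl, ht.le⟩, rfl⟩
    have h2 := h1 hy
    have h3 : y.2 = rx := h2.2
    exact ⟨⟨h2.1, h3 ▸ hrB.2⟩, by rw [h3]; exact hlt _ h2.1⟩
  have hp : p < rx := lt_of_le_of_ne hrB.2.1 (Ne.symm (hside p (Or.inl rfl)))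
  have hq : rx < q := lt_of_le_of_ne hrB.2.2 (hside q (Or.inr rfl))
  have hrt0 : 0 < rt := ht1.trans hrt1'
  have key : ∀ y ∈ Metric.ball (rt, rx) ε ∩ B, f (rt, rx) ≤ f y := fun y hy =>
    hrmin (subset_closure (hball hy))
  -- x direction
  have hmin : IsLocalMin (fun y => u rt y) rx := by
    have h1 : Ioo p q ∈ nhds rx := Ioo_mem_nhds hp hq
    filter_upwards [h1, Metric.ball_mem_nhds rx hε] with y hy1 hy2
    have := key (rt, y) ⟨by
      rw [Metric.mem_ball, Prod.dist_eq]; simpa [hε] using hy2, ⟨hrB.1, ⟨hy1.1.le, hy1.2.le⟩⟩⟩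
    simp only [hf] at this
    linarith
  obtain ⟨hx0, hxx0⟩ := second_test (fun y => hu.dx rt hrt0 y) (hu.dxx rt hrt0 rx) hmin
  have htd : ut rt rx + κ ≤ 0 := by
    have hd : HasDerivAt (fun s => u s rx + κ * (s - t1)) (ut rt rx + κ) rt := by
      have := (hu.dt rt hrt0 rx).add (((hasDerivAt_id' rt).sub_const t1).const_mul κ)
      rw [mul_one] at this
      exact this
    refine left_test (ε := min ε (rt - t1)) (lt_min hε (by linarith)) hd ?_
    intro s hs1 hs2
    have e1 := min_le_left ε (rt - t1)
    have e2 := min_le_right ε (rt - t1)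
    exact key (s, rx) ⟨by
      rw [Metric.mem_ball, Prod.dist_eq]
      simp only [dist_self, Real.dist_eq]
      rw [max_lt_iff]
      exact ⟨by rw [abs_lt]; constructor <;> linarith, hε⟩,
      ⟨⟨by linarith, by linarith [hrB.1.2]⟩, hrB.2⟩⟩
  have heq := hu.eq rt hrt0 rx
  rw [hx0] at heq
  have h1 : 0 ≤ a rt rx * uxx rt rx := mul_nonneg (hu.hδ.le.trans (hu.ha _ hrt0 _)) hxx0
  have hc0 := hu.hc0 rt hrt0 rx
  have hcK := abs_le.1 (hu.hcK rt hrt0 rx)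
  rcases le_or_gt (u rt rx) 0 with h | h
  · nlinarith
  · simp only at hfr' hrt
    have h2 : u rt rx ≤ κ * τ := by linarith
    have h3 : -c rt rx * u rt rx ≤ K * (κ * τ) := by
      apply mul_le_mul <;> linarith [hu.hK]
    have h4 : K * (κ * τ) < κ := by nlinarith
    nlinarith

open Real Set Filter

lemma seg_h {P : Set (ℝ × ℝ)} {t x x' : ℝ} (h : ∀ y ∈ uIcc x x', (t, y) ∈ P) :
    JoinedIn P (t, x) (t, x') := by
  refine JoinedIn.of_segment_subset ?_
  intro y hy
  have h1 : segment ℝ (t, x) (t, x') ⊆ {t} ×ˢ uIcc x x' :=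
    ((convex_singleton t).prod (convex_uIcc x x')).segment_subset
      ⟨rfl, left_mem_uIcc⟩ ⟨rfl, right_mem_uIcc⟩
  have h2 := h1 hy
  obtain ⟨y1, y2⟩ := y
  have h3 : y1 = t := h2.1
  subst h3
  exact h _ h2.2

lemma seg_v {P : Set (ℝ × ℝ)} {t t' x : ℝ} (h : ∀ s ∈ uIcc t t', (s, x) ∈ P) :
    JoinedIn P (t, x) (t', x) := by
  refine JoinedIn.of_segment_subset ?_
  intro y hy
  have h1 : segment ℝ (t, x) (t', x) ⊆ uIcc t t' ×ˢ {x} :=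
    ((convex_uIcc t t').prod (convex_singleton x)).segment_subset
      ⟨left_mem_uIcc, rfl⟩ ⟨right_mem_uIcc, rfl⟩
  have h2 := h1 hy
  obtain ⟨y1, y2⟩ := y
  have h3 : y2 = x := h2.2
  subst h3
  exact h _ h2.1

lemma join_edge {P : Set (ℝ × ℝ)} {t x t' x' e : ℝ} (h1 : ∀ y ∈ uIcc x e, (t, y) ∈ P)
    (h2 : ∀ s ∈ uIcc t t', (s, e) ∈ P) (h3 : ∀ y ∈ uIcc x' e, (t', y) ∈ P) :
    JoinedIn P (t, x) (t', x') :=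
  (seg_h h1).trans ((seg_v h2).trans (seg_h h3).symm)

lemma pos_nhd {f : ℝ → ℝ → ℝ}
    (hf : ContinuousOn (fun p : ℝ × ℝ => f p.1 p.2) (Set.Ioi 0 ×ˢ Set.univ)) {t x : ℝ}
    (ht : 0 < t) (h : 0 < f t x) :
    ∃ ε > 0, ε < t ∧ ∀ s y, |s - t| ≤ ε → |y - x| ≤ ε → 0 < f s y := by
  have hm : (Set.Ioi 0 ×ˢ Set.univ : Set (ℝ × ℝ)) ∈ nhds (t, x) :=
    (isOpen_Ioi.prod isOpen_univ).mem_nhds ⟨ht, trivial⟩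
  have h1 := (hf.continuousAt hm).eventually (lt_mem_nhds h)
  obtain ⟨ε, hε, h2⟩ := Metric.eventually_nhds_iff_ball.1 h1
  have e1 := min_le_left (ε/2) (t/2)
  have e2 := min_le_right (ε/2) (t/2)
  refine ⟨min (ε/2) (t/2), lt_min (by linarith) (by linarith), by linarith, ?_⟩
  intro s y hs hy
  refine h2 (s, y) ?_
  rw [Metric.mem_ball, Prod.dist_eq, max_lt_iff, Real.dist_eq, Real.dist_eq]
  constructor <;> simp only <;> linarith

lemma mono_nn {f f' : ℝ → ℝ} {x y : ℝ} (hxy : x ≤ y) (hf : ∀ z ∈ Icc x y, HasDerivAt f (f' z) z)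
    (h : ∀ z ∈ Icc x y, 0 ≤ f' z) : f x ≤ f y := by
  have : MonotoneOn f (Icc x y) := by
    apply monotoneOn_of_deriv_nonneg (convex_Icc _ _)
    · exact fun z hz => (hf z hz).continuousAt.continuousWithinAt
    · intro z hz
      rw [interior_Icc] at hz
      exact (hf z ⟨hz.1.le, hz.2.le⟩).differentiableAt.differentiableWithinAt
    · intro z hz
      rw [interior_Icc] at hz
      rw [(hf z ⟨hz.1.le, hz.2.le⟩).deriv]
      exact h z ⟨hz.1.le, hz.2.le⟩
  exact this (left_mem_Icc.2 hxy) (right_mem_Icc.2 hxy) hxy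

lemma mono_np {f f' : ℝ → ℝ} {x y : ℝ} (hxy : x ≤ y) (hf : ∀ z ∈ Icc x y, HasDerivAt f (f' z) z)
    (h : ∀ z ∈ Icc x y, f' z ≤ 0) : f y ≤ f x := by
  have := mono_nn (f := fun z => - f z) (f' := fun z => - f' z) hxy (fun z hz => (hf z hz).neg)
    (fun z hz => by linarith [h z hz])
  linarith

lemma mono_pos {f f' : ℝ → ℝ} {x y : ℝ} (hxy : x < y) (hf : ∀ z ∈ Icc x y, HasDerivAt f (f' z) z)
    (h : ∀ z ∈ Ioo x y, 0 < f' z) : f x < f y := by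
  have : StrictMonoOn f (Icc x y) := by
    apply strictMonoOn_of_deriv_pos (convex_Icc _ _)
    · exact fun z hz => (hf z hz).continuousAt.continuousWithinAt
    · intro z hz
      rw [interior_Icc] at hz
      rw [(hf z ⟨hz.1.le, hz.2.le⟩).deriv]
      exact h z hz
  exact this (left_mem_Icc.2 hxy.le) (right_mem_Icc.2 hxy.le) hxy

lemma mono_neg {f f' : ℝ → ℝ} {x y : ℝ} (hxy : x < y) (hf : ∀ z ∈ Icc x y, HasDerivAt f (f' z) z)
    (h : ∀ z ∈ Ioo x y, f' z < 0) : f y < f x := by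
  have := mono_pos (f := fun z => - f z) (f' := fun z => - f' z) hxy (fun z hz => (hf z hz).neg)
    (fun z hz => by linarith [h z hz])
  linarith

lemma loc_fin {δ K : ℝ} {a b c u ut ux uxx : ℝ → ℝ → ℝ} (hu : Sol δ K a b c u ut ux uxx)
    {t1 t0 p q : ℝ} (ht1 : 0 < t1)
    (hs : ∀ t ∈ Icc t1 t0, u t p ≠ 0 ∧ u t q ≠ 0)
    {gt gx : ℝ} (hgt : gt ∈ Icc t1 t0) (hgx : gx ∈ Icc p q)
    (hg : ¬ (u gt gx = 0 ∧ ux gt gx = 0 ∧ uxx gt gx = 0)) :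
    ∃ ε > 0, ∃ col : ℝ × ℝ → Bool, ∀ r r' : ℝ × ℝ, r ∈ Icc t1 t0 ×ˢ Icc p q →
      r' ∈ Icc t1 t0 ×ˢ Icc p q → dist r (gt, gx) < ε → dist r' (gt, gx) < ε →
      0 < u r.1 r.2 → 0 < u r'.1 r'.2 → col r = col r' →
      JoinedIn {y ∈ Icc t1 t0 ×ˢ Icc p q | 0 < u y.1 y.2} r r' := by
  have hgt0 : 0 < gt := ht1.trans_le hgt.1
  set P : Set (ℝ × ℝ) := {y ∈ Icc t1 t0 ×ˢ Icc p q | 0 < u y.1 y.2} with hP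
  rcases lt_trichotomy (u gt gx) 0 with h0 | h0 | h0
  · obtain ⟨ε, hε, -, h⟩ := pos_nhd (f := fun t x => - u t x) hu.cu.neg hgt0 (by linarith : 0 < - u gt gx)
    refine ⟨ε, hε, fun _ => true, ?_⟩
    intro r r' _ _ hr _ hur
    rw [Prod.dist_eq, max_lt_iff, Real.dist_eq, Real.dist_eq] at hr
    have := h r.1 r.2 hr.1.le hr.2.le
    linarith
  swap
  · obtain ⟨ε, hε, -, h⟩ := pos_nhd hu.cu hgt0 h0
    refine ⟨ε, hε, fun _ => true, ?_⟩
    intro r r' hrB hrB' hr hr' _ _ _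
    refine JoinedIn.of_segment_subset ?_
    intro y hy
    have hc : Convex ℝ (Metric.ball (gt, gx) ε ∩ Icc t1 t0 ×ˢ Icc p q) :=
      (convex_ball _ _).inter ((convex_Icc _ _).prod (convex_Icc _ _))
    have h2 := hc.segment_subset ⟨hr, hrB⟩ ⟨hr', hrB'⟩ hy
    refine ⟨h2.2, ?_⟩
    have h3 := h2.1
    rw [Metric.mem_ball, Prod.dist_eq, max_lt_iff, Real.dist_eq, Real.dist_eq] at h3
    exact h y.1 y.2 h3.1.le h3.2.le
  have hgp : p < gx := lt_of_le_of_ne hgx.1 (by rintro rfl; exact (hs gt hgt).1 h0)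
  have hgq : gx < q := lt_of_le_of_ne hgx.2 (by rintro rfl; exact (hs gt hgt).2 h0)
  -- generic right-edge statement
  have right : ∀ ε > 0, gx + ε < q → 0 < u gt (gx + ε) → ∃ η > 0, η ≤ ε ∧ η < gt ∧
      ∀ t ∈ Icc t1 t0, |t - gt| ≤ η → (t, gx + ε) ∈ P := by
    intro ε hε hq hpos
    obtain ⟨η, hη, hη2, h⟩ := pos_nhd hu.cu hgt0 hpos
    refine ⟨min η ε, lt_min hη hε, min_le_right _ _, (min_le_left _ _).trans_lt hη2, ?_⟩
    intro t ht htη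
    exact ⟨⟨ht, by linarith, hq.le⟩, h t _ (htη.trans (min_le_left _ _)) (by simpa using hη.le)⟩
  have left : ∀ ε > 0, p < gx - ε → 0 < u gt (gx - ε) → ∃ η > 0, η ≤ ε ∧ η < gt ∧
      ∀ t ∈ Icc t1 t0, |t - gt| ≤ η → (t, gx - ε) ∈ P := by
    intro ε hε hq hpos
    obtain ⟨η, hη, hη2, h⟩ := pos_nhd hu.cu hgt0 hpos
    refine ⟨min η ε, lt_min hη hε, min_le_right _ _, (min_le_left _ _).trans_lt hη2, ?_⟩
    intro t ht htη
    exact ⟨⟨ht, hq.le, by simp only; linarith⟩, h t _ (htη.trans (min_le_left _ _)) (by simpa using hη.le)⟩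
  have edge : ∀ e η, (∀ t ∈ Icc t1 t0, |t - gt| ≤ η → (t, e) ∈ P) → ∀ t t' x x', t ∈ Icc t1 t0 →
      t' ∈ Icc t1 t0 → |t - gt| < η → |t' - gt| < η → (∀ y ∈ uIcc x e, (t, y) ∈ P) → 
      (∀ y ∈ uIcc x' e, (t', y) ∈ P) → JoinedIn P (t, x) (t', x') := by
    intro e η he t t' x x' ht ht' htη htη' h1 h2
    refine join_edge h1 ?_ h2
    intro s hs
    refine he s ?_ ?_
    · rw [← uIcc_of_le (hgt.1.trans hgt.2)] at ht ht' ⊢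
      exact uIcc_subset_uIcc ht ht' hs
    · have e1 : t ∈ uIcc (gt - η) (gt + η) := by
        rw [abs_lt] at htη; rw [mem_uIcc]; left; constructor <;> linarith
      have e2 : t' ∈ uIcc (gt - η) (gt + η) := by
        rw [abs_lt] at htη'; rw [mem_uIcc]; left; constructor <;> linarith
      have e3 := uIcc_subset_uIcc e1 e2 hs
      rw [uIcc_of_le (by linarith [(abs_nonneg _).trans_lt htη])] at e3
      rw [abs_le]; constructor <;> linarith [e3.1, e3.2]
  -- horizontal motion
  have goR : ∀ t x e, t ∈ Icc t1 t0 → x ∈ Icc p q → x ≤ e → e ≤ q → 0 < u t x →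
      (∀ y ∈ Icc x e, 0 ≤ ux t y) → ∀ y ∈ uIcc x e, (t, y) ∈ P := by
    intro t x e ht hx hxe he hpos hd y hy
    rw [uIcc_of_le hxe] at hy
    refine ⟨⟨ht, hx.1.trans hy.1, hy.2.trans he⟩, hpos.trans_le ?_⟩
    exact mono_nn (f := u t) hy.1 (fun z _ => hu.dx t (ht1.trans_le ht.1) z)
      (fun z hz => hd z ⟨hz.1, hz.2.trans hy.2⟩)
  have goL : ∀ t x e, t ∈ Icc t1 t0 → x ∈ Icc p q → e ≤ x → p ≤ e → 0 < u t x →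
      (∀ y ∈ Icc e x, ux t y ≤ 0) → ∀ y ∈ uIcc x e, (t, y) ∈ P := by
    intro t x e ht hx hxe he hpos hd y hy
    rw [uIcc_of_ge hxe] at hy
    refine ⟨⟨ht, he.trans hy.1, hy.2.trans hx.2⟩, hpos.trans_le ?_⟩
    exact mono_np (f := u t) hy.2 (fun z _ => hu.dx t (ht1.trans_le ht.1) z)
      (fun z hz => hd z ⟨hy.1.trans hz.1, hz.2⟩)
  have shrink : ∀ ε > 0, ∃ ε' > 0, ε' ≤ ε ∧ p < gx - ε' ∧ gx + ε' < q := by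
    intro ε hε
    refine ⟨min ε (min ((gx - p)/2) ((q - gx)/2)), lt_min hε (lt_min (by linarith) (by linarith)), min_le_left _ _, ?_, ?_⟩
    · have := (min_le_right ε (min ((gx - p)/2) ((q - gx)/2))).trans (min_le_left _ _)
      linarith
    · have := (min_le_right ε (min ((gx - p)/2) ((q - gx)/2))).trans (min_le_right _ _)
      linarith
  rcases lt_trichotomy (ux gt gx) 0 with hx0 | hx0 | hx0
  · obtain ⟨ε0, hε0, -, h⟩ := pos_nhd (f := fun t x => - ux t x) hu.cux.neg hgt0 (by linarith : 0 < - ux gt gx)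
    obtain ⟨ε, hε, hle, hp, hq⟩ := shrink ε0 hε0
    have : u gt gx < u gt (gx - ε) := by
      refine mono_neg (f := u gt) (by linarith) (fun z _ => hu.dx gt hgt0 z) (fun z hz => ?_)
      have := h gt z (by simpa using hε0.le) (by rw [abs_le]; constructor <;> linarith [hz.1, hz.2])
      linarith
    obtain ⟨η, hη, hηε, hη2, he⟩ := left ε hε hp (by linarith)
    refine ⟨η, hη, fun _ => true, ?_⟩
    rintro ⟨t, x⟩ ⟨t', x'⟩ hr hr' hd hd' hpos hpos' -
    rw [Prod.dist_eq, max_lt_iff, Real.dist_eq, Real.dist_eq] at hd hd'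
    simp only at hd hd' hpos hpos'
    have hxa := abs_lt.1 hd.2
    have hxa' := abs_lt.1 hd'.2
    refine edge _ _ he _ _ _ _ hr.1 hr'.1 hd.1 hd'.1 (goL _ _ _ hr.1 hr.2 ?_ hp.le hpos ?_)
      (goL _ _ _ hr'.1 hr'.2 ?_ hp.le hpos' ?_)
    · linarith
    · intro y hy
      have := h t y (by linarith) (by rw [abs_le]; constructor <;> linarith [hy.1, hy.2])
      linarith
    · linarith
    · intro y hy
      have := h t' y (by linarith) (by rw [abs_le]; constructor <;> linarith [hy.1, hy.2])
      linarith
  swap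
  · obtain ⟨ε0, hε0, -, h⟩ := pos_nhd hu.cux hgt0 hx0
    obtain ⟨ε, hε, hle, hp, hq⟩ := shrink ε0 hε0
    have : u gt gx < u gt (gx + ε) := by
      refine mono_pos (f := u gt) (by linarith) (fun z _ => hu.dx gt hgt0 z) (fun z hz => ?_)
      exact h gt z (by simpa using hε0.le) (by rw [abs_le]; constructor <;> linarith [hz.1, hz.2])
    obtain ⟨η, hη, hηε, hη2, he⟩ := right ε hε hq (by linarith)
    refine ⟨η, hη, fun _ => true, ?_⟩
    rintro ⟨t, x⟩ ⟨t', x'⟩ hr hr' hd hd' hpos hpos' -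
    rw [Prod.dist_eq, max_lt_iff, Real.dist_eq, Real.dist_eq] at hd hd'
    simp only at hd hd' hpos hpos'
    have hxa := abs_lt.1 hd.2
    have hxa' := abs_lt.1 hd'.2
    refine edge _ _ he _ _ _ _ hr.1 hr'.1 hd.1 hd'.1 (goR _ _ _ hr.1 hr.2 ?_ hq.le hpos ?_)
      (goR _ _ _ hr'.1 hr'.2 ?_ hq.le hpos' ?_)
    · linarith
    · intro y hy
      exact (h t y (by linarith) (by rw [abs_le]; constructor <;> linarith [hy.1, hy.2])).le
    · linarith
    · intro y hy
      exact (h t' y (by linarith) (by rw [abs_le]; constructor <;> linarith [hy.1, hy.2])).le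
  have hxx : uxx gt gx ≠ 0 := fun h => hg ⟨h0, hx0, h⟩
  rcases lt_or_gt_of_ne hxx with hxx | hxx
  · -- concave case
    have hut : ut gt gx < 0 := by
      rw [hu.eq gt hgt0, hx0, h0]
      have := mul_neg_of_pos_of_neg (hu.hδ.trans_le (hu.ha gt hgt0 gx)) hxx
      linarith
    obtain ⟨ε0, hε0, -, h⟩ := pos_nhd (f := fun t x => - uxx t x) hu.cuxx.neg hgt0 (by linarith : 0 < - uxx gt gx)
    obtain ⟨ε1, hε1, -, h'⟩ := pos_nhd (f := fun t x => - ut t x) hu.cut.neg hgt0 (by linarith : 0 < - ut gt gx)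
    obtain ⟨ε, hε, hle, hp, hq⟩ := shrink (min ε0 ε1) (lt_min hε0 hε1)
    have hle0 := hle.trans (min_le_left _ _)
    have hle1 := hle.trans (min_le_right _ _)
    refine ⟨ε, hε, fun _ => true, ?_⟩
    rintro ⟨t, x⟩ ⟨t', x'⟩ hr hr' hd hd' hpos hpos' -
    rw [Prod.dist_eq, max_lt_iff, Real.dist_eq, Real.dist_eq] at hd hd'
    simp only at hd hd' hpos hpos'
    set τ := max t1 (gt - ε) with hτ
    have hτ1 : t1 ≤ τ := le_max_left _ _
    have hτ2 : gt - ε ≤ τ := le_max_right _ _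
    have hτ3 : τ ≤ gt := max_le hgt.1 (by linarith)
    have down : ∀ t x, t ∈ Icc t1 t0 → x ∈ Icc p q → |t - gt| < ε → |x - gx| < ε → 0 < u t x →
        (∀ s ∈ uIcc t τ, (s, x) ∈ P) := by
      intro t x ht hx hta hxa hpos s hs
      have hta' := abs_lt.1 hta
      have : τ ≤ t := max_le ht.1 (by linarith)
      rw [uIcc_of_ge this] at hs
      refine ⟨⟨⟨hτ1.trans hs.1, hs.2.trans ht.2⟩, hx⟩, hpos.trans_le ?_⟩
      refine mono_np (f := fun s => u s x) hs.2 (fun z hz => hu.dt z (by linarith [hz.1, hs.1]) x) ?_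
      intro z hz
      have := h' z x (by rw [abs_le]; constructor <;> linarith [hz.1, hs.1, hz.2, hs.2]) (by linarith)
      linarith
    have d1 := down t x hr.1 hr.2 hd.1 hd.2 hpos
    have d2 := down t' x' hr'.1 hr'.2 hd'.1 hd'.2 hpos'
    refine (seg_v d1).trans (JoinedIn.trans (seg_h ?_) (seg_v d2).symm)
    have hconc : ConcaveOn ℝ (Icc (gx - ε) (gx + ε)) (u τ) := by
      refine concaveOn_of_hasDerivWithinAt2_nonpos (f' := ux τ) (f'' := uxx τ) (convex_Icc _ _) ?_ ?_ ?_ ?_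
      · exact fun z _ => (hu.dx τ (by linarith) z).continuousAt.continuousWithinAt
      · exact fun z _ => (hu.dx τ (by linarith) z).hasDerivWithinAt
      · exact fun z _ => (hu.dxx τ (by linarith) z).hasDerivWithinAt
      · intro z hz
        rw [interior_Icc] at hz
        have := h τ z (by rw [abs_le]; constructor <;> linarith) (by rw [abs_le]; constructor <;> linarith [hz.1, hz.2])
        linarith
    have hxa := abs_lt.1 hd.2
    have hxa' := abs_lt.1 hd'.2
    have hcv := hconc.convex_gt 0
    have m1 : x ∈ {x ∈ Icc (gx - ε) (gx + ε) | 0 < u τ x} :=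
      ⟨⟨by linarith, by linarith⟩, (d1 τ right_mem_uIcc).2⟩
    have m2 : x' ∈ {x ∈ Icc (gx - ε) (gx + ε) | 0 < u τ x} :=
      ⟨⟨by linarith, by linarith⟩, (d2 τ right_mem_uIcc).2⟩
    intro y hy
    rw [← segment_eq_uIcc] at hy
    have m3 := hcv.segment_subset m1 m2 hy
    exact ⟨⟨⟨hτ1, hτ3.trans hgt.2⟩, by linarith [m3.1.1], by simp only; linarith [m3.1.2]⟩, m3.2⟩
  · -- convex case
    obtain ⟨ε0, hε0, -, h⟩ := pos_nhd hu.cuxx hgt0 hxx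
    obtain ⟨ε, hε, hle, hp, hq⟩ := shrink ε0 hε0
    have uxR : ∀ t x y, 0 < t → |t - gt| ≤ ε → gx - ε ≤ x → x < y → y ≤ gx + ε → ux t x < ux t y := by
      intro t x y ht0 hta h1 h2 h3
      refine mono_pos (f := ux t) h2 (fun z _ => hu.dxx t ht0 z) ?_
      intro z hz
      exact h t z (hta.trans hle) (by rw [abs_le]; constructor <;> linarith [hz.1, hz.2])
    have r1 : u gt gx < u gt (gx + ε) := by
      refine mono_pos (f := u gt) (by linarith) (fun z _ => hu.dx gt hgt0 z) (fun z hz => ?_)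
      have := uxR gt gx z hgt0 (by simpa using hε.le) (by linarith) hz.1 hz.2.le
      linarith
    have r2 : u gt gx < u gt (gx - ε) := by
      refine mono_neg (f := u gt) (by linarith) (fun z _ => hu.dx gt hgt0 z) (fun z hz => ?_)
      have := uxR gt z gx hgt0 (by simpa using hε.le) hz.1.le hz.2 (by linarith)
      linarith
    obtain ⟨η1, hη1, hηε1, hη21, he1⟩ := right ε hε hq (by linarith)
    obtain ⟨η2, hη2, hηε2, hη22, he2⟩ := left ε hε hp (by linarith)
    have m1 := min_le_left η1 η2
    have m2 := min_le_right η1 η2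
    classical
    refine ⟨min η1 η2, lt_min hη1 hη2, fun r => decide (0 ≤ ux r.1 r.2), ?_⟩
    rintro ⟨t, x⟩ ⟨t', x'⟩ hr hr' hd hd' hpos hpos' hcol
    rw [Prod.dist_eq, max_lt_iff, Real.dist_eq, Real.dist_eq] at hd hd'
    simp only [decide_eq_decide] at hd hd' hpos hpos' hcol
    have hxa := abs_lt.1 hd.2
    have hxa' := abs_lt.1 hd'.2
    have ht0 : 0 < t := ht1.trans_le hr.1.1
    have ht0' : 0 < t' := ht1.trans_le hr'.1.1
    rcases le_or_gt 0 (ux t x) with hs1 | hs1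
    · have hs2 := hcol.1 hs1
      have aux : ∀ t x, 0 < t → |t - gt| ≤ ε → gx - ε ≤ x → 0 ≤ ux t x → ∀ y ∈ Icc x (gx + ε), 0 ≤ ux t y := by
        intro t x ht0 hta h1 h2 y hy
        rcases eq_or_lt_of_le hy.1 with h3 | h3
        · rwa [← h3]
        · exact h2.trans (uxR t x y ht0 hta h1 h3 hy.2).le
      exact edge _ _ he1 _ _ _ _ hr.1 hr'.1 (by linarith) (by linarith)
        (goR _ _ _ hr.1 hr.2 (by linarith) hq.le hpos (aux t x ht0 (by linarith) (by linarith) hs1))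
        (goR _ _ _ hr'.1 hr'.2 (by linarith) hq.le hpos' (aux t' x' ht0' (by linarith) (by linarith) hs2))
    · have hs2 : ux t' x' < 0 := by
        by_contra hc; push Not at hc; linarith [hcol.2 hc]
      have aux : ∀ t x, 0 < t → |t - gt| ≤ ε → x ≤ gx + ε → ux t x ≤ 0 → ∀ y ∈ Icc (gx - ε) x, ux t y ≤ 0 := by
        intro t x ht0 hta h1 h2 y hy
        rcases eq_or_lt_of_le hy.2 with h3 | h3
        · rwa [h3]
        · exact (uxR t y x ht0 hta hy.1 h3 h1).le.trans h2
      exact edge _ _ he2 _ _ _ _ hr.1 hr'.1 (by linarith) (by linarith)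
        (goL _ _ _ hr.1 hr.2 (by linarith) hp.le hpos (aux t x ht0 (by linarith) (by linarith) hs1.le))
        (goL _ _ _ hr'.1 hr'.2 (by linarith) hp.le hpos' (aux t' x' ht0' (by linarith) (by linarith) hs2.le))

open Real Set Filter

lemma notjoined_core {δ K : ℝ} {a b c u ut ux uxx : ℝ → ℝ → ℝ} (hu : Sol δ K a b c u ut ux uxx)
    {t1 t0 p q : ℝ} (ht1 : 0 < t1) (ht : t1 < t0) (hK : K * (t0 - t1) < 1)
    (hs : ∀ s, s = p ∨ s = q → (∀ t ∈ Icc t1 t0, 0 < u t s) ∨ (∀ t ∈ Icc t1 t0, u t s < 0))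
    {Y : Set ℝ} (hY : Y.Infinite) (hYpq : Y ⊆ Ioo p q) (hYpos : ∀ y ∈ Y, 0 < u t0 y)
    (hYz : ∀ y ∈ Y, ∀ y' ∈ Y, y < y' → ∃ z ∈ Ioo y y', u t0 z = 0) :
    ¬ JoinedIn {r ∈ Icc t1 t0 ×ˢ Icc p q | ¬ (u r.1 r.2 = 0 ∧ ux r.1 r.2 = 0 ∧ uxx r.1 r.2 = 0)}
      (t0, p) (t0, q) := by
  rintro ⟨γ, hγ⟩
  set P : Set (ℝ × ℝ) := {y ∈ Icc t1 t0 ×ˢ Icc p q | 0 < u y.1 y.2} with hP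
  have hγc : IsCompact (range γ) := isCompact_range γ.continuous
  have h1 : ∀ y : Y, ∃ g, g ∈ range γ ∧ JoinedIn P (t0, (y:ℝ)) g := by
    intro y
    have hy := hYpq y.2
    have hpos := hYpos y y.2
    obtain ⟨x1, hx1⟩ := reach hu.neg (p := p) (q := q) (z := y) (d := 0) ht1 ht hK ⟨hy.1.le, hy.2.le⟩
      (by linarith) (by linarith) (by
        intro s hs'
        rcases hs s hs' with h | h
        · right; intro t ht; have := h t ht; linarith
        · left; intro t ht; have := h t ht; linarith)
    have hx1' : JoinedIn P (t0, (y:ℝ)) (t1, x1) := hx1.mono (fun r hr => ⟨hr.1, by linarith [hr.2]⟩)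
    have hT : JoinedIn (pathComponentIn P (t0, (y:ℝ))) (t0, (y:ℝ)) (t1, x1) :=
      (isPathConnected_pathComponentIn hx1'.source_mem).joinedIn _
        (mem_pathComponentIn_self hx1'.source_mem) _ hx1'
    obtain ⟨g, hg1, hg2⟩ := cross_joined (S := range γ) t1 t0 p y q x1 hy.1 hy.2
      ⟨γ, fun t => mem_range_self t⟩ hT
      (by rintro _ ⟨t, rfl⟩; exact (hγ t).1.1.2) (by rintro _ ⟨t, rfl⟩; exact (hγ t).1.1.1)
      (fun r hr => (JoinedIn.target_mem hr).1.1.2)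
    exact ⟨g, hg1, hg2⟩
  choose g hg1 hg2 using h1
  have : Infinite Y := hY.to_subtype
  obtain ⟨g0, hg0, hcl⟩ := hγc (f := map g cofinite) (by
    rw [le_principal_iff]
    exact mem_map.2 (Filter.univ_mem' hg1))
  obtain ⟨tt, rfl⟩ := hg0
  have hg0 := hγ tt
  obtain ⟨ε, hε, col, hcol⟩ := loc_fin hu ht1 (p := p) (q := q) (by
    intro t ht
    constructor
    · rcases hs p (Or.inl rfl) with h | h
      · exact (h t ht).ne'
      · exact (h t ht).ne
    · rcases hs q (Or.inr rfl) with h | h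
      · exact (h t ht).ne'
      · exact (h t ht).ne) hg0.1.1 hg0.1.2 hg0.2
  have hfreq : ∃ᶠ y in cofinite, dist (g y) (γ tt) < ε := by
    have : MapClusterPt (γ tt) cofinite g := hcl
    exact this.frequently (Metric.ball_mem_nhds _ hε)
  rw [frequently_cofinite_iff_infinite] at hfreq
  obtain ⟨y, hy, y', hy', hne, hc⟩ := hfreq.exists_ne_map_eq_of_mapsTo
    (f := fun y => col (g y)) (t := univ) (fun _ _ => trivial) finite_univ
  have main : ∀ y y' : Y, dist (g y) (γ tt) < ε → dist (g y') (γ tt) < ε → col (g y) = col (g y') →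
      (y:ℝ) < y' → False := by
    intro y y' hy hy' hc hlt
    have hB : ∀ y, g y ∈ P := fun y => (hg2 y).target_mem
    have hj : JoinedIn P (t0, (y:ℝ)) (t0, (y':ℝ)) :=
      ((hg2 y).trans (hcol _ _ (hB y).1 (hB y').1 hy hy' (hB y).2 (hB y').2 hc)).trans (hg2 y').symm
    obtain ⟨γ2, hγ2⟩ := hj
    obtain ⟨z, hz, hz0⟩ := hYz y y.2 y' y'.2 hlt
    have hcu : ContinuousOn (fun r : ℝ × ℝ => u r.1 r.2) (Icc t1 t0 ×ˢ Icc p q) :=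
      hu.cu.mono (box_sub ht1)
    obtain ⟨d1, hd1, hd1'⟩ : ∃ d > 0, ∀ t, d ≤ u (γ2 t).1 (γ2 t).2 := by
      have : Continuous (fun t => u (γ2 t).1 (γ2 t).2) :=
        hcu.comp_continuous γ2.continuous (fun t => (hγ2 t).1)
      obtain ⟨t, -, ht⟩ := isCompact_univ.exists_isMinOn univ_nonempty this.continuousOn
      exact ⟨_, (hγ2 t).2, fun s => ht (mem_univ s)⟩
    have side : ∀ s, s = p ∨ s = q → ∃ d > 0, ∀ d' > 0, d' ≤ d →
        (∀ t ∈ Icc t1 t0, d' ≤ u t s) ∨ (∀ t ∈ Icc t1 t0, u t s < d') := by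
      intro s hs'
      rcases hs s hs' with h | h
      · have : ContinuousOn (fun t => u t s) (Icc t1 t0) :=
          fun t ht => (hu.dt t (ht1.trans_le ht.1) s).continuousAt.continuousWithinAt
        obtain ⟨t, ht', hm⟩ := isCompact_Icc.exists_isMinOn ⟨t1, le_rfl, ht.le⟩ this
        exact ⟨_, h t ht', fun d' _ hle => Or.inl fun r hr => hle.trans (hm hr)⟩
      · exact ⟨1, one_pos, fun d' hd' _ => Or.inr fun r hr => (h r hr).trans hd'⟩
    obtain ⟨d2, hd2, hd2'⟩ := side p (Or.inl rfl)
    obtain ⟨d3, hd3, hd3'⟩ := side q (Or.inr rfl)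
    set d := min d1 (min d2 d3) with hd
    have hd0 : 0 < d := lt_min hd1 (lt_min hd2 hd3)
    have l1 : d ≤ d1 := min_le_left _ _
    have l2 : d ≤ d2 := (min_le_right _ _).trans (min_le_left _ _)
    have l3 : d ≤ d3 := (min_le_right _ _).trans (min_le_right _ _)
    obtain ⟨x1, hx1⟩ := reach hu (p := p) (q := q) (z := z) (d := d) ht1 ht hK
      ⟨(hYpq y.2).1.le.trans hz.1.le, hz.2.le.trans (hYpq y'.2).2.le⟩ hz0.le (by rw [hz0]; exact hd0)
      (by rintro s (rfl | rfl); exacts [hd2' d hd0 l2, hd3' d hd0 l3])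
    obtain ⟨r, ⟨t, rfl⟩, hr2⟩ := cross_joined (S := range γ2) t1 t0 y z y' x1 hz.1 hz.2
      ⟨γ2, fun t => mem_range_self t⟩ hx1
      (by rintro _ ⟨t, rfl⟩; exact (hγ2 t).1.1.2) (by rintro _ ⟨t, rfl⟩; exact (hγ2 t).1.1.1)
      (fun r hr => hr.1.1.2)
    have := hd1' t
    have := hr2.2
    linarith
  rcases lt_or_gt_of_ne hne with h | h
  · exact main y y' hy hy' hc h
  · exact main y' y hy' hy hc.symm h

lemma notjoined {δ K : ℝ} {a b c u ut ux uxx : ℝ → ℝ → ℝ} (hu : Sol δ K a b c u ut ux uxx)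
    {t1 t0 p q : ℝ} (ht1 : 0 < t1) (ht : t1 < t0) (hK : K * (t0 - t1) < 1)
    (hs : ∀ s, s = p ∨ s = q → (∀ t ∈ Icc t1 t0, 0 < u t s) ∨ (∀ t ∈ Icc t1 t0, u t s < 0))
    (hinf : {x ∈ Ioo p q | u t0 x = 0}.Infinite)
    (hno : ∀ x y, x < y → ∃ z ∈ Ioo x y, u t0 z ≠ 0) :
    ¬ JoinedIn {r ∈ Icc t1 t0 ×ˢ Icc p q | ¬ (u r.1 r.2 = 0 ∧ ux r.1 r.2 = 0 ∧ uxx r.1 r.2 = 0)}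
      (t0, p) (t0, q) := by
  set e := hinf.natEmbedding with he
  set f : ℕ → ℝ := fun n => (e n : ℝ) with hf
  have hfm : ∀ n, f n ∈ {x ∈ Ioo p q | u t0 x = 0} := fun n => (e n).2
  have hfi : Function.Injective f := Subtype.val_injective.comp e.injective
  -- Y exists
  have hY : ∃ Y : Set ℝ, Y.Infinite ∧ Y ⊆ Ioo p q ∧ (∀ y ∈ Y, u t0 y ≠ 0) ∧
      (∀ y ∈ Y, ∀ y' ∈ Y, y < y' → ∃ z ∈ Ioo y y', u t0 z = 0) := by
    have key : ∀ s : ℕ → ℝ, (∀ n, s n ∈ {x ∈ Ioo p q | u t0 x = 0}) →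
        (StrictMono s ∨ StrictAnti s) → ∃ Y : Set ℝ, Y.Infinite ∧ Y ⊆ Ioo p q ∧
        (∀ y ∈ Y, u t0 y ≠ 0) ∧ (∀ y ∈ Y, ∀ y' ∈ Y, y < y' → ∃ z ∈ Ioo y y', u t0 z = 0) := by
      rintro s hs1 (hs2 | hs2)
      · have : ∀ n, ∃ z ∈ Ioo (s n) (s (n+1)), u t0 z ≠ 0 := fun n => hno _ _ (hs2 (Nat.lt_succ_self n))
        choose y hy1 hy2 using this
        have hm : StrictMono y := strictMono_nat_of_lt_succ fun n => (hy1 n).2.trans (hy1 (n+1)).1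
        refine ⟨range y, infinite_range_of_injective hm.injective, ?_, ?_, ?_⟩
        · rintro _ ⟨n, rfl⟩
          exact ⟨(hs1 n).1.1.trans (hy1 n).1, (hy1 n).2.trans (hs1 (n+1)).1.2⟩
        · rintro _ ⟨n, rfl⟩; exact hy2 n
        · rintro _ ⟨n, rfl⟩ _ ⟨m, rfl⟩ hlt
          have hnm := hm.lt_iff_lt.1 hlt
          exact ⟨s (n+1), ⟨(hy1 n).2, (hs2.monotone hnm).trans_lt (hy1 m).1⟩, (hs1 _).2⟩
      · have : ∀ n, ∃ z ∈ Ioo (s (n+1)) (s n), u t0 z ≠ 0 := fun n => hno _ _ (hs2 (Nat.lt_succ_self n))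
        choose y hy1 hy2 using this
        have hm : StrictAnti y := strictAnti_nat_of_succ_lt fun n => (hy1 (n+1)).2.trans (hy1 n).1
        refine ⟨range y, infinite_range_of_injective hm.injective, ?_, ?_, ?_⟩
        · rintro _ ⟨n, rfl⟩
          exact ⟨(hs1 (n+1)).1.1.trans (hy1 n).1, (hy1 n).2.trans (hs1 n).1.2⟩
        · rintro _ ⟨n, rfl⟩; exact hy2 n
        · rintro _ ⟨n, rfl⟩ _ ⟨m, rfl⟩ hlt
          have hnm := hm.lt_iff_gt.1 hlt
          exact ⟨s n, ⟨(hy1 n).2, (hs2.antitone hnm).trans_lt (hy1 m).1⟩, (hs1 _).2⟩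
    obtain ⟨g, hg | hg⟩ := exists_increasing_or_nonincreasing_subseq (· < ·) f
    · exact key (f ∘ g) (fun n => hfm _) (Or.inl (fun m n h => hg m n h))
    · refine key (f ∘ g) (fun n => hfm _) (Or.inr (fun m n h => ?_))
      refine lt_of_le_of_ne (not_lt.1 (hg m n h)) (fun h' => ?_)
      exact absurd (g.injective (hfi h')) h.ne'
  obtain ⟨Y, hYi, hYpq, hY0, hYz⟩ := hY
  have hun : Y = {y ∈ Y | 0 < u t0 y} ∪ {y ∈ Y | u t0 y < 0} := by
    ext y
    constructor
    · intro hy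
      rcases lt_or_gt_of_ne (hY0 y hy) with h | h
      · exact Or.inr ⟨hy, h⟩
      · exact Or.inl ⟨hy, h⟩
    · rintro (h | h) <;> exact h.1
  rw [hun, infinite_union] at hYi
  rcases hYi with h | h
  · exact notjoined_core hu ht1 ht hK hs h (fun y hy => hYpq hy.1) (fun y hy => hy.2)
      (fun y hy y' hy' => hYz y hy.1 y' hy'.1)
  · have := notjoined_core hu.neg (p := p) (q := q) ht1 ht hK (by
      intro s hs'
      rcases hs s hs' with h | h
      · right; intro t ht; have := h t ht; linarith
      · left; intro t ht; have := h t ht; linarith) h (fun y hy => hYpq hy.1)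
      (fun y hy => by linarith [hy.2])
      (fun y hy y' hy' hlt => by
        obtain ⟨z, hz, h0⟩ := hYz y hy.1 y' hy'.1 hlt
        exact ⟨z, hz, by rw [h0]; simp⟩)
    simpa only [neg_eq_zero] using this

open Real Set Filter

def CO (f : ℝ → ℝ → ℝ) (t1 t0 A B : ℝ) : Prop :=
  ContinuousOn (fun p : ℝ × ℝ => f p.1 p.2) (Icc t1 t0 ×ˢ Icc A B)

namespace CO
variable {f g : ℝ → ℝ → ℝ} {t1 t0 A B : ℝ}
lemma add (hf : CO f t1 t0 A B) (hg : CO g t1 t0 A B) : CO (fun t x => f t x + g t x) t1 t0 A B :=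
  ContinuousOn.add hf hg
lemma sub (hf : CO f t1 t0 A B) (hg : CO g t1 t0 A B) : CO (fun t x => f t x - g t x) t1 t0 A B :=
  ContinuousOn.sub hf hg
lemma mul (hf : CO f t1 t0 A B) (hg : CO g t1 t0 A B) : CO (fun t x => f t x * g t x) t1 t0 A B :=
  ContinuousOn.mul hf hg
lemma pow (hf : CO f t1 t0 A B) (n : ℕ) : CO (fun t x => f t x ^ n) t1 t0 A B :=
  ContinuousOn.pow hf n
lemma neg (hf : CO f t1 t0 A B) : CO (fun t x => - f t x) t1 t0 A B :=
  ContinuousOn.neg hf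
lemma const_mul (c : ℝ) (hf : CO f t1 t0 A B) : CO (fun t x => c * f t x) t1 t0 A B :=
  continuousOn_const.mul hf
lemma slice (hf : CO f t1 t0 A B) {t : ℝ} (ht : t ∈ Icc t1 t0) : ContinuousOn (f t) (Icc A B) :=
  ContinuousOn.comp (g := fun p : ℝ × ℝ => f p.1 p.2) (f := fun x => (t, x)) hf (by fun_prop) (fun x hx => ⟨ht, hx⟩)
lemma sliceT (hf : CO f t1 t0 A B) {x : ℝ} (hx : x ∈ Icc A B) : ContinuousOn (fun t => f t x) (Icc t1 t0) :=
  ContinuousOn.comp (g := fun p : ℝ × ℝ => f p.1 p.2) (f := fun t => (t, x)) hf (by fun_prop) (fun t ht => ⟨ht, hx⟩)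
lemma bdd (hf : CO f t1 t0 A B) : ∃ C > 0, ∀ t ∈ Icc t1 t0, ∀ x ∈ Icc A B, |f t x| ≤ C := by
  obtain ⟨C, hC⟩ := (isCompact_Icc.prod isCompact_Icc).exists_bound_of_continuousOn hf
  refine ⟨max C 1, by positivity, fun t ht x hx => ?_⟩
  have := hC (t, x) ⟨ht, hx⟩
  exact this.trans (le_max_left _ _)
lemma intble (hf : CO f t1 t0 A B) (hAB : A ≤ B) {t : ℝ} (ht : t ∈ Icc t1 t0) :
    IntervalIntegrable (f t) MeasureTheory.volume A B :=
  (hf.slice ht).intervalIntegrable_of_Icc hAB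

lemma par_cont (hf : CO f t1 t0 A B) (hAB : A ≤ B) :
    ContinuousOn (fun t => ∫ x in A..B, f t x) (Icc t1 t0) := by
  obtain ⟨C, hC0, hC⟩ := hf.bdd
  intro t ht
  refine intervalIntegral.continuousWithinAt_of_dominated_interval (bound := fun _ => C) ?_ ?_ ?_ ?_
  · filter_upwards [self_mem_nhdsWithin] with s hs
    exact (hf.intble hAB hs).aestronglyMeasurable_restrict_uIoc
  · filter_upwards [self_mem_nhdsWithin] with s hs
    refine Eventually.of_forall fun x hx => ?_
    rw [uIoc_of_le hAB] at hx
    exact hC s hs x ⟨hx.1.le, hx.2⟩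
  · exact intervalIntegrable_const
  · refine Eventually.of_forall fun x hx => ?_
    rw [uIoc_of_le hAB] at hx
    exact hf.sliceT ⟨hx.1.le, hx.2⟩ t ht

lemma par_deriv (hf : CO f t1 t0 A B) (hg : CO g t1 t0 A B) (hAB : A ≤ B)
    (hd : ∀ t ∈ Ioo t1 t0, ∀ x ∈ Icc A B, HasDerivAt (fun s => f s x) (g t x) t) {t : ℝ}
    (ht : t ∈ Ioo t1 t0) :
    HasDerivAt (fun t => ∫ x in A..B, f t x) (∫ x in A..B, g t x) t := by
  obtain ⟨C, hC0, hC⟩ := hg.bdd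
  have hmem : Ioo t1 t0 ∈ nhds t := Ioo_mem_nhds ht.1 ht.2
  refine (intervalIntegral.hasDerivAt_integral_of_dominated_loc_of_deriv_le (bound := fun _ => C)
    (s := Ioo t1 t0) hmem ?_ ?_ ?_ ?_ ?_ ?_).2
  · filter_upwards [hmem] with s hs
    exact (hf.intble hAB (Ioo_subset_Icc_self hs)).aestronglyMeasurable_restrict_uIoc
  · exact hf.intble hAB (Ioo_subset_Icc_self ht)
  · exact (hg.intble hAB (Ioo_subset_Icc_self ht)).aestronglyMeasurable_restrict_uIoc
  · refine Eventually.of_forall fun x hx s hs => ?_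
    rw [uIoc_of_le hAB] at hx
    exact hC s (Ioo_subset_Icc_self hs) x ⟨hx.1.le, hx.2⟩
  · exact intervalIntegrable_const
  · refine Eventually.of_forall fun x hx s hs => ?_
    rw [uIoc_of_le hAB] at hx
    exact hd s hs x ⟨hx.1.le, hx.2⟩
end CO

lemma ibp0 {f f' : ℝ → ℝ} {A B : ℝ} (hAB : A ≤ B) (hd : ∀ x ∈ Icc A B, HasDerivAt f (f' x) x)
    (hc : ContinuousOn f' (Icc A B)) (hA : f A = 0) (hB : f B = 0) : ∫ x in A..B, f' x = 0 := by
  rw [intervalIntegral.integral_eq_sub_of_hasDerivAt (f := f) (fun x hx => hd x (by rwa [uIcc_of_le hAB] at hx))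
    (hc.intervalIntegrable_of_Icc hAB), hA, hB, sub_zero]

lemma par_grad {a at' ax v vt vx vxx : ℝ → ℝ → ℝ} {t1 t0 A B : ℝ} (hAB : A ≤ B)
    (ca : CO a t1 t0 A B) (cat : CO at' t1 t0 A B) (cax : CO ax t1 t0 A B)
    (cv : CO v t1 t0 A B) (cvt : CO vt t1 t0 A B) (cvx : CO vx t1 t0 A B) (cvxx : CO vxx t1 t0 A B)
    (da : ∀ t ∈ Ioo t1 t0, ∀ x ∈ Icc A B, HasDerivAt (fun s => a s x) (at' t x) t)
    (dax : ∀ t ∈ Icc t1 t0, ∀ x ∈ Icc A B, HasDerivAt (fun y => a t y) (ax t x) x)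
    (dv : ∀ t ∈ Ioo t1 t0, ∀ x ∈ Icc A B, HasDerivAt (fun s => v s x) (vt t x) t)
    (dvx : ∀ t ∈ Icc t1 t0, ∀ x ∈ Icc A B, HasDerivAt (fun y => v t y) (vx t x) x)
    (dvxx : ∀ t ∈ Icc t1 t0, ∀ x ∈ Icc A B, HasDerivAt (fun y => vx t y) (vxx t x) x)
    (hA : ∀ t ∈ Icc t1 t0, v t A = 0) (hB : ∀ t ∈ Icc t1 t0, v t B = 0)
    {t : ℝ} (ht : t ∈ Ioo t1 t0) :
    HasDerivAt (fun t => ∫ x in A..B, a t x * vx t x ^ 2)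
      (∫ x in A..B, (at' t x * vx t x ^ 2 - 2 * vt t x * (ax t x * vx t x + a t x * vxx t x))) t := by
  have htI := Ioo_subset_Icc_self ht
  have hmem : Ioo t1 t0 ∈ nhds t := Ioo_mem_nhds ht.1 ht.2
  -- slope functions
  set G : ℝ → ℝ → ℝ := fun s x => slope (fun s => a s x) t s * vx s x ^ 2 -
    slope (fun s => v s x) t s * (ax t x * (vx s x + vx t x) + a t x * (vxx s x + vxx t x)) with hG
  rw [hasDerivAt_iff_tendsto_slope]
  have hev : ∀ᶠ s in nhdsWithin t {t}ᶜ, s ∈ Ioo t1 t0 := mem_nhdsWithin_of_mem_nhds hmem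
  have key : ∀ s ∈ Ioo t1 t0, slope (fun t => ∫ x in A..B, a t x * vx t x ^ 2) t s
      = ∫ x in A..B, G s x := by
    intro s hs
    have hsI := Ioo_subset_Icc_self hs
    have h1 := (ca.mul (cvx.pow 2)).intble hAB hsI
    have h2 := (ca.mul (cvx.pow 2)).intble hAB htI
    have e0 := ibp0 (A := A) (B := B) (f := fun x => (s - t)⁻¹ * ((v s x - v t x) * (a t x * (vx s x + vx t x))))
      (f' := fun x => (s - t)⁻¹ * ((vx s x - vx t x) * (a t x * (vx s x + vx t x)) + (v s x - v t x) *
        (ax t x * (vx s x + vx t x) + a t x * (vxx s x + vxx t x)))) hAB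
      (fun x hx => ((((dvx s hsI x hx).sub (dvx t htI x hx)).mul
        ((dax t htI x hx).mul ((dvxx s hsI x hx).add (dvxx t htI x hx)))).const_mul _))
      (continuousOn_const.mul ((((cvx.slice hsI).sub (cvx.slice htI)).mul ((ca.slice htI).mul
        ((cvx.slice hsI).add (cvx.slice htI)))).add (((cv.slice hsI).sub (cv.slice htI)).mul
        (((cax.slice htI).mul ((cvx.slice hsI).add (cvx.slice htI))).add ((ca.slice htI).mul
        ((cvxx.slice hsI).add (cvxx.slice htI)))))))
      (by simp only [hA s hsI, hA t htI]; ring) (by simp only [hB s hsI, hB t htI]; ring)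
    have i0 : IntervalIntegrable (fun x => (s - t)⁻¹ * ((vx s x - vx t x) * (a t x * (vx s x + vx t x)) + (v s x - v t x) *
        (ax t x * (vx s x + vx t x) + a t x * (vxx s x + vxx t x)))) MeasureTheory.volume A B :=
      ContinuousOn.intervalIntegrable_of_Icc hAB (continuousOn_const.mul ((((cvx.slice hsI).sub (cvx.slice htI)).mul ((ca.slice htI).mul
        ((cvx.slice hsI).add (cvx.slice htI)))).add (((cv.slice hsI).sub (cv.slice htI)).mul
        (((cax.slice htI).mul ((cvx.slice hsI).add (cvx.slice htI))).add ((ca.slice htI).mul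
        ((cvxx.slice hsI).add (cvxx.slice htI)))))))
    rw [slope_def_field, ← intervalIntegral.integral_sub h1 h2, div_eq_inv_mul,
      ← intervalIntegral.integral_const_mul]
    rw [← sub_zero (∫ x in A..B, (s - t)⁻¹ * _), ← e0, ← intervalIntegral.integral_sub _ i0]
    · refine intervalIntegral.integral_congr fun x hx => ?_
      simp only [hG, slope_def_field, div_eq_inv_mul]
      ring
    · exact (h1.sub h2).const_mul _
  refine Tendsto.congr' (f₁ := fun s => ∫ x in A..B, G s x) ?_ ?_
  · filter_upwards [hev] with s hs using (key s hs).symm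
  obtain ⟨Ca, hCa0, hCa⟩ := ca.bdd
  obtain ⟨Cat, hCat0, hCat⟩ := cat.bdd
  obtain ⟨Cax, hCax0, hCax⟩ := cax.bdd
  obtain ⟨Cvt, hCvt0, hCvt⟩ := cvt.bdd
  obtain ⟨Cvx, hCvx0, hCvx⟩ := cvx.bdd
  obtain ⟨Cvxx, hCvxx0, hCvxx⟩ := cvxx.bdd
  have slopeb : ∀ (f f' : ℝ → ℝ) (C : ℝ), (∀ s ∈ Ioo t1 t0, HasDerivAt f (f' s) s) →
      (∀ s ∈ Ioo t1 t0, |f' s| ≤ C) → ∀ s ∈ Ioo t1 t0, s ≠ t → |slope f t s| ≤ C := by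
    intro f f' C hd hb s hs hne
    have := (convex_Ioo t1 t0).norm_image_sub_le_of_norm_hasDerivWithin_le
      (fun s hs => (hd s hs).hasDerivWithinAt) hb ht hs
    rw [slope_def_field, abs_div]
    exact div_le_of_le_mul₀ (abs_nonneg _) ((abs_nonneg _).trans (hb s hs)) this
  refine intervalIntegral.tendsto_integral_filter_of_dominated_convergence
    (bound := fun _ => Cat * Cvx^2 + Cvt * (Cax * (Cvx + Cvx) + Ca * (Cvxx + Cvxx))) ?_ ?_ ?_ ?_
  · filter_upwards [hev] with s hs
    have hsI := Ioo_subset_Icc_self hs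
    have : ContinuousOn (G s) (Icc A B) := by
      simp only [hG, slope_def_field]
      exact ((((ca.slice hsI).sub (ca.slice htI)).div_const _).mul ((cvx.slice hsI).pow 2)).sub
        ((((cv.slice hsI).sub (cv.slice htI)).div_const _).mul
        (((cax.slice htI).mul ((cvx.slice hsI).add (cvx.slice htI))).add ((ca.slice htI).mul
        ((cvxx.slice hsI).add (cvxx.slice htI)))))
    exact (this.intervalIntegrable_of_Icc hAB).aestronglyMeasurable_restrict_uIoc
  · filter_upwards [hev, self_mem_nhdsWithin] with s hs hne
    have hsI := Ioo_subset_Icc_self hs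
    refine Eventually.of_forall fun x hx => ?_
    rw [uIoc_of_le hAB] at hx
    have hx' : x ∈ Icc A B := ⟨hx.1.le, hx.2⟩
    have b1 := slopeb (fun s => a s x) (fun s => at' s x) Cat (fun s hs => da s hs x hx')
      (fun s hs => hCat s (Ioo_subset_Icc_self hs) x hx') s hs hne
    have b2 := slopeb (fun s => v s x) (fun s => vt s x) Cvt (fun s hs => dv s hs x hx')
      (fun s hs => hCvt s (Ioo_subset_Icc_self hs) x hx') s hs hne
    have b3 := hCvx s hsI x hx'
    have b4 := hCvx t htI x hx'
    have b5 := hCvxx s hsI x hx'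
    have b6 := hCvxx t htI x hx'
    have b7 := hCa t htI x hx'
    have b8 := hCax t htI x hx'
    rw [Real.norm_eq_abs]
    simp only [hG]
    refine (abs_sub _ _).trans ?_
    rw [abs_mul, abs_mul, abs_pow]
    have c1 : |vx s x + vx t x| ≤ Cvx + Cvx := (abs_add_le _ _).trans (add_le_add b3 b4)
    have c2 : |vxx s x + vxx t x| ≤ Cvxx + Cvxx := (abs_add_le _ _).trans (add_le_add b5 b6)
    have c3 : |ax t x * (vx s x + vx t x) + a t x * (vxx s x + vxx t x)| ≤
        Cax * (Cvx + Cvx) + Ca * (Cvxx + Cvxx) := by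
      refine (abs_add_le _ _).trans ?_
      rw [abs_mul, abs_mul]
      gcongr
    gcongr
  · exact intervalIntegrable_const
  · refine Eventually.of_forall fun x hx => ?_
    rw [uIoc_of_le hAB] at hx
    have hx' : x ∈ Icc A B := ⟨hx.1.le, hx.2⟩
    have l1 := hasDerivAt_iff_tendsto_slope.1 (da t ht x hx')
    have l2 := hasDerivAt_iff_tendsto_slope.1 (dv t ht x hx')
    have l3 : Tendsto (fun s => vx s x) (nhdsWithin t {t}ᶜ) (nhds (vx t x)) :=
      (((cvx.sliceT hx').continuousAt (Icc_mem_nhds ht.1 ht.2)).tendsto).mono_left nhdsWithin_le_nhds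
    have l4 : Tendsto (fun s => vxx s x) (nhdsWithin t {t}ᶜ) (nhds (vxx t x)) :=
      (((cvxx.sliceT hx').continuousAt (Icc_mem_nhds ht.1 ht.2)).tendsto).mono_left nhdsWithin_le_nhds
    have := (l1.mul (l3.pow 2)).sub (l2.mul (((tendsto_const_nhds (x := ax t x)).mul (l3.add_const (vx t x))).add
      ((tendsto_const_nhds (x := a t x)).mul (l4.add_const (vxx t x)))))
    convert this using 2
    ring

open Real Set Filter

lemma pwE {x h ε a ax a0 v vx f g L M : ℝ} (hh : 0 < h) (hε : 0 < ε) (hM : 0 ≤ M)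
    (hax : |ax| ≤ M) (ha0 : |a - a0| ≤ M * (|x| + h))
    (hf : |f| ≤ M * (|v| + |vx| + 2 * ε * |x| / h * |v|) + g) (hL : L = M * (3 + 6 * ε)) (hg : 0 ≤ g) :
    (-ax * vx + 2 * ε / h * (a - a0) * v + f) ^ 2 ≤
      4 * L ^ 2 * (vx ^ 2 + v ^ 2 + x ^ 2 / h ^ 2 * v ^ 2) + 4 * g ^ 2 := by
  have hL0 : 0 ≤ L := by rw [hL]; positivity
  have h1 : |(-ax * vx + 2 * ε / h * (a - a0) * v + f)| ≤ L * |vx| + L * |v| + L * (|x| / h * |v|) + g := by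
    have e1 : |-ax * vx| ≤ M * |vx| := by
      rw [abs_mul, abs_neg]; gcongr
    have e2 : |2 * ε / h * (a - a0) * v| ≤ 2 * ε / h * (M * (|x| + h)) * |v| := by
      rw [abs_mul, abs_mul, abs_of_pos (show 0 < 2 * ε / h by positivity)]
      gcongr
    have e3 : 2 * ε / h * (M * (|x| + h)) * |v| = 2 * ε * M * (|x| / h * |v|) + 2 * ε * M * |v| := by
      field_simp
    have e4 : M * (|v| + |vx| + 2 * ε * |x| / h * |v|) = M * |v| + M * |vx| + 2 * ε * M * (|x| / h * |v|) := by
      field_simp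
    have e5 := abs_add_three (-ax * vx) (2 * ε / h * (a - a0) * v) f
    rw [e3] at e2
    rw [e4] at hf
    have p1 : 0 ≤ M * |vx| := by positivity
    have p2 : 0 ≤ M * |v| := by positivity
    have p3 : 0 ≤ M * (|x| / h * |v|) := by positivity
    have p4 : 0 ≤ ε * (M * |vx|) := by positivity
    have p5 : 0 ≤ ε * (M * |v|) := by positivity
    have p6 : 0 ≤ ε * (M * (|x| / h * |v|)) := by positivity
    rw [hL]
    linarith
  rw [← sq_abs]
  have h2 : |(-ax * vx + 2 * ε / h * (a - a0) * v + f)| ^ 2 ≤ (L * |vx| + L * |v| + L * (|x| / h * |v|) + g) ^ 2 :=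
    pow_le_pow_left₀ (abs_nonneg _) h1 2
  refine h2.trans ?_
  have e1 : x ^ 2 / h ^ 2 * v ^ 2 = (|x| / h * |v|) ^ 2 := by
    rw [mul_pow, div_pow, sq_abs, sq_abs]
  rw [e1, ← sq_abs vx, ← sq_abs v]
  generalize |vx| = p
  generalize |x| / h * |v| = r
  generalize |v| = q
  nlinarith [sq_nonneg (L * p - L * q), sq_nonneg (L * p - L * r), sq_nonneg (L * p - g),
    sq_nonneg (L * q - L * r), sq_nonneg (L * q - g), sq_nonneg (L * r - g)]

lemma pw_aux {s : ℝ} (hs1 : 0.475 ≤ s) (hs2 : s ≤ 0.525) : 0.09 ≤ (s - 1) * (1.25 - 3 * s) := by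
  nlinarith [mul_nonneg (sub_nonneg.2 hs1) (sub_nonneg.2 hs2)]

set_option maxHeartbeats 1000000 in
lemma pwA {x h ε a at' ax v vx A N m e g L M δ : ℝ} (hh : 0 < h) (hε : 0 < ε) (hM : 0 ≤ M)
    (hδ : 0 < δ) (hδa : δ ≤ a) (hs1 : 0.475 ≤ 4 * ε * a) (hs2 : 4 * ε * a ≤ 0.525)
    (hat : |at'| ≤ M) (hxM : 4 * ε * |x * ax| ≤ 0.1)
    (he : e ^ 2 ≤ 4 * L ^ 2 * (vx ^ 2 + v ^ 2 + x ^ 2 / h ^ 2 * v ^ 2) + 4 * g ^ 2)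
    (hN : N ≤ 0) (hh1 : h * (M + 2 * L ^ 2) ≤ 0.2 * δ)
    (hh2 : h * (4 * ε ^ 2 * M + 2 * L ^ 2) ≤ 0.08 * ε)
    {P Pt S vt : ℝ} (hP : P = ε * x ^ 2 / h ^ 2 * (4 * ε * a - 1))
    (hPt : Pt = 2 * ε * x ^ 2 / h ^ 3 * (4 * ε * a - 1) + 4 * ε ^ 2 * x ^ 2 / h ^ 2 * at')
    (hS : S = A + P * v) (hvt : vt = S + 4 * ε * x * a / h * vx + m * v + e) :
    0 ≤ (2 * vt * S - at' * vx ^ 2 + Pt * v ^ 2) + (-N) * (2 * v * vt)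
      + (-2 * (N + m)) * (v * A + a * vx ^ 2)
      + (-(4 * ε / h)) * ((a * vx) ^ 2 + 2 * x * (a * vx) * A)
      + (-(4 * ε ^ 2 / h ^ 3)) * (3 * x ^ 2 * a * (4 * ε * a - 1) * v ^ 2
          + x ^ 3 * ax * (8 * ε * a - 1) * v ^ 2 + 2 * x ^ 3 * a * (4 * ε * a - 1) * v * vx)
      + (4 * ε * N / h) * ((a + x * ax) * v ^ 2 + 2 * x * a * v * vx)
      + (-2 * (N + m) - 3 / (4 * h)) * (-a * vx ^ 2 + P * v ^ 2)
      + (2 * (N + m) * N - 3 / (4 * h) * N + 2 * L ^ 2) * v ^ 2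
      + 2 * g ^ 2 := by
  set r := S - N * v with hr
  have ident : (2 * vt * S - at' * vx ^ 2 + Pt * v ^ 2) + (-N) * (2 * v * vt)
      + (-2 * (N + m)) * (v * A + a * vx ^ 2)
      + (-(4 * ε / h)) * ((a * vx) ^ 2 + 2 * x * (a * vx) * A)
      + (-(4 * ε ^ 2 / h ^ 3)) * (3 * x ^ 2 * a * (4 * ε * a - 1) * v ^ 2
          + x ^ 3 * ax * (8 * ε * a - 1) * v ^ 2 + 2 * x ^ 3 * a * (4 * ε * a - 1) * v * vx)
      + (4 * ε * N / h) * ((a + x * ax) * v ^ 2 + 2 * x * a * v * vx)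
      + (-2 * (N + m) - 3 / (4 * h)) * (-a * vx ^ 2 + P * v ^ 2)
      + (2 * (N + m) * N - 3 / (4 * h) * N + 2 * L ^ 2) * v ^ 2
      + 2 * g ^ 2
      = 2 * (r + e / 2) ^ 2 + (1 / 2) * (4 * L ^ 2 * (vx ^ 2 + v ^ 2 + x ^ 2 / h ^ 2 * v ^ 2) + 4 * g ^ 2 - e ^ 2)
      + (1 / h) * vx ^ 2 * (- (4 * ε * a) * a + 0.75 * a - h * (at' + 2 * L ^ 2))
      + x ^ 2 / h ^ 3 * v ^ 2 * (ε * ((4 * ε * a - 1) * (1.25 - 3 * (4 * ε * a))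
          - (4 * ε * (x * ax)) * (2 * (4 * ε * a) - 1)) + h * (4 * ε ^ 2 * at' - 2 * L ^ 2))
      + (-N) * (1 / h) * v ^ 2 * (0.75 - 4 * ε * a - 4 * ε * (x * ax)) := by
    rw [hr, hvt, hS, hPt, hP]
    field_simp
    ring
  rw [ident]
  have ha : 0 < a := hδ.trans_le hδa
  have hat' := abs_le.1 hat
  have hz : |4 * ε * (x * ax)| ≤ 0.1 := by
    rw [abs_mul, abs_of_pos (show 0 < 4 * ε by positivity)]; exact hxM
  generalize hzz : 4 * ε * (x * ax) = z at hz ⊢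
  have hz' := abs_le.1 hz
  have t1 : 0 ≤ - (4 * ε * a) * a + 0.75 * a - h * (at' + 2 * L ^ 2) := by
    have : h * (at' + 2 * L ^ 2) ≤ h * (M + 2 * L ^ 2) := by gcongr; exact hat'.2
    have h3 : 4 * ε * a * a ≤ 0.525 * a := mul_le_mul_of_nonneg_right hs2 ha.le
    linarith
  generalize hss : 4 * ε * a = s at hs1 hs2 t1 ⊢
  have t2 : 0 ≤ ε * ((s - 1) * (1.25 - 3 * s) - z * (2 * s - 1)) + h * (4 * ε ^ 2 * at' - 2 * L ^ 2) := by
    have e1 : 0.09 ≤ (s - 1) * (1.25 - 3 * s) := pw_aux hs1 hs2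
    have e2 : z * (2 * s - 1) ≤ 0.01 := by
      have : |z * (2 * s - 1)| ≤ 0.1 * 0.1 := by
        rw [abs_mul]
        gcongr
        rw [abs_le]; constructor <;> linarith
      have := abs_le.1 this
      linarith
    have e3 : h * (4 * ε ^ 2 * (-M) - 2 * L ^ 2) ≤ h * (4 * ε ^ 2 * at' - 2 * L ^ 2) := by
      gcongr; exact hat'.1
    have e4 : ε * 0.08 ≤ ε * ((s - 1) * (1.25 - 3 * s) - z * (2 * s - 1)) := by
      gcongr; linarith
    linarith
  have t3 : 0 ≤ 0.75 - s - z := by linarith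
  have t4 : 0 ≤ 4 * L ^ 2 * (vx ^ 2 + v ^ 2 + x ^ 2 / h ^ 2 * v ^ 2) + 4 * g ^ 2 - e ^ 2 := by linarith
  have t5 : 0 ≤ -N := by linarith
  positivity

lemma pwB {x h ε a ax v vx A m e g L C2 δ : ℝ} (hh : 0 < h) (hε : 0 < ε)
    (hδ : 0 < δ) (hδa : δ ≤ a) (hs2 : 4 * ε * a ≤ 0.525)
    (hxM : 4 * ε * |x * ax| ≤ 0.1)
    (he : e ^ 2 ≤ 4 * L ^ 2 * (vx ^ 2 + v ^ 2 + x ^ 2 / h ^ 2 * v ^ 2) + 4 * g ^ 2)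
    (hm : 0 ≤ m) (hC : 4 * L ^ 2 ≤ C2 * δ) (hC' : 10 * L ^ 2 ≤ C2 * ε)
    {P S vt : ℝ} (hP : P = ε * x ^ 2 / h ^ 2 * (4 * ε * a - 1))
    (hS : S = A + P * v) (hvt : vt = S + 4 * ε * x * a / h * vx + m * v + e) :
    0 ≤ 2 * v * vt + (-2) * (v * A + a * vx ^ 2)
      + (-(4 * ε / h)) * ((a + x * ax) * v ^ 2 + 2 * x * a * v * vx)
      + (-(2 + C2)) * (-a * vx ^ 2 + P * v ^ 2)
      + (1 / h + 1 + 4 * L ^ 2) * v ^ 2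
      + 4 * g ^ 2 := by
  have ident : 2 * v * vt + (-2) * (v * A + a * vx ^ 2)
      + (-(4 * ε / h)) * ((a + x * ax) * v ^ 2 + 2 * x * a * v * vx)
      + (-(2 + C2)) * (-a * vx ^ 2 + P * v ^ 2)
      + (1 / h + 1 + 4 * L ^ 2) * v ^ 2
      + 4 * g ^ 2
      = (v + e) ^ 2 + (4 * L ^ 2 * (vx ^ 2 + v ^ 2 + x ^ 2 / h ^ 2 * v ^ 2) + 4 * g ^ 2 - e ^ 2)
      + vx ^ 2 * (C2 * a - 4 * L ^ 2) + x ^ 2 / h ^ 2 * v ^ 2 * (C2 * ε * (1 - 4 * ε * a) - 4 * L ^ 2)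
      + (1 / h) * v ^ 2 * (1 - 4 * ε * a - 4 * ε * (x * ax)) + 2 * m * v ^ 2 := by
    rw [hvt, hS, hP]
    field_simp
    ring
  rw [ident]
  have hC0 : 0 ≤ C2 := by
    by_contra hc
    push Not at hc
    linarith [mul_neg_of_neg_of_pos hc hδ, sq_nonneg L]
  have t1 : 0 ≤ C2 * a - 4 * L ^ 2 := by
    have : C2 * δ ≤ C2 * a := by gcongr
    linarith
  have t2 : 0 ≤ C2 * ε * (1 - 4 * ε * a) - 4 * L ^ 2 := by
    have : C2 * ε * 0.475 ≤ C2 * ε * (1 - 4 * ε * a) := by gcongr; linarith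
    linarith [sq_nonneg L]
  have t3 : 0 ≤ 1 - 4 * ε * a - 4 * ε * (x * ax) := by
    have h1 : x * ax ≤ |x * ax| := le_abs_self _
    have : 4 * ε * (x * ax) ≤ 4 * ε * |x * ax| := by gcongr
    linarith
  have t4 : 0 ≤ 4 * L ^ 2 * (vx ^ 2 + v ^ 2 + x ^ 2 / h ^ 2 * v ^ 2) + 4 * g ^ 2 - e ^ 2 := by linarith
  positivity

lemma lin1 {f g : ℝ → ℝ} {A B : ℝ} (hAB : A ≤ B) (c : ℝ) (hf : ContinuousOn f (Icc A B))
    (hg : ContinuousOn g (Icc A B)) :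
    ∫ x in A..B, (f x + c * g x) = (∫ x in A..B, f x) + c * ∫ x in A..B, g x := by
  rw [intervalIntegral.integral_add (hf.intervalIntegrable_of_Icc hAB)
    ((hg.intervalIntegrable_of_Icc hAB).const_mul c), intervalIntegral.integral_const_mul]

open Real Set Filter

lemma step {R h ε m δ M L C2 g a0 : ℝ} {a at' ax v vt vx vxx f : ℝ → ℝ} (hR : 0 < R)
    (hh : 0 < h) (hε : 0 < ε) (hm : 0 ≤ m) (hδ : 0 < δ) (hM : 0 ≤ M) (hg : 0 ≤ g)
    (hL : L = M * (3 + 6 * ε))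
    (ca : ContinuousOn a (Icc (-R) R)) (cat : ContinuousOn at' (Icc (-R) R))
    (cax : ContinuousOn ax (Icc (-R) R)) (cv : ContinuousOn v (Icc (-R) R))
    (cvt : ContinuousOn vt (Icc (-R) R)) (cvx : ContinuousOn vx (Icc (-R) R))
    (cvxx : ContinuousOn vxx (Icc (-R) R))
    (da : ∀ x ∈ Icc (-R) R, HasDerivAt a (ax x) x)
    (dv : ∀ x ∈ Icc (-R) R, HasDerivAt v (vx x) x)
    (dvx : ∀ x ∈ Icc (-R) R, HasDerivAt vx (vxx x) x)
    (hv1 : v (-R) = 0) (hv2 : v R = 0) (hvx1 : vx (-R) = 0) (hvx2 : vx R = 0)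
    (hδa : ∀ x ∈ Icc (-R) R, δ ≤ a x)
    (hs1 : ∀ x ∈ Icc (-R) R, 0.475 ≤ 4 * ε * a x) (hs2 : ∀ x ∈ Icc (-R) R, 4 * ε * a x ≤ 0.525)
    (hat : ∀ x ∈ Icc (-R) R, |at' x| ≤ M) (hax : ∀ x ∈ Icc (-R) R, |ax x| ≤ M)
    (hxM : 4 * ε * (R * M) ≤ 0.1)
    (ha0 : ∀ x ∈ Icc (-R) R, |a x - a0| ≤ M * (|x| + h))
    (hf : ∀ x ∈ Icc (-R) R, |f x| ≤ M * (|v x| + |vx x| + 2 * ε * |x| / h * |v x|) + g)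
    (hh1 : h * (M + 2 * L ^ 2) ≤ 0.2 * δ)
    (hh2 : h * (4 * ε ^ 2 * M + 2 * L ^ 2) ≤ 0.08 * ε)
    (hC : 4 * L ^ 2 ≤ C2 * δ) (hC' : 10 * L ^ 2 ≤ C2 * ε)
    {P Pt : ℝ → ℝ} (hP : ∀ x, P x = ε * x ^ 2 / h ^ 2 * (4 * ε * a x - 1))
    (hPt : ∀ x, Pt x = 2 * ε * x ^ 2 / h ^ 3 * (4 * ε * a x - 1) + 4 * ε ^ 2 * x ^ 2 / h ^ 2 * at' x)
    (hvt : ∀ x ∈ Icc (-R) R, vt x = (ax x * vx x + a x * vxx x) + P x * v x + 4 * ε * x * a x / h * vx x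
      + m * v x + (- ax x * vx x + 2 * ε / h * (a x - a0) * v x + f x))
    {H D D1 H1 : ℝ} (hH : H = ∫ x in (-R)..R, v x ^ 2)
    (hD : D = ∫ x in (-R)..R, (-a x * vx x ^ 2 + P x * v x ^ 2))
    (hD1 : D1 = ∫ x in (-R)..R, (2 * vt x * (ax x * vx x + a x * vxx x + P x * v x)
      - at' x * vx x ^ 2 + Pt x * v x ^ 2))
    (hH1 : H1 = ∫ x in (-R)..R, 2 * v x * vt x) :
    (∀ N ≤ 0, N * H = D → 3 / (2 * h) * D - 2 * L ^ 2 * H - 4 * R * g ^ 2 ≤ D1 - N * H1) ∧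
    (2 + C2) * D - (1 / h + 1 + 4 * L ^ 2) * H - 8 * R * g ^ 2 ≤ H1 := by
  have hAB : -R ≤ R := by linarith
  have hPe : P = fun x => ε * x ^ 2 / h ^ 2 * (4 * ε * a x - 1) := funext hP
  have hPte : Pt = fun x => 2 * ε * x ^ 2 / h ^ 3 * (4 * ε * a x - 1) + 4 * ε ^ 2 * x ^ 2 / h ^ 2 * at' x := funext hPt
  have cP : ContinuousOn P (Icc (-R) R) := by rw [hPe]; fun_prop
  have cPt : ContinuousOn Pt (Icc (-R) R) := by rw [hPte]; fun_prop
  have hxax : ∀ x ∈ Icc (-R) R, 4 * ε * |x * ax x| ≤ 0.1 := by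
    intro x hx
    refine le_trans ?_ hxM
    rw [abs_mul]
    gcongr
    · exact abs_le.2 hx
    · exact hax x hx
  have hE : ∀ x ∈ Icc (-R) R, _ := fun x hx =>
    pwE (x := x) (a := a x) hh hε hM (hax x hx) (ha0 x hx) (hf x hx) hL hg
  -- zero integrals
  have Z1 : ∫ x in (-R)..R, (v x * (ax x * vx x + a x * vxx x) + a x * vx x ^ 2) = 0 := by
    refine ibp0 (f := fun x => v x * (a x * vx x)) hAB ?_ (by fun_prop) (by simp [hv1]) (by simp [hv2])
    intro x hx
    refine HasDerivAt.congr_deriv ((dv x hx).fun_mul ((da x hx).fun_mul (dvx x hx))) ?_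
    ring
  have Z2 : ∫ x in (-R)..R, ((a x * vx x) ^ 2 + 2 * x * (a x * vx x) * (ax x * vx x + a x * vxx x)) = 0 := by
    refine ibp0 (f := fun x => x * ((a x * vx x) * (a x * vx x))) hAB ?_ (by fun_prop) (by simp [hvx1]) (by simp [hvx2])
    intro x hx
    refine HasDerivAt.congr_deriv ((hasDerivAt_id' x).fun_mul (((da x hx).fun_mul (dvx x hx)).fun_mul ((da x hx).fun_mul (dvx x hx)))) ?_
    ring
  have Z3 : ∫ x in (-R)..R, (3 * x ^ 2 * a x * (4 * ε * a x - 1) * v x ^ 2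
          + x ^ 3 * ax x * (8 * ε * a x - 1) * v x ^ 2 + 2 * x ^ 3 * a x * (4 * ε * a x - 1) * v x * vx x) = 0 := by
    refine ibp0 (f := fun x => x ^ 3 * ((a x * (4 * ε * a x - 1)) * (v x * v x))) hAB ?_ (by fun_prop) (by simp [hv1]) (by simp [hv2])
    intro x hx
    refine HasDerivAt.congr_deriv ((hasDerivAt_pow 3 x).fun_mul (((da x hx).fun_mul (((da x hx).const_mul (4 * ε)).sub_const 1)).fun_mul
      ((dv x hx).fun_mul (dv x hx)))) ?_
    push_cast
    ring
  have Z4 : ∫ x in (-R)..R, ((a x + x * ax x) * v x ^ 2 + 2 * x * a x * v x * vx x) = 0 := by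
    refine ibp0 (f := fun x => (x * a x) * (v x * v x)) hAB ?_ (by fun_prop) (by simp [hv1]) (by simp [hv2])
    intro x hx
    refine HasDerivAt.congr_deriv (((hasDerivAt_id' x).fun_mul (da x hx)).fun_mul ((dv x hx).fun_mul (dv x hx))) ?_
    ring
  constructor
  · intro N hN hNH
    have pos : 0 ≤ ∫ x in (-R)..R, ((2 * vt x * (ax x * vx x + a x * vxx x + P x * v x)
      - at' x * vx x ^ 2 + Pt x * v x ^ 2) + (-N) * (2 * v x * vt x)
      + (-2 * (N + m)) * (v x * (ax x * vx x + a x * vxx x) + a x * vx x ^ 2)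
      + (-(4 * ε / h)) * ((a x * vx x) ^ 2 + 2 * x * (a x * vx x) * (ax x * vx x + a x * vxx x))
      + (-(4 * ε ^ 2 / h ^ 3)) * (3 * x ^ 2 * a x * (4 * ε * a x - 1) * v x ^ 2
          + x ^ 3 * ax x * (8 * ε * a x - 1) * v x ^ 2 + 2 * x ^ 3 * a x * (4 * ε * a x - 1) * v x * vx x)
      + (4 * ε * N / h) * ((a x + x * ax x) * v x ^ 2 + 2 * x * a x * v x * vx x)
      + (-2 * (N + m) - 3 / (4 * h)) * (-a x * vx x ^ 2 + P x * v x ^ 2)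
      + (2 * (N + m) * N - 3 / (4 * h) * N + 2 * L ^ 2) * v x ^ 2
      + 2 * g ^ 2 * 1) := by
      refine intervalIntegral.integral_nonneg hAB fun x hx => ?_
      rw [mul_one]
      exact pwA hh hε hM hδ (hδa x hx) (hs1 x hx) (hs2 x hx) (hat x hx) (hxax x hx) (hE x hx) hN hh1 hh2
        (hP x) (hPt x) rfl (hvt x hx)
    rw [lin1 hAB _ (by fun_prop) (by fun_prop), lin1 hAB _ (by fun_prop) (by fun_prop),
      lin1 hAB _ (by fun_prop) (by fun_prop), lin1 hAB _ (by fun_prop) (by fun_prop),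
      lin1 hAB _ (by fun_prop) (by fun_prop), lin1 hAB _ (by fun_prop) (by fun_prop),
      lin1 hAB _ (by fun_prop) (by fun_prop), lin1 hAB _ (by fun_prop) (by fun_prop),
      Z1, Z2, Z3, Z4, ← hD1, ← hH1, ← hD, ← hH, intervalIntegral.integral_const, smul_eq_mul] at pos
    have e1 : (3 / (2 * h)) * D = 3 / (4 * h) * D + 3 / (4 * h) * D := by field_simp; ring
    rw [e1]
    have e2 : 3 / (4 * h) * N * H = 3 / (4 * h) * D := by rw [mul_assoc, hNH]
    have e3 : 2 * (N + m) * N * H = 2 * (N + m) * D := by rw [mul_assoc, hNH]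
    linarith
  · have pos : 0 ≤ ∫ x in (-R)..R, (2 * v x * vt x
      + (-2) * (v x * (ax x * vx x + a x * vxx x) + a x * vx x ^ 2)
      + (-(4 * ε / h)) * ((a x + x * ax x) * v x ^ 2 + 2 * x * a x * v x * vx x)
      + (-(2 + C2)) * (-a x * vx x ^ 2 + P x * v x ^ 2)
      + (1 / h + 1 + 4 * L ^ 2) * v x ^ 2
      + 4 * g ^ 2 * 1) := by
      refine intervalIntegral.integral_nonneg hAB fun x hx => ?_
      rw [mul_one]
      exact pwB hh hε hδ (hδa x hx) (hs2 x hx) (hxax x hx) (hE x hx) hm hC hC' (hP x) rfl (hvt x hx)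
    rw [lin1 hAB _ (by fun_prop) (by fun_prop), lin1 hAB _ (by fun_prop) (by fun_prop),
      lin1 hAB _ (by fun_prop) (by fun_prop), lin1 hAB _ (by fun_prop) (by fun_prop),
      lin1 hAB _ (by fun_prop) (by fun_prop),
      Z1, Z4, ← hH1, ← hD, ← hH, intervalIntegral.integral_const, smul_eq_mul] at pos
    linarith

open Real Set Filter

lemma mono_of_deriv {f f' : ℝ → ℝ} {p q : ℝ} (hpq : p ≤ q) (hc : ContinuousOn f (Icc p q))
    (hd : ∀ t ∈ Ioo p q, HasDerivAt f (f' t) t) (hn : ∀ t ∈ Ioo p q, 0 ≤ f' t) :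
    ∀ t ∈ Icc p q, f p ≤ f t := by
  intro t ht
  refine monotoneOn_of_hasDerivWithinAt_nonneg (D := Icc p q) (f' := f') (convex_Icc p q) hc ?_ ?_
    (left_mem_Icc.2 hpq) ht ht.1
  · intro x hx
    rw [interior_Icc] at hx
    exact (hd x hx).hasDerivWithinAt
  · intro x hx
    rw [interior_Icc] at hx
    exact hn x hx

lemma ode {τ t0 θ c1 c2 C3 : ℝ} {H H1 D D1 : ℝ → ℝ} (hτ : τ < t0) (hθ : 0 < θ) (h1 : t0 + θ - τ ≤ 1)
    (hc1 : 0 ≤ c1) (hc2 : 0 ≤ c2) (hC3 : 0 ≤ C3)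
    (cH : ContinuousOn H (Icc τ t0)) (cD : ContinuousOn D (Icc τ t0))
    (dH : ∀ t ∈ Ioo τ t0, HasDerivAt H (H1 t) t) (dD : ∀ t ∈ Ioo τ t0, HasDerivAt D (D1 t) t)
    (Hpos : ∀ t ∈ Icc τ t0, 0 < H t) (Dneg : ∀ t ∈ Icc τ t0, D t ≤ 0)
    (hN : ∀ t ∈ Ioo τ t0, ∀ N ≤ 0, N * H t = D t →
      3 / (2 * (t0 + θ - t)) * D t - c1 * H t ≤ D1 t - N * H1 t)
    (hH : ∀ t ∈ Ioo τ t0, C3 * D t - (1 / (t0 + θ - t) + c2) * H t ≤ H1 t) :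
    log (H τ) - 2 * (C3 * (- D τ / H τ + c1) + 1 + c2) / √θ ≤ log (H t0) := by
  have hh : ∀ t ∈ Icc τ t0, 0 < t0 + θ - t := fun t ht => by linarith [ht.2]
  set k : ℝ → ℝ := fun t => √(t0 + θ - t) with hk
  have kpos : ∀ t ∈ Icc τ t0, 0 < k t := fun t ht => sqrt_pos.2 (hh t ht)
  have ksq : ∀ t ∈ Icc τ t0, k t ^ 2 = t0 + θ - t := fun t ht => sq_sqrt (hh t ht).le
  have k1 : ∀ t ∈ Icc τ t0, k t ≤ 1 := fun t ht => by
    rw [hk]; exact sqrt_le_one.2 (by linarith [ht.1])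
  have dk : ∀ t ∈ Icc τ t0, HasDerivAt k (-1 / (2 * k t)) t := fun t ht =>
    ((hasDerivAt_id' t).const_sub (t0 + θ)).sqrt (hh t ht).ne'
  have ck : ContinuousOn k (Icc τ t0) := fun t ht => (dk t ht).continuousAt.continuousWithinAt
  set N : ℝ → ℝ := fun t => D t / H t with hNdef
  have cN : ContinuousOn N (Icc τ t0) := cD.div cH fun t ht => (Hpos t ht).ne'
  have N0 : ∀ t ∈ Icc τ t0, N t ≤ 0 := fun t ht => div_nonpos_of_nonpos_of_nonneg (Dneg t ht) (Hpos t ht).le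
  have NH : ∀ t ∈ Icc τ t0, N t * H t = D t := fun t ht => div_mul_cancel₀ _ (Hpos t ht).ne'
  have dN : ∀ t ∈ Ioo τ t0, HasDerivAt N ((D1 t - N t * H1 t) / H t) t := by
    intro t ht
    have hH0 := (Hpos t (Ioo_subset_Icc_self ht)).ne'
    refine ((dD t ht).div (dH t ht) hH0).congr_deriv ?_
    simp only [hNdef]
    field_simp
  have hN' : ∀ t ∈ Ioo τ t0, 3 / (2 * k t ^ 2) * N t - c1 ≤ (D1 t - N t * H1 t) / H t := by
    intro t ht
    have htI := Ioo_subset_Icc_self ht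
    have := hN t ht (N t) (N0 t htI) (NH t htI)
    rw [le_div_iff₀ (Hpos t htI), ksq t htI]
    have e := NH t htI
    rw [← e] at this
    linarith
  have A : ∀ t ∈ Icc τ t0, N τ * k τ ^ 3 + c1 * τ ≤ N t * k t ^ 3 + c1 * t := by
    refine mono_of_deriv (f := fun t => N t * k t ^ 3 + c1 * t) (f' := fun t => (D1 t - N t * H1 t) / H t * k t ^ 3 +
      N t * (3 * k t ^ 2 * (-1 / (2 * k t))) + c1 * 1) hτ.le ?_ ?_ ?_
    · exact (cN.mul (ck.pow 3)).add (by fun_prop)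
    · intro t ht
      have := (dk t (Ioo_subset_Icc_self ht)).fun_pow 3
      exact ((dN t ht).fun_mul (this.congr_deriv (by norm_num))).fun_add ((hasDerivAt_id' t).const_mul c1)
    · intro t ht
      have htI := Ioo_subset_Icc_self ht
      have kp := kpos t htI
      have h3 : 3 / (2 * k t ^ 2) * N t * k t ^ 3 = 3 / 2 * k t * N t := by field_simp
      have h4 : 3 * k t ^ 2 * (-1 / (2 * k t)) = - 3 / 2 * k t := by field_simp
      have h5 := mul_le_mul_of_nonneg_right (hN' t ht) (pow_pos kp 3).le
      have h6 : k t ^ 3 ≤ 1 := pow_le_one₀ kp.le (k1 t htI)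
      have h7 := mul_le_mul_of_nonneg_left h6 hc1
      simp only [h4]
      linarith
  have hτI : τ ∈ Icc τ t0 := left_mem_Icc.2 hτ.le
  have B : ∀ t ∈ Icc τ t0, -(- N τ + c1) ≤ N t * k t ^ 3 := by
    intro t ht
    have h6 : k τ ^ 3 ≤ 1 := pow_le_one₀ (kpos τ hτI).le (k1 τ hτI)
    have h7 := mul_le_mul_of_nonneg_left h6 (neg_nonneg.2 (N0 τ hτI))
    have h8 : c1 * (t - τ) ≤ c1 * 1 := mul_le_mul_of_nonneg_left (by linarith [ht.2]) hc1
    linarith [A t ht]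
  set N2 := C3 * (- N τ + c1) + 1 + c2 with hN2
  have Cc : ∀ t ∈ Icc τ t0, log (H τ) + 2 * N2 * (k τ)⁻¹ ≤ log (H t) + 2 * N2 * (k t)⁻¹ := by
    refine mono_of_deriv (f := fun t => log (H t) + 2 * N2 * (k t)⁻¹) (f' := fun t => H1 t / H t +
      2 * N2 * (-(-1 / (2 * k t)) / k t ^ 2)) hτ.le ?_ ?_ ?_
    · exact (cH.log fun t ht => (Hpos t ht).ne').add (continuousOn_const.mul (ck.inv₀ fun t ht => (kpos t ht).ne'))
    · intro t ht
      have htI := Ioo_subset_Icc_self ht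
      exact ((dH t ht).log (Hpos t htI).ne').fun_add (((dk t htI).fun_inv (kpos t htI).ne').const_mul _)
    · intro t ht
      have htI := Ioo_subset_Icc_self ht
      have kp := kpos t htI
      have h1 : C3 * N t - (1 / k t ^ 2 + c2) ≤ H1 t / H t := by
        rw [le_div_iff₀ (Hpos t htI), ksq t htI]
        have := hH t ht
        rw [← NH t htI] at this
        linarith
      have h2 : 2 * N2 * (-(-1 / (2 * k t)) / k t ^ 2) = N2 / k t ^ 3 := by field_simp
      have h3 : -N2 / k t ^ 3 ≤ C3 * N t - (1 / k t ^ 2 + c2) := by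
        rw [div_le_iff₀ (pow_pos kp 3)]
        have e1 := mul_le_mul_of_nonneg_left (B t htI) hC3
        have e2 : 1 / k t ^ 2 * k t ^ 3 = k t := by field_simp
        have e3 : c2 * k t ^ 3 ≤ c2 * 1 := mul_le_mul_of_nonneg_left (pow_le_one₀ kp.le (k1 t htI)) hc2
        have e4 := k1 t htI
        have e5 : (C3 * N t - (1 / k t ^ 2 + c2)) * k t ^ 3 = C3 * (N t * k t ^ 3) - 1 / k t ^ 2 * k t ^ 3 - c2 * k t ^ 3 := by ring
        rw [e5, e2]
        linarith
      rw [neg_div] at h3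
      rw [h2]
      linarith
  have fin := Cc t0 (right_mem_Icc.2 hτ.le)
  have e1 : k t0 = √θ := by simp [hk]
  have e2 : 0 ≤ 2 * N2 * (k τ)⁻¹ := by
    have := N0 τ hτI
    have := kpos τ hτI
    have : 0 ≤ C3 * (- N τ + c1) := mul_nonneg hC3 (by linarith)
    have : 0 ≤ N2 := by linarith
    positivity
  have e3 : 2 * (C3 * (- D τ / H τ + c1) + 1 + c2) / √θ = 2 * N2 * (k t0)⁻¹ := by
    rw [e1, hN2, hNdef, div_eq_mul_inv _ (√θ)]
    ring
  rw [e3]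
  linarith

open Real Set Filter

lemma weight_ode {τ t0 θ R ε δ M L C2 a0 : ℝ} {a at' ax v vt vx vxx f : ℝ → ℝ → ℝ} {g : ℝ → ℝ} (hτ : τ < t0)
    (hθ : 0 < θ) (h1 : t0 + θ - τ ≤ 1) (hR : 0 < R)
    (hε : 0 < ε) (hδ : 0 < δ) (hM : 0 ≤ M) (hg : ∀ t, 0 ≤ g t)
    (hL : L = M * (3 + 6 * ε)) (ha00 : 0 ≤ a0)
    (ca : CO a τ t0 (-R) R) (cat : CO at' τ t0 (-R) R) (cax : CO ax τ t0 (-R) R)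
    (cv : CO v τ t0 (-R) R) (cvt : CO vt τ t0 (-R) R) (cvx : CO vx τ t0 (-R) R) (cvxx : CO vxx τ t0 (-R) R)
    (da : ∀ t ∈ Ioo τ t0, ∀ x ∈ Icc (-R) R, HasDerivAt (fun s => a s x) (at' t x) t)
    (dax : ∀ t ∈ Icc τ t0, ∀ x ∈ Icc (-R) R, HasDerivAt (fun y => a t y) (ax t x) x)
    (dv : ∀ t ∈ Ioo τ t0, ∀ x ∈ Icc (-R) R, HasDerivAt (fun s => v s x) (vt t x) t)
    (dvx : ∀ t ∈ Icc τ t0, ∀ x ∈ Icc (-R) R, HasDerivAt (fun y => v t y) (vx t x) x)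
    (dvxx : ∀ t ∈ Icc τ t0, ∀ x ∈ Icc (-R) R, HasDerivAt (fun y => vx t y) (vxx t x) x)
    (hv1 : ∀ t ∈ Icc τ t0, v t (-R) = 0) (hv2 : ∀ t ∈ Icc τ t0, v t R = 0)
    (hvx1 : ∀ t ∈ Icc τ t0, vx t (-R) = 0) (hvx2 : ∀ t ∈ Icc τ t0, vx t R = 0)
    (hδa : ∀ t ∈ Icc τ t0, ∀ x ∈ Icc (-R) R, δ ≤ a t x)
    (hs1 : ∀ t ∈ Icc τ t0, ∀ x ∈ Icc (-R) R, 0.475 ≤ 4 * ε * a t x)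
    (hs2 : ∀ t ∈ Icc τ t0, ∀ x ∈ Icc (-R) R, 4 * ε * a t x ≤ 0.525)
    (hat : ∀ t ∈ Icc τ t0, ∀ x ∈ Icc (-R) R, |at' t x| ≤ M)
    (hax : ∀ t ∈ Icc τ t0, ∀ x ∈ Icc (-R) R, |ax t x| ≤ M)
    (hxM : 4 * ε * (R * M) ≤ 0.1)
    (ha0 : ∀ t ∈ Icc τ t0, ∀ x ∈ Icc (-R) R, |a t x - a0| ≤ M * (|x| + (t0 + θ - t)))
    (hf : ∀ t ∈ Icc τ t0, ∀ x ∈ Icc (-R) R, |f t x| ≤ M * (|v t x| + |vx t x| + 2 * ε * |x| / (t0 + θ - t) * |v t x|) + g t)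
    (hh1 : (t0 + θ - τ) * (M + 2 * L ^ 2) ≤ 0.2 * δ)
    (hh2 : (t0 + θ - τ) * (4 * ε ^ 2 * M + 2 * L ^ 2) ≤ 0.08 * ε)
    (hC2 : 0 ≤ C2) (hC : 4 * L ^ 2 ≤ C2 * δ) (hC' : 10 * L ^ 2 ≤ C2 * ε)
    {P : ℝ → ℝ → ℝ} (hP : ∀ t x, P t x = ε * x ^ 2 / (t0 + θ - t) ^ 2 * (4 * ε * a t x - 1))
    (hvt : ∀ t ∈ Icc τ t0, ∀ x ∈ Icc (-R) R, vt t x = (ax t x * vx t x + a t x * vxx t x) + P t x * v t x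
      + 4 * ε * x * a t x / (t0 + θ - t) * vx t x
      + 2 * ε * a0 / (t0 + θ - t) * v t x + (- ax t x * vx t x + 2 * ε / (t0 + θ - t) * (a t x - a0) * v t x + f t x))
    {H D : ℝ → ℝ} (hH : ∀ t, H t = ∫ x in (-R)..R, v t x ^ 2)
    (hD : ∀ t, D t = ∫ x in (-R)..R, (-a t x * vx t x ^ 2 + P t x * v t x ^ 2))
    (Hpos : ∀ t ∈ Icc τ t0, 0 < H t) (Hg : ∀ t ∈ Icc τ t0, 8 * R * g t ^ 2 ≤ H t) :
    log (H τ) - 2 * ((2 + C2) * (- D τ / H τ + (2 * L ^ 2 + 1)) + 1 + (2 + 4 * L ^ 2)) / √θ ≤ log (H t0) := by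
  have hAB : -R ≤ R := by linarith
  have hh : ∀ t ∈ Icc τ t0, 0 < t0 + θ - t := fun t ht => by linarith [ht.2]
  have hpow : ∀ n : ℕ, CO (fun t x => (t0 + θ - t) ^ n) τ t0 (-R) R := fun n => by
    unfold CO; fun_prop
  have ch : ∀ (n : ℕ) (q : ℝ → ℝ → ℝ), CO q τ t0 (-R) R → CO (fun t x => q t x / (t0 + θ - t) ^ n) τ t0 (-R) R :=
    fun n q hq => ContinuousOn.div hq (hpow n) (fun p hp => (pow_pos (hh p.1 hp.1) n).ne')
  have cx : ∀ c : ℝ, CO (fun t x => c * x ^ 2) τ t0 (-R) R := fun c => by unfold CO; fun_prop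
  have c1 : CO (fun t x => 1) τ t0 (-R) R := by unfold CO; fun_prop
  have hPe : P = fun t x => ε * x ^ 2 / (t0 + θ - t) ^ 2 * (4 * ε * a t x - 1) := by
    funext t x; exact hP t x
  have cP : CO P τ t0 (-R) R := by
    rw [hPe]
    exact (ch 2 _ (cx ε)).mul ((ca.const_mul (4 * ε)).sub c1)
  set Pt : ℝ → ℝ → ℝ := fun t x => 2 * ε * x ^ 2 / (t0 + θ - t) ^ 3 * (4 * ε * a t x - 1) + 4 * ε ^ 2 * x ^ 2 / (t0 + θ - t) ^ 2 * at' t x with hPt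
  have cPt : CO Pt τ t0 (-R) R :=
    ((ch 3 _ (cx (2 * ε))).mul ((ca.const_mul (4 * ε)).sub c1)).add ((ch 2 _ (cx (4 * ε ^ 2))).mul cat)
  have dP : ∀ t ∈ Ioo τ t0, ∀ x ∈ Icc (-R) R, HasDerivAt (fun s => P s x) (Pt t x) t := by
    intro t ht x hx
    have hp := (hh t (Ioo_subset_Icc_self ht)).ne'
    have e1 := ((hasDerivAt_id' t).const_sub (t0 + θ)).fun_pow 2
    have e2 := (hasDerivAt_const t (ε * x ^ 2)).fun_div e1 (pow_ne_zero 2 hp)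
    have e3 := e2.fun_mul (((da t ht x hx).const_mul (4 * ε)).sub_const 1)
    rw [hPe]
    refine e3.congr_deriv ?_
    simp only [hPt]
    field_simp
    push_cast
    ring
  have hHe : H = fun t => ∫ x in (-R)..R, v t x ^ 2 := funext hH
  have hDe : D = fun t => ∫ x in (-R)..R, (-a t x * vx t x ^ 2 + P t x * v t x ^ 2) := funext hD
  have cH : ContinuousOn H (Icc τ t0) := by rw [hHe]; exact (cv.pow 2).par_cont hAB
  have cD : ContinuousOn D (Icc τ t0) := by
    rw [hDe]; exact ((ca.neg.mul (cvx.pow 2)).add (cP.mul (cv.pow 2))).par_cont hAB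
  have dH : ∀ t ∈ Ioo τ t0, HasDerivAt H (∫ x in (-R)..R, 2 * v t x * vt t x) t := by
    intro t ht
    rw [hHe]
    refine (cv.pow 2).par_deriv ((cv.const_mul 2).mul cvt) hAB ?_ ht
    intro t ht x hx
    exact ((dv t ht x hx).fun_pow 2).congr_deriv (by push_cast; ring)
  have dD : ∀ t ∈ Ioo τ t0, HasDerivAt D (∫ x in (-R)..R, (2 * vt t x * (ax t x * vx t x + a t x * vxx t x + P t x * v t x)
      - at' t x * vx t x ^ 2 + Pt t x * v t x ^ 2)) t := by
    intro t ht
    have htI := Ioo_subset_Icc_self ht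
    have g1 := par_grad hAB ca cat cax cv cvt cvx cvxx da dax dv dvx dvxx hv1 hv2 ht
    have cc2 : CO (fun t x => Pt t x * v t x ^ 2 + P t x * (2 * v t x * vt t x)) τ t0 (-R) R :=
      (cPt.mul (cv.pow 2)).add (cP.mul ((cv.const_mul 2).mul cvt))
    have g2 := (cP.mul (cv.pow 2)).par_deriv cc2 hAB (by
      intro t ht x hx
      exact ((dP t ht x hx).fun_mul ((dv t ht x hx).fun_pow 2)).congr_deriv (by push_cast; ring)) ht
    have cc1 : CO (fun t x => at' t x * vx t x ^ 2 - 2 * vt t x * (ax t x * vx t x + a t x * vxx t x)) τ t0 (-R) R :=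
      (cat.mul (cvx.pow 2)).sub ((cvt.const_mul 2).mul ((cax.mul cvx).add (ca.mul cvxx)))
    have g3 := (g2.fun_sub g1)
    have ev : D =ᶠ[nhds t] fun t => (∫ x in (-R)..R, P t x * v t x ^ 2) - ∫ x in (-R)..R, a t x * vx t x ^ 2 := by
      filter_upwards [Ioo_mem_nhds ht.1 ht.2] with s hs
      have hsI := Ioo_subset_Icc_self hs
      rw [hD, ← intervalIntegral.integral_sub ((cP.mul (cv.pow 2)).intble hAB hsI) ((ca.mul (cvx.pow 2)).intble hAB hsI)]
      refine intervalIntegral.integral_congr fun x hx => ?_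
      ring
    refine (g3.congr_of_eventuallyEq ev).congr_deriv ?_
    rw [← intervalIntegral.integral_sub (cc2.intble hAB htI) (cc1.intble hAB htI)]
    refine intervalIntegral.integral_congr fun x hx => ?_
    ring
  have Dneg : ∀ t ∈ Icc τ t0, D t ≤ 0 := by
    intro t ht
    rw [hD, ← neg_nonneg, ← intervalIntegral.integral_neg]
    refine intervalIntegral.integral_nonneg hAB ?_
    intro x hx
    have e1 : 0 ≤ a t x * vx t x ^ 2 := mul_nonneg (hδ.le.trans (hδa t ht x hx)) (sq_nonneg _)
    have e2 : P t x ≤ 0 := by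
      rw [hP]
      exact mul_nonpos_of_nonneg_of_nonpos (by positivity) (by linarith [hs2 t ht x hx])
    have e3 : P t x * v t x ^ 2 ≤ 0 := mul_nonpos_of_nonpos_of_nonneg e2 (sq_nonneg _)
    linarith
  have hst : ∀ t ∈ Ioo τ t0, _ := fun t ht =>
    have htI := Ioo_subset_Icc_self ht
    have hle : t0 + θ - t ≤ t0 + θ - τ := by linarith [ht.1]
    step (h := t0 + θ - t) (m := 2 * ε * a0 / (t0 + θ - t)) (f := f t) hR (hh t htI) hε
      (div_nonneg (by positivity) (hh t htI).le) hδ hM (hg t) hL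
      (ca.slice htI) (cat.slice htI) (cax.slice htI) (cv.slice htI) (cvt.slice htI) (cvx.slice htI) (cvxx.slice htI)
      (dax t htI) (dvx t htI) (dvxx t htI) (hv1 t htI) (hv2 t htI) (hvx1 t htI) (hvx2 t htI)
      (hδa t htI) (hs1 t htI) (hs2 t htI) (hat t htI) (hax t htI) hxM (ha0 t htI) (hf t htI)
      ((mul_le_mul_of_nonneg_right hle (by positivity)).trans hh1)
      ((mul_le_mul_of_nonneg_right hle (by positivity)).trans hh2) hC hC'
      (P := P t) (Pt := Pt t) (hP t) (fun x => rfl) (hvt t htI) (hH t) (hD t) rfl rfl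
  refine ode hτ hθ h1 (by positivity) (by positivity) (by positivity) cH cD dH dD Hpos Dneg ?_ ?_
  · intro t ht N hN hNH
    have := (hst t ht).1 N hN hNH
    have h8 := Hg t (Ioo_subset_Icc_self ht)
    have h9 : 0 ≤ R * g t ^ 2 := by positivity
    linarith
  · intro t ht
    have := (hst t ht).2
    have h8 := Hg t (Ioo_subset_Icc_self ht)
    linarith

open Real Set Filter

lemma weight_fix {τ t0 θ R ε δ M L C2 a0 Kb : ℝ} {a at' ax W Wt Wx Wxx : ℝ → ℝ → ℝ} (hτ : τ < t0)
    (hθ : 0 < θ) (h1 : t0 + θ - τ ≤ 1) (hR : 0 < R)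
    (hε : 0 < ε) (hδ : 0 < δ) (hM : 0 ≤ M) (hKb : 0 ≤ Kb)
    (hL : L = M * (3 + 6 * ε)) (ha00 : 0 ≤ a0)
    (ca : CO a τ t0 (-R) R) (cat : CO at' τ t0 (-R) R) (cax : CO ax τ t0 (-R) R)
    (cW : CO W τ t0 (-R) R) (cWt : CO Wt τ t0 (-R) R) (cWx : CO Wx τ t0 (-R) R) (cWxx : CO Wxx τ t0 (-R) R)
    (da : ∀ t ∈ Ioo τ t0, ∀ x ∈ Icc (-R) R, HasDerivAt (fun s => a s x) (at' t x) t)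
    (dax : ∀ t ∈ Icc τ t0, ∀ x ∈ Icc (-R) R, HasDerivAt (fun y => a t y) (ax t x) x)
    (dW : ∀ t ∈ Ioo τ t0, ∀ x ∈ Icc (-R) R, HasDerivAt (fun s => W s x) (Wt t x) t)
    (dWx : ∀ t ∈ Icc τ t0, ∀ x ∈ Icc (-R) R, HasDerivAt (fun y => W t y) (Wx t x) x)
    (dWxx : ∀ t ∈ Icc τ t0, ∀ x ∈ Icc (-R) R, HasDerivAt (fun y => Wx t y) (Wxx t x) x)
    (hW1 : ∀ t ∈ Icc τ t0, W t (-R) = 0) (hW2 : ∀ t ∈ Icc τ t0, W t R = 0)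
    (hWx1 : ∀ t ∈ Icc τ t0, Wx t (-R) = 0) (hWx2 : ∀ t ∈ Icc τ t0, Wx t R = 0)
    (hδa : ∀ t ∈ Icc τ t0, ∀ x ∈ Icc (-R) R, δ ≤ a t x)
    (hs1 : ∀ t ∈ Icc τ t0, ∀ x ∈ Icc (-R) R, 0.475 ≤ 4 * ε * a t x)
    (hs2 : ∀ t ∈ Icc τ t0, ∀ x ∈ Icc (-R) R, 4 * ε * a t x ≤ 0.525)
    (hat : ∀ t ∈ Icc τ t0, ∀ x ∈ Icc (-R) R, |at' t x| ≤ M)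
    (hax : ∀ t ∈ Icc τ t0, ∀ x ∈ Icc (-R) R, |ax t x| ≤ M)
    (hxM : 4 * ε * (R * M) ≤ 0.1)
    (ha0 : ∀ t ∈ Icc τ t0, ∀ x ∈ Icc (-R) R, |a t x - a0| ≤ M * (|x| + (t0 - t)))
    (hf1 : ∀ t ∈ Icc τ t0, ∀ x ∈ Icc (-R) R, |Wt t x - a t x * Wxx t x| ≤ M * (|W t x| + |Wx t x|) + Kb)
    (hf2 : ∀ t ∈ Icc τ t0, ∀ x ∈ Icc (-R) R, |x| ≤ R / 2 → |Wt t x - a t x * Wxx t x| ≤ M * (|W t x| + |Wx t x|))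
    (hh1 : (t0 + θ - τ) * (M + 2 * L ^ 2) ≤ 0.2 * δ)
    (hh2 : (t0 + θ - τ) * (4 * ε ^ 2 * M + 2 * L ^ 2) ≤ 0.08 * ε)
    (hC2 : 0 ≤ C2) (hC : 4 * L ^ 2 ≤ C2 * δ) (hC' : 10 * L ^ 2 ≤ C2 * ε)
    {H D : ℝ → ℝ} (hH : ∀ t, H t = ∫ x in (-R)..R, (rexp (-(ε * x ^ 2 / (t0 + θ - t))) * W t x) ^ 2)
    (hD : ∀ t, D t = ∫ x in (-R)..R, (-a t x * (-(2 * ε * x / (t0 + θ - t)) * (rexp (-(ε * x ^ 2 / (t0 + θ - t))) * W t x) + rexp (-(ε * x ^ 2 / (t0 + θ - t))) * Wx t x) ^ 2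
      + (ε * x ^ 2 / (t0 + θ - t) ^ 2 * (4 * ε * a t x - 1)) * (rexp (-(ε * x ^ 2 / (t0 + θ - t))) * W t x) ^ 2))
    (Hpos : ∀ t ∈ Icc τ t0, 0 < H t)
    (Hg : ∀ t ∈ Icc τ t0, 8 * R * (Kb * rexp (-(ε * (R / 2) ^ 2 / (t0 + θ - t)))) ^ 2 ≤ H t) :
    log (H τ) - 2 * ((2 + C2) * (- D τ / H τ + (2 * L ^ 2 + 1)) + 1 + (2 + 4 * L ^ 2)) / √θ ≤ log (H t0) := by
  have hh : ∀ t ∈ Icc τ t0, 0 < t0 + θ - t := fun t ht => by linarith [ht.2]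
  set E : ℝ → ℝ → ℝ := fun t x => rexp (-(ε * x ^ 2 / (t0 + θ - t))) with hE
  have Epos : ∀ t x, 0 < E t x := fun t x => exp_pos _
  have ch : ∀ (n : ℕ) (q : ℝ → ℝ → ℝ), CO q τ t0 (-R) R → CO (fun t x => q t x / (t0 + θ - t) ^ n) τ t0 (-R) R :=
    fun n q hq => ContinuousOn.div hq (by fun_prop) (fun p hp => (pow_pos (hh p.1 hp.1) n).ne')
  have ch1 : ∀ (q : ℝ → ℝ → ℝ), CO q τ t0 (-R) R → CO (fun t x => q t x / (t0 + θ - t)) τ t0 (-R) R :=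
    fun q hq => ContinuousOn.div hq (by fun_prop) (fun p hp => (hh p.1 hp.1).ne')
  have cx2 : ∀ c : ℝ, CO (fun t x => c * x ^ 2) τ t0 (-R) R := fun c => by unfold CO; fun_prop
  have cx1 : ∀ c : ℝ, CO (fun t x => c * x) τ t0 (-R) R := fun c => by unfold CO; fun_prop
  have cx0 : ∀ c : ℝ, CO (fun t x => c) τ t0 (-R) R := fun c => by unfold CO; fun_prop
  have cE : CO E τ t0 (-R) R := ContinuousOn.rexp (ch1 _ (cx2 ε)).neg
  have cEW := cE.mul cW
  have cvx := ((ch1 _ (cx1 (2 * ε))).neg.mul cEW).add (cE.mul cWx)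
  have dEt : ∀ t ∈ Ioo τ t0, ∀ x, HasDerivAt (fun s => E s x) (-(ε * x ^ 2 / (t0 + θ - t) ^ 2) * E t x) t := by
    intro t ht x
    have hp := (hh t (Ioo_subset_Icc_self ht)).ne'
    have e1 := (((hasDerivAt_const t (ε * x ^ 2)).fun_div ((hasDerivAt_id' t).const_sub (t0 + θ)) hp).fun_neg).exp
    refine e1.congr_deriv ?_
    simp only [hE]
    ring
  have dEx : ∀ t ∈ Icc τ t0, ∀ x, HasDerivAt (fun y => E t y) (-(2 * ε * x / (t0 + θ - t)) * E t x) x := by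
    intro t ht x
    have e1 := (((((hasDerivAt_id' x).fun_pow 2).const_mul ε).div_const (t0 + θ - t)).fun_neg).exp
    refine e1.congr_deriv ?_
    simp only [hE]
    push_cast
    ring
  have dvx : ∀ t ∈ Icc τ t0, ∀ x ∈ Icc (-R) R, HasDerivAt (fun y => E t y * W t y)
      (-(2 * ε * x / (t0 + θ - t)) * (E t x * W t x) + E t x * Wx t x) x := by
    intro t ht x hx
    exact ((dEx t ht x).fun_mul (dWx t ht x hx)).congr_deriv (by ring)
  refine weight_ode (v := fun t x => E t x * W t x) (vt := fun t x => -(ε * x ^ 2 / (t0 + θ - t) ^ 2) * (E t x * W t x) + E t x * Wt t x)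
    (vx := fun t x => -(2 * ε * x / (t0 + θ - t)) * (E t x * W t x) + E t x * Wx t x)
    (vxx := fun t x => (-(2 * ε / (t0 + θ - t)) * (E t x * W t x) + -(2 * ε * x / (t0 + θ - t)) * (-(2 * ε * x / (t0 + θ - t)) * (E t x * W t x) + E t x * Wx t x))
      + (-(2 * ε * x / (t0 + θ - t)) * E t x * Wx t x + E t x * Wxx t x))
    (f := fun t x => E t x * (Wt t x - a t x * Wxx t x)) (g := fun t => |Kb * rexp (-(ε * (R / 2) ^ 2 / (t0 + θ - t)))|)
    (P := fun t x => ε * x ^ 2 / (t0 + θ - t) ^ 2 * (4 * ε * a t x - 1))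
    hτ hθ h1 hR hε hδ hM (fun t => abs_nonneg _) hL ha00 ca cat cax cEW
    (((ch 2 _ (cx2 ε)).neg.mul cEW).add (cE.mul cWt)) cvx
    ((((ch1 _ (cx0 (2 * ε))).neg.mul cEW).add ((ch1 _ (cx1 (2 * ε))).neg.mul cvx)).add
      (((ch1 _ (cx1 (2 * ε))).neg.mul cE |>.mul cWx).add (cE.mul cWxx)))
    da dax ?_ dvx ?_ ?_ ?_ ?_ ?_ hδa hs1 hs2 hat hax hxM ?_ ?_ hh1 hh2 hC2 hC hC' (fun t x => rfl) ?_ hH hD Hpos ?_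
  · intro t ht x hx
    exact ((dEt t ht x).fun_mul (dW t ht x hx)).congr_deriv (by ring)
  · intro t ht x hx
    have e1 : HasDerivAt (fun y => -(2 * ε * y / (t0 + θ - t))) (-(2 * ε / (t0 + θ - t))) x :=
      (((hasDerivAt_id' x).const_mul (2 * ε)).div_const (t0 + θ - t)).fun_neg.congr_deriv (by ring)
    exact (e1.fun_mul (dvx t ht x hx)).fun_add ((dEx t ht x).fun_mul (dWxx t ht x hx))
  · intro t ht; simp [hW1 t ht]
  · intro t ht; simp [hW2 t ht]
  · intro t ht; simp [hW1 t ht, hWx1 t ht]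
  · intro t ht; simp [hW2 t ht, hWx2 t ht]
  · intro t ht x hx
    exact (ha0 t ht x hx).trans (mul_le_mul_of_nonneg_left (by linarith) hM)
  · intro t ht x hx
    have hp := hh t ht
    have hEp := Epos t x
    set G := |Kb * rexp (-(ε * (R / 2) ^ 2 / (t0 + θ - t)))| with hG
    have hb : |E t x * (Wt t x - a t x * Wxx t x)| ≤ M * (E t x * |W t x| + E t x * |Wx t x|) + G := by
      rw [abs_mul, abs_of_pos hEp]
      rcases le_total |x| (R / 2) with hxR | hxR
      · have := mul_le_mul_of_nonneg_left (hf2 t ht x hx hxR) hEp.le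
        have hG0 : 0 ≤ G := abs_nonneg _
        linarith
      · have := mul_le_mul_of_nonneg_left (hf1 t ht x hx) hEp.le
        have h3 : Kb * E t x ≤ G := by
          refine le_trans ?_ (le_abs_self _)
          refine mul_le_mul_of_nonneg_left ?_ hKb
          refine exp_le_exp.2 (neg_le_neg ?_)
          have : (R / 2) ^ 2 ≤ x ^ 2 := by
            rw [← sq_abs x]; exact pow_le_pow_left₀ (by linarith) hxR 2
          gcongr
        linarith
    have e1 : |E t x * W t x| = E t x * |W t x| := by rw [abs_mul, abs_of_pos hEp]
    have e2 : E t x * |Wx t x| ≤ |-(2 * ε * x / (t0 + θ - t)) * (E t x * W t x) + E t x * Wx t x| +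
        2 * ε * |x| / (t0 + θ - t) * |E t x * W t x| := by
      have t1 : E t x * |Wx t x| = |E t x * Wx t x| := by rw [abs_mul, abs_of_pos hEp]
      have t2 : 2 * ε * |x| / (t0 + θ - t) * |E t x * W t x| = |-(2 * ε * x / (t0 + θ - t)) * (E t x * W t x)| := by
        rw [abs_mul (-(2 * ε * x / (t0 + θ - t))), abs_neg, abs_div, abs_of_pos hp, abs_mul (2 * ε) x, abs_of_pos (by positivity : 0 < 2 * ε)]
      rw [t1, t2]
      have := abs_sub (-(2 * ε * x / (t0 + θ - t)) * (E t x * W t x) + E t x * Wx t x) (-(2 * ε * x / (t0 + θ - t)) * (E t x * W t x))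
      rwa [add_sub_cancel_left] at this
    have := mul_le_mul_of_nonneg_left e2 hM
    rw [e1] at this ⊢
    linarith
  · intro t ht x hx
    have hp := (hh t ht).ne'
    field_simp
    ring
  · intro t ht
    simp only [sq_abs]
    exact Hg t ht

open Real Set Filter

lemma lim_contra {A B C h1 : ℝ} (hA : 0 < A) (hh : 0 < h1)
    (h : ∀ θ ∈ Ioc 0 h1, A / θ ≤ B + C / √θ) : False := by
  have ht : Tendsto (fun s : ℝ => B * s ^ 2 + C * s) (nhdsWithin 0 (Ioi 0)) (nhds 0) := by
    have : Continuous (fun s : ℝ => B * s ^ 2 + C * s) := by fun_prop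
    have h2 := this.tendsto 0
    simp only [ne_eq, OfNat.ofNat_ne_zero, not_false_eq_true, zero_pow, mul_zero, add_zero] at h2
    exact h2.mono_left nhdsWithin_le_nhds
  have : A ≤ 0 := by
    refine ge_of_tendsto ht ?_
    have h3 : Ioo 0 (√h1) ∈ nhdsWithin (0:ℝ) (Ioi 0) := Ioo_mem_nhdsGT (sqrt_pos.2 hh)
    filter_upwards [h3] with s hs
    have hs0 := hs.1
    have hle : s ^ 2 ≤ h1 := by
      have := pow_le_pow_left₀ hs.1.le hs.2.le 2
      rwa [sq_sqrt hh.le] at this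
    have h4 := h (s ^ 2) ⟨by positivity, hle⟩
    rw [sqrt_sq hs0.le, div_le_iff₀ (by positivity)] at h4
    have e : (B + C / s) * s ^ 2 = B * s ^ 2 + C * s := by field_simp
    linarith
  linarith

lemma H_low {W : ℝ → ℝ → ℝ} {t1 t0 R ε x1 : ℝ} (ht : t1 < t0) (hR : 0 < R) (hε : 0 < ε)
    (cW : CO W t1 t0 (-R) R) (hx1 : |x1| < R / 4) (hW : W t0 x1 ≠ 0) :
    ∃ η > 0, ∃ c0 > 0, ∀ t ∈ Icc t1 t0, t0 - t ≤ η → ∀ h > 0,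
      c0 * rexp (-(ε * (R / 4) ^ 2 / h)) ^ 2 ≤ ∫ x in (-R)..R, (rexp (-(ε * x ^ 2 / h)) * W t x) ^ 2 := by
  have hx1' := abs_lt.1 hx1
  set w0 := |W t0 x1| / 2 with hw0
  have hw0p : 0 < w0 := by have := abs_pos.2 hW; positivity
  have hc : ContinuousWithinAt (fun p : ℝ × ℝ => |W p.1 p.2|) (Icc t1 t0 ×ˢ Icc (-R) R) (t0, x1) :=
    (cW (t0, x1) ⟨right_mem_Icc.2 ht.le, by constructor <;> linarith⟩).abs
  have hev : ∀ᶠ p in nhdsWithin (t0, x1) (Icc t1 t0 ×ˢ Icc (-R) R), w0 < |W p.1 p.2| :=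
    hc.eventually (lt_mem_nhds (by simp only [hw0]; have := abs_pos.2 hW; linarith))
  obtain ⟨ρ, hρ, hball⟩ := Metric.mem_nhdsWithin_iff.1 hev
  set σ := min (ρ / 2) (R / 4 - |x1|) with hσ
  have hσp : 0 < σ := lt_min (by linarith) (by linarith)
  have hσ1 : σ ≤ ρ / 2 := min_le_left _ _
  have hσ2 : σ ≤ R / 4 - |x1| := min_le_right _ _
  have hl := neg_abs_le x1
  have hr := le_abs_self x1
  refine ⟨ρ / 2, by linarith, 2 * σ * w0 ^ 2, by positivity, fun t ht' hη h hh => ?_⟩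
  have cF : ContinuousOn (fun x => (rexp (-(ε * x ^ 2 / h)) * W t x) ^ 2) (Icc (-R) R) := by
    have := cW.slice ht'
    fun_prop
  have iF := cF.intervalIntegrable_of_Icc (μ := MeasureTheory.volume) (by linarith : -R ≤ R)
  have m1 : ∫ x in (x1 - σ)..(x1 + σ), (rexp (-(ε * x ^ 2 / h)) * W t x) ^ 2 ≤
      ∫ x in (-R)..R, (rexp (-(ε * x ^ 2 / h)) * W t x) ^ 2 := by
    refine intervalIntegral.integral_mono_interval (by linarith) (by linarith) (by linarith) ?_ iF
    exact Eventually.of_forall fun x => sq_nonneg _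
  refine le_trans ?_ m1
  have m2 : ∫ x in (x1 - σ)..(x1 + σ), (rexp (-(ε * (R / 4) ^ 2 / h)) * w0) ^ 2 ≤
      ∫ x in (x1 - σ)..(x1 + σ), (rexp (-(ε * x ^ 2 / h)) * W t x) ^ 2 := by
    refine intervalIntegral.integral_mono_on (by linarith) intervalIntegrable_const ?_ ?_
    · exact (cF.mono (Icc_subset_Icc (by linarith) (by linarith))).intervalIntegrable_of_Icc (by linarith)
    · intro x hx
      have hxR : |x| ≤ R / 4 := abs_le.2 ⟨by linarith [hx.1], by linarith [hx.2]⟩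
      have hx2 : x ^ 2 ≤ (R / 4) ^ 2 := by
        rw [← sq_abs x]; exact pow_le_pow_left₀ (abs_nonneg _) hxR 2
      have hWx : w0 < |W t x| := by
        refine hball (a := (t, x)) ⟨?_, ht', by constructor <;> linarith [hx.1, hx.2]⟩
        rw [Metric.mem_ball, Prod.dist_eq, max_lt_iff, Real.dist_eq, Real.dist_eq]
        constructor
        · rw [abs_lt]; constructor <;> linarith [ht'.2]
        · rw [abs_lt]; constructor <;> linarith [hx.1, hx.2]
      rw [← sq_abs (rexp (-(ε * x ^ 2 / h)) * W t x), abs_mul, abs_of_pos (exp_pos _)]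
      gcongr
  refine le_trans (le_of_eq ?_) m2
  rw [intervalIntegral.integral_const]
  simp only [smul_eq_mul]
  ring

open Real Set Filter

lemma small_ev (A : ℝ) {B : ℝ} (hB : 0 < B) : ∀ᶠ h in nhdsWithin (0:ℝ) (Ioi 0), 2 * h * A ≤ B := by
  have : Continuous (fun s : ℝ => 2 * s * A) := by fun_prop
  have h2 := this.tendsto 0
  simp only [mul_zero, zero_mul] at h2
  filter_upwards [nhdsWithin_le_nhds (h2 (Iio_mem_nhds hB))] with s hs using le_of_lt hs

lemma d_pt {x h h1 ε a A W Wx CW Cx R E : ℝ} (hε : 0 < ε) (hR : 0 < R) (hh1 : 0 < h1) (hhl : h1 ≤ h)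
    (hCW : 0 ≤ CW) (hCx : 0 ≤ Cx) (hxR : |x| ≤ R) (ap : 0 < a) (hs2 : a ≤ A)
    (h4a : 0.475 ≤ 4 * ε * a) (h4b : 4 * ε * a ≤ 0.525) (bW : |W| ≤ CW) (bWx : |Wx| ≤ Cx) (hE0 : 0 < E) (hE1 : E ≤ 1) :
    ‖-a * (-(2 * ε * x / h) * (E * W) + E * Wx) ^ 2 + (ε * x ^ 2 / h ^ 2 * (4 * ε * a - 1)) * (E * W) ^ 2‖ ≤
      A * (2 * ε * R / h1 * CW + Cx) ^ 2 + ε * R ^ 2 / h1 ^ 2 * CW ^ 2 := by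
  have hhp : 0 < h := by linarith
  have b1 : |E * W| ≤ CW := by
    rw [abs_mul, abs_of_pos hE0]
    calc E * |W| ≤ 1 * CW := by gcongr
      _ = CW := one_mul _
  have b2 : |E * Wx| ≤ Cx := by
    rw [abs_mul, abs_of_pos hE0]
    calc E * |Wx| ≤ 1 * Cx := by gcongr
      _ = Cx := one_mul _
  have b3 : |-(2 * ε * x / h)| ≤ 2 * ε * R / h1 := by
    rw [abs_neg, abs_div, abs_mul, abs_of_pos hhp, abs_of_pos (by positivity : 0 < 2 * ε)]
    gcongr
  have b4 : |-(2 * ε * x / h) * (E * W) + E * Wx| ≤ 2 * ε * R / h1 * CW + Cx := by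
    refine (abs_add_le _ _).trans (add_le_add ?_ b2)
    rw [abs_mul]
    gcongr
  have b5 : |4 * ε * a - 1| ≤ 1 := by
    rw [abs_le]; constructor <;> linarith
  have hx2 : x ^ 2 ≤ R ^ 2 := by
    rw [← sq_abs x]; exact pow_le_pow_left₀ (abs_nonneg _) hxR 2
  refine (norm_add_le _ _).trans (add_le_add ?_ ?_)
  · rw [norm_mul, norm_neg, norm_pow, norm_eq_abs, norm_eq_abs, abs_of_pos ap]
    gcongr
    exact ap.le.trans hs2
  · rw [norm_mul, norm_mul, norm_pow, norm_eq_abs, norm_eq_abs, norm_eq_abs,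
      abs_of_nonneg (by positivity : 0 ≤ ε * x ^ 2 / h ^ 2)]
    calc ε * x ^ 2 / h ^ 2 * |4 * ε * a - 1| * |E * W| ^ 2
        ≤ ε * R ^ 2 / h1 ^ 2 * 1 * CW ^ 2 := by gcongr
      _ = ε * R ^ 2 / h1 ^ 2 * CW ^ 2 := by ring

set_option maxHeartbeats 1000000 in
lemma E_core {t1 t0 R δ M Kb x1 r : ℝ} {a at' ax W Wt Wx Wxx : ℝ → ℝ → ℝ} (ht : t1 < t0)
    (hR : 0 < R) (hδ : 0 < δ) (hM : 0 ≤ M) (hKb : 0 ≤ Kb)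
    (ca : CO a t1 t0 (-R) R) (cat : CO at' t1 t0 (-R) R) (cax : CO ax t1 t0 (-R) R)
    (cW : CO W t1 t0 (-R) R) (cWt : CO Wt t1 t0 (-R) R) (cWx : CO Wx t1 t0 (-R) R) (cWxx : CO Wxx t1 t0 (-R) R)
    (da : ∀ t ∈ Ioo t1 t0, ∀ x ∈ Icc (-R) R, HasDerivAt (fun s => a s x) (at' t x) t)
    (dax : ∀ t ∈ Icc t1 t0, ∀ x ∈ Icc (-R) R, HasDerivAt (fun y => a t y) (ax t x) x)
    (dW : ∀ t ∈ Ioo t1 t0, ∀ x ∈ Icc (-R) R, HasDerivAt (fun s => W s x) (Wt t x) t)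
    (dWx : ∀ t ∈ Icc t1 t0, ∀ x ∈ Icc (-R) R, HasDerivAt (fun y => W t y) (Wx t x) x)
    (dWxx : ∀ t ∈ Icc t1 t0, ∀ x ∈ Icc (-R) R, HasDerivAt (fun y => Wx t y) (Wxx t x) x)
    (hW1 : ∀ t ∈ Icc t1 t0, W t (-R) = 0) (hW2 : ∀ t ∈ Icc t1 t0, W t R = 0)
    (hWx1 : ∀ t ∈ Icc t1 t0, Wx t (-R) = 0) (hWx2 : ∀ t ∈ Icc t1 t0, Wx t R = 0)
    (hδa : ∀ t ∈ Icc t1 t0, ∀ x ∈ Icc (-R) R, δ ≤ a t x)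
    (hs1 : ∀ t ∈ Icc t1 t0, ∀ x ∈ Icc (-R) R, 0.95 * a t0 0 ≤ a t x)
    (hs2 : ∀ t ∈ Icc t1 t0, ∀ x ∈ Icc (-R) R, a t x ≤ 1.05 * a t0 0)
    (hat : ∀ t ∈ Icc t1 t0, ∀ x ∈ Icc (-R) R, |at' t x| ≤ M)
    (hax : ∀ t ∈ Icc t1 t0, ∀ x ∈ Icc (-R) R, |ax t x| ≤ M)
    (hxM : R * M ≤ 0.2 * δ)
    (ha0 : ∀ t ∈ Icc t1 t0, ∀ x ∈ Icc (-R) R, |a t x - a t0 0| ≤ M * (|x| + (t0 - t)))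
    (hf1 : ∀ t ∈ Icc t1 t0, ∀ x ∈ Icc (-R) R, |Wt t x - a t x * Wxx t x| ≤ M * (|W t x| + |Wx t x|) + Kb)
    (hf2 : ∀ t ∈ Icc t1 t0, ∀ x ∈ Icc (-R) R, |x| ≤ R / 2 → |Wt t x - a t x * Wxx t x| ≤ M * (|W t x| + |Wx t x|))
    (hx1 : |x1| < R / 4) (hW : W t0 x1 ≠ 0) (hr : 0 < r) (hz : ∀ x, |x| < r → W t0 x = 0) : False := by
  set a0 := a t0 0 with ha0def
  have h0I : (0:ℝ) ∈ Icc (-R) R := ⟨by linarith, hR.le⟩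
  have ha0δ : δ ≤ a0 := hδa t0 (right_mem_Icc.2 ht.le) 0 h0I
  have ha0p : 0 < a0 := hδ.trans_le ha0δ
  set ε := 1 / (8 * a0) with hεd
  have hε : 0 < ε := by positivity
  have hεa : 4 * ε * a0 = 1 / 2 := by rw [hεd]; field_simp; norm_num
  set L := M * (3 + 6 * ε) with hL
  set C2 := 4 * L ^ 2 / δ + 10 * L ^ 2 / ε with hC2
  have hC20 : 0 ≤ C2 := by positivity
  have hC : 4 * L ^ 2 ≤ C2 * δ := by
    have e1 : 4 * L ^ 2 / δ * δ = 4 * L ^ 2 := div_mul_cancel₀ _ hδ.ne'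
    have e2 : 0 ≤ 10 * L ^ 2 / ε * δ := by positivity
    rw [hC2, add_mul, e1]; linarith
  have hC' : 10 * L ^ 2 ≤ C2 * ε := by
    have e1 : 10 * L ^ 2 / ε * ε = 10 * L ^ 2 := div_mul_cancel₀ _ hε.ne'
    have e2 : 0 ≤ 4 * L ^ 2 / δ * ε := by positivity
    rw [hC2, add_mul, e1]; linarith
  obtain ⟨η, hη, c0, hc0, hlow⟩ := H_low (ε := ε) ht hR hε cW hx1 hW
  have hpR : 0 < c0 * (2 * (ε * ((R / 2) ^ 2 - (R / 4) ^ 2))) := by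
    have e : (R / 2) ^ 2 - (R / 4) ^ 2 = 3 / 16 * R ^ 2 := by ring
    rw [e]; positivity
  obtain ⟨h1, ⟨q1, q2, q3, q4, q5, q6⟩⟩ := ((small_ev (M + 2 * L ^ 2) (by positivity : 0 < 0.2 * δ)).and
    ((small_ev (4 * ε ^ 2 * M + 2 * L ^ 2) (by positivity : 0 < 0.08 * ε)).and
    ((small_ev (8 * R * Kb ^ 2) hpR).and
    ((small_ev 1 (one_pos)).and ((small_ev (1 / 2) (lt_min hη (sub_pos.2 ht))).and
    (self_mem_nhdsWithin)))))).exists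
  have hh1 : 0 < h1 := q6
  have hη1 : h1 ≤ η := by have := q5.trans (min_le_left _ _); linarith
  have ht1 : h1 ≤ t0 - t1 := by have := q5.trans (min_le_right _ _); linarith
  set τ := t0 - h1 with hτ
  have hτ1 : t1 ≤ τ := by linarith
  have hτ0 : τ < t0 := by linarith
  have sub : Icc τ t0 ⊆ Icc t1 t0 := Icc_subset_Icc hτ1 le_rfl
  have sub' : Ioo τ t0 ⊆ Ioo t1 t0 := Ioo_subset_Ioo hτ1 le_rfl
  have subp : Icc τ t0 ×ˢ Icc (-R) R ⊆ Icc t1 t0 ×ˢ Icc (-R) R := prod_mono sub le_rfl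
  obtain ⟨CW, hCW, bW⟩ := cW.bdd
  obtain ⟨Cx, hCx, bWx⟩ := cWx.bdd
  set e0 := c0 * rexp (-(ε * (R / 4) ^ 2 / h1)) ^ 2 with he0
  have he0p : 0 < e0 := by positivity
  set d0 := (1.05 * a0 * (2 * ε * R / h1 * CW + Cx) ^ 2 + ε * R ^ 2 / h1 ^ 2 * CW ^ 2) * (2 * R) with hd0
  have hd0p : 0 ≤ d0 := by positivity
  set N := 2 * ((2 + C2) * (d0 / e0 + (2 * L ^ 2 + 1)) + 1 + (2 + 4 * L ^ 2)) with hN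
  refine lim_contra (A := 2 * ε * r ^ 2) (B := log (CW ^ 2 * (2 * R)) - log e0) (C := N) (h1 := h1)
    (by positivity) hh1 ?_
  intro θ hθ
  have hθ0 := hθ.1
  have hθ1 := hθ.2
  have hhτ : t0 + θ - τ = θ + h1 := by rw [hτ]; ring
  set H : ℝ → ℝ := fun t => ∫ x in (-R)..R, (rexp (-(ε * x ^ 2 / (t0 + θ - t))) * W t x) ^ 2 with hH
  set D : ℝ → ℝ := fun t => ∫ x in (-R)..R, (-a t x * (-(2 * ε * x / (t0 + θ - t)) * (rexp (-(ε * x ^ 2 / (t0 + θ - t))) * W t x) + rexp (-(ε * x ^ 2 / (t0 + θ - t))) * Wx t x) ^ 2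
      + (ε * x ^ 2 / (t0 + θ - t) ^ 2 * (4 * ε * a t x - 1)) * (rexp (-(ε * x ^ 2 / (t0 + θ - t))) * W t x) ^ 2) with hD
  have hlow' : ∀ t ∈ Icc τ t0, c0 * rexp (-(ε * (R / 4) ^ 2 / (t0 + θ - t))) ^ 2 ≤ H t := fun t ht' =>
    hlow t (sub ht') (by linarith [ht'.1]) _ (by linarith [ht'.2])
  have Hpos : ∀ t ∈ Icc τ t0, 0 < H t := fun t ht' => lt_of_lt_of_le (by positivity) (hlow' t ht')
  have h4a : ∀ t ∈ Icc τ t0, ∀ x ∈ Icc (-R) R, 0.475 ≤ 4 * ε * a t x := fun t ht' x hx => by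
    have := mul_le_mul_of_nonneg_left (hs1 t (sub ht') x hx) (by positivity : 0 ≤ 4 * ε)
    linarith
  have h4b : ∀ t ∈ Icc τ t0, ∀ x ∈ Icc (-R) R, 4 * ε * a t x ≤ 0.525 := fun t ht' x hx => by
    have := mul_le_mul_of_nonneg_left (hs2 t (sub ht') x hx) (by positivity : 0 ≤ 4 * ε)
    linarith
  have main := weight_fix (H := H) (D := D) (C2 := C2) (a0 := a0) hτ0 hθ0 (by linarith) hR hε hδ hM hKb hL ha0p.le
    (ca.mono subp) (cat.mono subp) (cax.mono subp) (cW.mono subp) (cWt.mono subp) (cWx.mono subp) (cWxx.mono subp)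
    (fun t h => da t (sub' h)) (fun t h => dax t (sub h)) (fun t h => dW t (sub' h)) (fun t h => dWx t (sub h))
    (fun t h => dWxx t (sub h)) (fun t h => hW1 t (sub h)) (fun t h => hW2 t (sub h)) (fun t h => hWx1 t (sub h))
    (fun t h => hWx2 t (sub h)) (fun t h => hδa t (sub h)) h4a h4b (fun t h => hat t (sub h)) (fun t h => hax t (sub h))
    (by
      have := mul_le_mul_of_nonneg_left (hxM.trans (mul_le_mul_of_nonneg_left ha0δ (by norm_num))) (by positivity : 0 ≤ 4 * ε)
      linarith)
    (fun t h => ha0 t (sub h)) (fun t h => hf1 t (sub h)) (fun t h => hf2 t (sub h))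
    (by
      refine le_trans (mul_le_mul_of_nonneg_right ?_ (by positivity)) q1
      linarith)
    (by
      refine le_trans (mul_le_mul_of_nonneg_right ?_ (by positivity)) q2
      linarith) hC20 hC hC' (fun t => rfl) (fun t => rfl) Hpos (by
      intro t ht'
      refine le_trans ?_ (hlow' t ht')
      have hhp : 0 < t0 + θ - t := by linarith [ht'.2]
      have hhl : t0 + θ - t ≤ 2 * h1 := by linarith [ht'.1]
      set h := t0 + θ - t with hh
      have ex : rexp (-(ε * (R / 4) ^ 2 / h)) ^ 2 = rexp (-(ε * (R / 2) ^ 2 / h)) ^ 2 *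
          rexp (2 * (ε * ((R / 2) ^ 2 - (R / 4) ^ 2)) / h) := by
        rw [← exp_nat_mul, ← exp_nat_mul, ← exp_add]
        congr 1
        push_cast
        ring
      rw [ex, mul_pow]
      have e1 : 8 * R * Kb ^ 2 ≤ c0 * rexp (2 * (ε * ((R / 2) ^ 2 - (R / 4) ^ 2)) / h) := by
        have e2 := add_one_le_exp (2 * (ε * ((R / 2) ^ 2 - (R / 4) ^ 2)) / h)
        have e3 : 8 * R * Kb ^ 2 ≤ c0 * (2 * (ε * ((R / 2) ^ 2 - (R / 4) ^ 2)) / h) := by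
          rw [← mul_div_assoc, le_div_iff₀ hhp]
          refine le_trans ?_ q3
          rw [mul_comm]
          exact mul_le_mul_of_nonneg_right hhl (by positivity)
        refine e3.trans (mul_le_mul_of_nonneg_left ?_ hc0.le)
        linarith
      have e4 := mul_le_mul_of_nonneg_right e1 (by positivity : 0 ≤ rexp (-(ε * (R / 2) ^ 2 / h)) ^ 2)
      linarith)
  have hτI : τ ∈ Icc τ t0 := left_mem_Icc.2 hτ0.le
  have hτI1 := sub hτI
  have HW : ∀ t x, |rexp (-(ε * x ^ 2 / (t0 + θ - t)))| = rexp (-(ε * x ^ 2 / (t0 + θ - t))) := fun t x => abs_of_pos (exp_pos _)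
  have E1 : ∀ t ∈ Icc τ t0, ∀ x, rexp (-(ε * x ^ 2 / (t0 + θ - t))) ≤ 1 := fun t ht' x => by
    refine exp_le_one_iff.2 (neg_nonpos.2 ?_)
    have : 0 < t0 + θ - t := by linarith [ht'.2]
    positivity
  have He0 : e0 ≤ H τ := by
    refine le_trans ?_ (hlow' τ hτI)
    rw [he0]
    gcongr
    linarith
  have Hup : H t0 ≤ CW ^ 2 * (2 * R) * rexp (-(2 * ε * r ^ 2 / θ)) := by
    have := intervalIntegral.norm_integral_le_of_norm_le_const (a := -R) (b := R)
      (f := fun x => (rexp (-(ε * x ^ 2 / (t0 + θ - t0))) * W t0 x) ^ 2) (C := CW ^ 2 * rexp (-(2 * ε * r ^ 2 / θ))) (by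
        intro x hx
        rw [uIoc_of_le (by linarith)] at hx
        have hxI : x ∈ Icc (-R) R := ⟨hx.1.le, hx.2⟩
        rw [norm_of_nonneg (sq_nonneg _)]
        rcases lt_or_ge |x| r with hxr | hxr
        · rw [hz x hxr]; simp; positivity
        · have hx2 : r ^ 2 ≤ x ^ 2 := by
            rw [← sq_abs x]; exact pow_le_pow_left₀ hr.le hxr 2
          have b := bW t0 (right_mem_Icc.2 ht.le) x hxI
          have b2 : W t0 x ^ 2 ≤ CW ^ 2 := by
            rw [← sq_abs (W t0 x)]; exact pow_le_pow_left₀ (abs_nonneg _) b 2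
          have b3 : rexp (-(ε * x ^ 2 / (t0 + θ - t0))) ^ 2 ≤ rexp (-(2 * ε * r ^ 2 / θ)) := by
            rw [← exp_nat_mul, add_sub_cancel_left]
            refine exp_le_exp.2 ?_
            have : ε * r ^ 2 / θ ≤ ε * x ^ 2 / θ := by gcongr
            have e : 2 * ε * r ^ 2 / θ = 2 * (ε * r ^ 2 / θ) := by ring
            rw [e]
            push_cast
            linarith
          rw [mul_pow, mul_comm]
          gcongr)
    have h5 := (le_abs_self _).trans this
    rw [show |R - -R| = 2 * R by rw [abs_of_pos (by linarith)]; ring] at h5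
    refine h5.trans (le_of_eq (by ring))
  have Dlow : - D τ ≤ d0 := by
    have := intervalIntegral.norm_integral_le_of_norm_le_const (a := -R) (b := R)
      (f := fun x => (-a τ x * (-(2 * ε * x / (t0 + θ - τ)) * (rexp (-(ε * x ^ 2 / (t0 + θ - τ))) * W τ x) + rexp (-(ε * x ^ 2 / (t0 + θ - τ))) * Wx τ x) ^ 2
      + (ε * x ^ 2 / (t0 + θ - τ) ^ 2 * (4 * ε * a τ x - 1)) * (rexp (-(ε * x ^ 2 / (t0 + θ - τ))) * W τ x) ^ 2))
      (C := 1.05 * a0 * (2 * ε * R / h1 * CW + Cx) ^ 2 + ε * R ^ 2 / h1 ^ 2 * CW ^ 2) (by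
        intro x hx
        rw [uIoc_of_le (by linarith)] at hx
        have hxI : x ∈ Icc (-R) R := ⟨hx.1.le, hx.2⟩
        exact d_pt hε hR hh1 (by linarith) hCW.le hCx.le (abs_le.2 hxI) (hδ.trans_le (hδa τ hτI1 x hxI)) (hs2 τ hτI1 x hxI)
          (h4a τ hτI x hxI) (h4b τ hτI x hxI) (bW τ hτI1 x hxI) (bWx τ hτI1 x hxI) (exp_pos _) (E1 τ hτI x))
    have h5 := (neg_le_abs _).trans this
    rw [show |R - -R| = 2 * R by rw [abs_of_pos (by linarith)]; ring] at h5
    exact h5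
  have l1 : log e0 ≤ log (H τ) := log_le_log he0p He0
  have l2 : log (H t0) ≤ log (CW ^ 2 * (2 * R)) - 2 * ε * r ^ 2 / θ := by
    have := log_le_log (Hpos t0 (right_mem_Icc.2 hτ0.le)) Hup
    rw [log_mul (by positivity) (by positivity), log_exp] at this
    linarith
  have l3 : 2 * ((2 + C2) * (- D τ / H τ + (2 * L ^ 2 + 1)) + 1 + (2 + 4 * L ^ 2)) / √θ ≤ N / √θ := by
    have : - D τ / H τ ≤ d0 / e0 := div_le_div₀ hd0p Dlow he0p He0
    rw [hN]
    gcongr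
  linarith

open Real Set Filter

lemma cutoff {R : ℝ} (hR : 0 < R) : ∃ χ χ' χ'' : ℝ → ℝ, (∀ x, HasDerivAt χ (χ' x) x) ∧
    (∀ x, HasDerivAt χ' (χ'' x) x) ∧ Continuous χ'' ∧
    (∀ x, |x| ≤ R / 2 → χ x = 1 ∧ χ' x = 0 ∧ χ'' x = 0) ∧ (∀ x, |x| = R → χ x = 0 ∧ χ' x = 0) := by
  let f : ContDiffBump (0 : ℝ) := ⟨2 * R / 3, 5 * R / 6, by positivity, by linarith⟩
  have hf : ContDiff ℝ 2 f := f.contDiff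
  have hf1 : ContDiff ℝ 1 (deriv f) := by
    have : ContDiff ℝ (1 + 1) f := by norm_num; exact hf
    exact (contDiff_succ_iff_deriv.1 this).2.2
  refine ⟨f, deriv f, deriv (deriv f), fun x => (hf.differentiable (by norm_num) x).hasDerivAt,
    fun x => (hf1.differentiable (by norm_num) x).hasDerivAt, hf1.continuous_deriv le_rfl, ?_, ?_⟩
  · intro x hx
    have hev : (f : ℝ → ℝ) =ᶠ[nhds x] fun _ => 1 := by
      have : Metric.ball (0:ℝ) (2 * R / 3) ∈ nhds x := Metric.isOpen_ball.mem_nhds (by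
        rw [mem_ball_zero_iff, norm_eq_abs]; linarith)
      filter_upwards [this] with y hy
      exact f.one_of_mem_closedBall (Metric.ball_subset_closedBall hy)
    have hev1 := hev.deriv
    have hev2 := hev1.deriv
    refine ⟨hev.eq_of_nhds, ?_, ?_⟩
    · rw [hev1.eq_of_nhds]; simp
    · rw [hev2.eq_of_nhds]; simp
  · intro x hx
    have hev : (f : ℝ → ℝ) =ᶠ[nhds x] fun _ => 0 := by
      have : {y : ℝ | 5 * R / 6 < |y|} ∈ nhds x := (isOpen_lt continuous_const continuous_abs).mem_nhds (by
        show 5 * R / 6 < |x|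
        linarith)
      filter_upwards [this] with y hy
      refine f.zero_of_le_dist ?_
      rw [Real.dist_eq, sub_zero]
      exact le_of_lt hy
    refine ⟨hev.eq_of_nhds, ?_⟩
    rw [hev.deriv.eq_of_nhds]; simp

lemma CO.trans {f : ℝ → ℝ → ℝ} {t1 t0 A B s x0 R : ℝ} (hf : CO f t1 t0 A B) (hs : t1 ≤ s)
    (h1 : A ≤ x0 - R) (h2 : x0 + R ≤ B) : CO (fun t x => f t (x0 + x)) s t0 (-R) R := by
  refine ContinuousOn.comp (g := fun p : ℝ × ℝ => f p.1 p.2) (f := fun p : ℝ × ℝ => (p.1, x0 + p.2)) hf (by fun_prop) ?_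
  intro p hp
  exact ⟨⟨hs.trans hp.1.1, hp.1.2⟩, ⟨by linarith [hp.2.1], by linarith [hp.2.2]⟩⟩

lemma E_local {t1 t0 A B δ M e : ℝ} {a at' ax w wt wx wxx : ℝ → ℝ → ℝ} (ht : t1 < t0)
    (hδ : 0 < δ) (hM : 0 ≤ M)
    (ca : CO a t1 t0 A B) (cat : CO at' t1 t0 A B) (cax : CO ax t1 t0 A B)
    (cW : CO w t1 t0 A B) (cWt : CO wt t1 t0 A B) (cWx : CO wx t1 t0 A B) (cWxx : CO wxx t1 t0 A B)
    (da : ∀ t ∈ Icc t1 t0, ∀ x ∈ Icc A B, HasDerivAt (fun s => a s x) (at' t x) t)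
    (dax : ∀ t ∈ Icc t1 t0, ∀ x ∈ Icc A B, HasDerivAt (fun y => a t y) (ax t x) x)
    (dW : ∀ t ∈ Ioo t1 t0, ∀ x ∈ Ioo A B, HasDerivAt (fun s => w s x) (wt t x) t)
    (dWx : ∀ t ∈ Icc t1 t0, ∀ x ∈ Ioo A B, HasDerivAt (fun y => w t y) (wx t x) x)
    (dWxx : ∀ t ∈ Icc t1 t0, ∀ x ∈ Ioo A B, HasDerivAt (fun y => wx t y) (wxx t x) x)
    (hδa : ∀ t ∈ Icc t1 t0, ∀ x ∈ Icc A B, δ ≤ a t x)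
    (hat : ∀ t ∈ Icc t1 t0, ∀ x ∈ Icc A B, |at' t x| ≤ M)
    (hax : ∀ t ∈ Icc t1 t0, ∀ x ∈ Icc A B, |ax t x| ≤ M)
    (hf : ∀ t ∈ Icc t1 t0, ∀ x ∈ Icc A B, |wt t x - a t x * wxx t x| ≤ M * (|w t x| + |wx t x|))
    (he : e ∈ Ioo A B) :
    ∃ ρ > 0, ∀ x0, |x0 - e| < ρ → (∀ᶠ y in nhds x0, w t0 y = 0) → ∀ x1, |x1 - e| < ρ → w t0 x1 = 0 := by
  obtain ⟨R, hRM, hRAB, hRt, hR⟩ := ((small_ev M (by positivity : 0 < 0.05 * δ)).and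
    ((small_ev 1 (lt_min (sub_pos.2 he.1) (sub_pos.2 he.2))).and
    ((small_ev 1 (sub_pos.2 ht)).and (self_mem_nhdsWithin)))).exists
  have hR0 : 0 < R := hR
  have hRA := hRAB.trans (min_le_left _ _)
  have hRB := hRAB.trans (min_le_right _ _)
  refine ⟨R / 8, by positivity, fun x0 hx0 hev x1 hx1 => ?_⟩
  by_contra hne
  have hx0' := abs_lt.1 hx0
  have hx1' := abs_lt.1 hx1
  obtain ⟨χ, χ', χ'', dχ, dχ', cχ'', hχ1, hχ0⟩ := cutoff hR0
  have cχ : Continuous χ := continuous_iff_continuousAt.2 fun x => (dχ x).continuousAt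
  have cχ' : Continuous χ' := continuous_iff_continuousAt.2 fun x => (dχ' x).continuousAt
  set s := t0 - R with hs
  have hs1 : t1 ≤ s := by linarith
  have sub : Icc s t0 ⊆ Icc t1 t0 := Icc_subset_Icc hs1 le_rfl
  have sub' : Ioo s t0 ⊆ Ioo t1 t0 := Ioo_subset_Ioo hs1 le_rfl
  have mx : ∀ x ∈ Icc (-R) R, x0 + x ∈ Ioo A B := fun x hx => ⟨by linarith [hx.1], by linarith [hx.2]⟩
  have mxc : ∀ x ∈ Icc (-R) R, x0 + x ∈ Icc A B := fun x hx => Ioo_subset_Icc_self (mx x hx)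
  have hA1 : A ≤ x0 - R := by linarith
  have hB1 : x0 + R ≤ B := by linarith
  have kχ : CO (fun t x => χ x) s t0 (-R) R := by unfold CO; fun_prop
  have kχ' : CO (fun t x => χ' x) s t0 (-R) R := by unfold CO; fun_prop
  have kχ'' : CO (fun t x => χ'' x) s t0 (-R) R := by unfold CO; fun_prop
  have ca1 := ca.trans hs1 hA1 hB1
  have cw1 := cW.trans hs1 hA1 hB1
  have cwt1 := cWt.trans hs1 hA1 hB1
  have cwx1 := cWx.trans hs1 hA1 hB1
  have cwxx1 := cWxx.trans hs1 hA1 hB1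
  have cW' := kχ.mul cw1
  have cWt' := kχ.mul cwt1
  have cWx' := (kχ'.mul cw1).add (kχ.mul cwx1)
  have cWxx' := ((kχ''.mul cw1).add (kχ'.mul cwx1)).add ((kχ'.mul cwx1).add (kχ.mul cwxx1))
  obtain ⟨Kb, hKb, bK⟩ := (cWt'.sub (ca1.mul cWxx')).bdd
  have ht0I : t0 ∈ Icc s t0 := right_mem_Icc.2 (by linarith)
  have hx0AB : x0 ∈ Icc A B := ⟨by linarith, by linarith⟩
  have lip : ∀ t ∈ Icc s t0, ∀ x ∈ Icc (-R) R, |a t (x0 + x) - a t0 (x0 + 0)| ≤ M * (|x| + (t0 - t)) := by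
    intro t ht' x hx
    have l1 := (convex_Icc A B).norm_image_sub_le_of_norm_hasDerivWithin_le (f := fun y => a t y) (f' := fun y => ax t y) (C := M)
      (fun y hy => (dax t (sub ht') y hy).hasDerivWithinAt) (fun y hy => hax t (sub ht') y hy) hx0AB (mxc x hx)
    have l2 := (convex_Icc t1 t0).norm_image_sub_le_of_norm_hasDerivWithin_le (f := fun y => a y x0) (f' := fun y => at' y x0) (C := M)
      (fun y hy => (da y hy x0 hx0AB).hasDerivWithinAt) (fun y hy => hat y hy x0 hx0AB) (sub ht0I) (sub ht')
    rw [norm_eq_abs, norm_eq_abs] at l1 l2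
    rw [add_sub_cancel_left] at l1
    rw [abs_sub_comm t t0, abs_of_nonneg (by linarith [ht'.2] : 0 ≤ t0 - t)] at l2
    rw [add_zero]
    have := abs_sub_le (a t (x0 + x)) (a t x0) (a t0 x0)
    linarith
  have osc : ∀ t ∈ Icc s t0, ∀ x ∈ Icc (-R) R, |a t (x0 + x) - a t0 (x0 + 0)| ≤ 0.05 * a t0 (x0 + 0) := by
    intro t ht' x hx
    refine (lip t ht' x hx).trans ?_
    have h3 : M * (|x| + (t0 - t)) ≤ M * (R + R) :=
      mul_le_mul_of_nonneg_left (add_le_add (abs_le.2 hx) (by linarith [ht'.1])) hM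
    have h4 : δ ≤ a t0 (x0 + 0) := by rw [add_zero]; exact hδa t0 (sub ht0I) x0 hx0AB
    linarith
  obtain ⟨r, hr, hrz⟩ := Metric.eventually_nhds_iff.1 hev
  refine E_core (a := fun t x => a t (x0 + x)) (at' := fun t x => at' t (x0 + x)) (ax := fun t x => ax t (x0 + x))
    (W := fun t x => χ x * w t (x0 + x)) (Wt := fun t x => χ x * wt t (x0 + x))
    (Wx := fun t x => χ' x * w t (x0 + x) + χ x * wx t (x0 + x))
    (Wxx := fun t x => (χ'' x * w t (x0 + x) + χ' x * wx t (x0 + x)) + (χ' x * wx t (x0 + x) + χ x * wxx t (x0 + x)))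
    (x1 := x1 - x0) (r := r) (by linarith : s < t0) hR0 hδ hM hKb.le
    ca1 (cat.trans hs1 hA1 hB1) (cax.trans hs1 hA1 hB1) cW' cWt' cWx' cWxx'
    (fun t h x hx => da t (sub (Ioo_subset_Icc_self h)) _ (mxc x hx))
    (fun t h x hx => (dax t (sub h) _ (mxc x hx)).comp_const_add x0 x)
    (fun t h x hx => (dW t (sub' h) _ (mx x hx)).const_mul _)
    (fun t h x hx => (dχ x).fun_mul ((dWx t (sub h) _ (mx x hx)).comp_const_add x0 x))
    (fun t h x hx => ((dχ' x).fun_mul ((dWx t (sub h) _ (mx x hx)).comp_const_add x0 x)).fun_add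
      ((dχ x).fun_mul ((dWxx t (sub h) _ (mx x hx)).comp_const_add x0 x)))
    ?_ ?_ ?_ ?_ (fun t h x hx => hδa t (sub h) _ (mxc x hx)) ?_ ?_
    (fun t h x hx => hat t (sub h) _ (mxc x hx)) (fun t h x hx => hax t (sub h) _ (mxc x hx)) ?_ lip ?_ ?_ ?_ ?_ hr ?_
  · intro t _; simp [hχ0 (-R) (by rw [abs_neg, abs_of_pos hR0])]
  · intro t _; simp [hχ0 R (abs_of_pos hR0)]
  · intro t _; simp [hχ0 (-R) (by rw [abs_neg, abs_of_pos hR0])]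
  · intro t _; simp [hχ0 R (abs_of_pos hR0)]
  · intro t h x hx
    have := (abs_le.1 (osc t h x hx)).1
    linarith
  · intro t h x hx
    have := (abs_le.1 (osc t h x hx)).2
    linarith
  · linarith
  · intro t h x hx
    have h1 : 0 ≤ M * (|χ x * w t (x0 + x)| + |χ' x * w t (x0 + x) + χ x * wx t (x0 + x)|) := by positivity
    have h2 := bK t h x hx
    linarith
  · intro t h x hx hx2
    obtain ⟨g1, g2, g3⟩ := hχ1 x hx2
    simpa [g1, g2, g3] using hf t (sub h) _ (mxc x hx)
  · rw [abs_lt]; constructor <;> linarith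
  · have g1 := (hχ1 (x1 - x0) (by rw [abs_le]; constructor <;> linarith)).1
    simpa [g1] using hne
  · intro x hx
    have : w t0 (x0 + x) = 0 := hrz (by rwa [Real.dist_eq, add_sub_cancel_left])
    simp [this]

lemma thmE {t1 t0 A B δ M e : ℝ} {a at' ax w wt wx wxx : ℝ → ℝ → ℝ} (ht : t1 < t0)
    (hδ : 0 < δ) (hM : 0 ≤ M)
    (ca : CO a t1 t0 A B) (cat : CO at' t1 t0 A B) (cax : CO ax t1 t0 A B)
    (cW : CO w t1 t0 A B) (cWt : CO wt t1 t0 A B) (cWx : CO wx t1 t0 A B) (cWxx : CO wxx t1 t0 A B)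
    (da : ∀ t ∈ Icc t1 t0, ∀ x ∈ Icc A B, HasDerivAt (fun s => a s x) (at' t x) t)
    (dax : ∀ t ∈ Icc t1 t0, ∀ x ∈ Icc A B, HasDerivAt (fun y => a t y) (ax t x) x)
    (dW : ∀ t ∈ Ioo t1 t0, ∀ x ∈ Ioo A B, HasDerivAt (fun s => w s x) (wt t x) t)
    (dWx : ∀ t ∈ Icc t1 t0, ∀ x ∈ Ioo A B, HasDerivAt (fun y => w t y) (wx t x) x)
    (dWxx : ∀ t ∈ Icc t1 t0, ∀ x ∈ Ioo A B, HasDerivAt (fun y => wx t y) (wxx t x) x)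
    (hδa : ∀ t ∈ Icc t1 t0, ∀ x ∈ Icc A B, δ ≤ a t x)
    (hat : ∀ t ∈ Icc t1 t0, ∀ x ∈ Icc A B, |at' t x| ≤ M)
    (hax : ∀ t ∈ Icc t1 t0, ∀ x ∈ Icc A B, |ax t x| ≤ M)
    (hf : ∀ t ∈ Icc t1 t0, ∀ x ∈ Icc A B, |wt t x - a t x * wxx t x| ≤ M * (|w t x| + |wx t x|))
    (he : e ∈ Ioo A B) (hz : ∀ᶠ y in nhds e, w t0 y = 0) : ∀ x ∈ Ioo A B, w t0 x = 0 := by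
  have key : Ioo A B ⊆ {x | ∀ᶠ y in nhds x, w t0 y = 0} := by
    refine isPreconnected_Ioo.subset_of_closure_inter_subset isOpen_setOfPred_eventually_nhds ⟨e, he, hz⟩ ?_
    rintro x ⟨hx, hxI⟩
    obtain ⟨ρ, hρ, h⟩ := E_local ht hδ hM ca cat cax cW cWt cWx cWxx da dax dW dWx dWxx hδa hat hax hf hxI
    obtain ⟨x0, hx0, hd⟩ := Metric.mem_closure_iff.1 hx ρ hρ
    rw [dist_comm, Real.dist_eq] at hd
    have h2 := h x0 hd hx0
    filter_upwards [Metric.ball_mem_nhds x hρ] with y hy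
    exact h2 y (by rwa [Metric.mem_ball, Real.dist_eq] at hy)
  exact fun x hx => (key hx).self_of_nhds

open Real Set Filter

lemma ind_cont {U B : Set (ℝ × ℝ)} {f : ℝ × ℝ → ℝ} (hf : ContinuousOn f B)
    (tri : ∀ r ∈ B, (∀ᶠ y in nhdsWithin r B, y ∈ U) ∨ (∀ᶠ y in nhdsWithin r B, y ∉ U) ∨ f r = 0) :
    ContinuousOn (U.indicator f) B := by
  intro r hr
  rcases tri r hr with h | h | h
  · refine (hf r hr).congr_of_eventuallyEq ?_ (indicator_of_mem (h.self_of_nhdsWithin hr) f)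
    filter_upwards [h] with y hy using indicator_of_mem hy f
  · refine (continuousWithinAt_const (b := (0:ℝ))).congr_of_eventuallyEq ?_
      (indicator_of_notMem (h.self_of_nhdsWithin hr) f)
    filter_upwards [h] with y hy using indicator_of_notMem hy f
  · have h0 : U.indicator f r = 0 := by
      by_cases hU : r ∈ U
      · rw [indicator_of_mem hU, h]
      · rw [indicator_of_notMem hU]
    unfold ContinuousWithinAt
    rw [h0]
    have h1 := hf r hr
    unfold ContinuousWithinAt at h1
    rw [h] at h1
    refine squeeze_zero_norm (fun y => ?_) (by simpa using h1.norm)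
    exact norm_indicator_le_norm_self f y

lemma ind_deriv {V : Set ℝ} {g : ℝ → ℝ} {g' x : ℝ} (hg : HasDerivAt g g' x)
    (tri : (∀ᶠ y in nhds x, y ∈ V) ∨ (∀ᶠ y in nhds x, y ∉ V) ∨ (g x = 0 ∧ g' = 0)) :
    HasDerivAt (V.indicator g) (V.indicator (fun _ => g') x) x := by
  rcases tri with h | h | ⟨h, h'⟩
  · rw [indicator_of_mem h.self_of_nhds]
    refine hg.congr_of_eventuallyEq ?_
    filter_upwards [h] with y hy using indicator_of_mem hy g
  · rw [indicator_of_notMem h.self_of_nhds]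
    refine (hasDerivAt_const x (0:ℝ)).congr_of_eventuallyEq ?_
    filter_upwards [h] with y hy using indicator_of_notMem hy g
  · have h0 : V.indicator g x = 0 := by
      by_cases hU : x ∈ V
      · rw [indicator_of_mem hU, h]
      · rw [indicator_of_notMem hU]
    have h1 : V.indicator (fun _ => g') x = 0 := by
      by_cases hU : x ∈ V
      · rw [indicator_of_mem hU, h']
      · rw [indicator_of_notMem hU]
    rw [h1]
    subst h'
    rw [hasDerivAt_iff_isLittleO] at hg ⊢
    simp only [h, h0, smul_zero, sub_zero] at hg ⊢
    exact (Asymptotics.IsBigO.of_bound 1 (Eventually.of_forall fun y => by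
      simpa using norm_indicator_le_norm_self g y)).trans_isLittleO hg

lemma noint {δ K M : ℝ} {a b c a_t a_x u ut ux uxx : ℝ → ℝ → ℝ}
    (hu : Sol δ K a b c u ut ux uxx) (hMK : M ≤ K)
    (ha_cont : ContinuousOn (fun p : ℝ × ℝ => a p.1 p.2) (Set.Ioi 0 ×ˢ Set.univ))
    (hat_cont : ContinuousOn (fun p : ℝ × ℝ => a_t p.1 p.2) (Set.Ioi 0 ×ˢ Set.univ))
    (hax_cont : ContinuousOn (fun p : ℝ × ℝ => a_x p.1 p.2) (Set.Ioi 0 ×ˢ Set.univ))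
    (ha_t : ∀ t > (0:ℝ), ∀ x : ℝ, HasDerivAt (fun s => a s x) (a_t t x) t)
    (ha_x : ∀ t > (0:ℝ), ∀ x : ℝ, HasDerivAt (fun y => a t y) (a_x t x) x)
    (hb1 : ∀ t > (0:ℝ), ∀ x : ℝ, |a_t t x| ≤ M) (hb2 : ∀ t > (0:ℝ), ∀ x : ℝ, |a_x t x| ≤ M)
    {t0 x0 : ℝ} (ht0 : 0 < t0) (hx0 : u t0 x0 ≠ 0) :
    ∀ x y, x < y → ∃ z ∈ Ioo x y, u t0 z ≠ 0 := by
  intro x y hxy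
  by_contra hcon
  push Not at hcon
  have ht1 : 0 < t0 / 2 := by linarith
  have hpos : ∀ t ∈ Icc (t0 / 2) t0, 0 < t := fun t ht => lt_of_lt_of_le ht1 ht.1
  refine hx0 (thmE (t1 := t0 / 2) (t0 := t0) (A := min x0 x - 1) (B := max x0 y + 1) (δ := δ)
    (M := K) (e := (x + y) / 2) (a := a) (at' := a_t) (ax := a_x) (w := u) (wt := ut) (wx := ux)
    (wxx := uxx) (by linarith) hu.hδ hu.hK.le (ha_cont.mono (box_sub ht1))
    (hat_cont.mono (box_sub ht1)) (hax_cont.mono (box_sub ht1)) (hu.cu.mono (box_sub ht1))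
    (hu.cut.mono (box_sub ht1)) (hu.cux.mono (box_sub ht1)) (hu.cuxx.mono (box_sub ht1))
    (fun t ht z _ => ha_t t (hpos t ht) z) (fun t ht z _ => ha_x t (hpos t ht) z)
    (fun t ht z _ => hu.dt t (hpos t (Ioo_subset_Icc_self ht)) z)
    (fun t ht z _ => hu.dx t (hpos t ht) z) (fun t ht z _ => hu.dxx t (hpos t ht) z)
    (fun t ht z _ => hu.ha t (hpos t ht) z)
    (fun t ht z _ => (hb1 t (hpos t ht) z).trans hMK)
    (fun t ht z _ => (hb2 t (hpos t ht) z).trans hMK) ?_ ?_ ?_ x0 ?_)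
  · intro t ht z _
    have h := hu.eq t (hpos t ht) z
    have e1 : ut t z - a t z * uxx t z = b t z * ux t z + c t z * u t z := by linarith
    rw [e1]
    refine (abs_add_le _ _).trans ?_
    rw [abs_mul, abs_mul]
    nlinarith [mul_le_mul_of_nonneg_right (hu.hb t (hpos t ht) z) (abs_nonneg (ux t z)),
      mul_le_mul_of_nonneg_right (hu.hcK t (hpos t ht) z) (abs_nonneg (u t z))]
  · constructor
    · linarith [min_le_right x0 x]
    · linarith [le_max_right x0 y]
  · filter_upwards [Ioo_mem_nhds (a := x) (b := y) (x := (x + y) / 2) (by linarith)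
      (by linarith)] with z hz using hcon z hz
  · constructor
    · linarith [min_le_left x0 x]
    · linarith [le_max_left x0 y]

lemma core {δ K M : ℝ} {a b c a_t a_x u ut ux uxx : ℝ → ℝ → ℝ}
    (hu : Sol δ K a b c u ut ux uxx) (hMK : M ≤ K)
    (ha_cont : ContinuousOn (fun p : ℝ × ℝ => a p.1 p.2) (Set.Ioi 0 ×ˢ Set.univ))
    (hat_cont : ContinuousOn (fun p : ℝ × ℝ => a_t p.1 p.2) (Set.Ioi 0 ×ˢ Set.univ))
    (hax_cont : ContinuousOn (fun p : ℝ × ℝ => a_x p.1 p.2) (Set.Ioi 0 ×ˢ Set.univ))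
    (ha_t : ∀ t > (0:ℝ), ∀ x : ℝ, HasDerivAt (fun s => a s x) (a_t t x) t)
    (ha_x : ∀ t > (0:ℝ), ∀ x : ℝ, HasDerivAt (fun y => a t y) (a_x t x) x)
    (hb1 : ∀ t > (0:ℝ), ∀ x : ℝ, |a_t t x| ≤ M) (hb2 : ∀ t > (0:ℝ), ∀ x : ℝ, |a_x t x| ≤ M)
    {t0 t1 p q : ℝ} (ht1 : 0 < t1) (ht : t1 < t0) (hpq : p < q) (hp : u t0 p ≠ 0)
    (hq : u t0 q ≠ 0) :
    JoinedIn {r ∈ Icc t1 t0 ×ˢ Icc p q | ¬ (u r.1 r.2 = 0 ∧ ux r.1 r.2 = 0 ∧ uxx r.1 r.2 = 0)}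
      (t0, p) (t0, q) := by
  by_contra hnj
  set B : Set (ℝ × ℝ) := Icc t1 t0 ×ˢ Icc p q with hB
  set S : Set (ℝ × ℝ) := {r ∈ B | ¬ (u r.1 r.2 = 0 ∧ ux r.1 r.2 = 0 ∧ uxx r.1 r.2 = 0)} with hS
  set U : Set (ℝ × ℝ) := {r | JoinedIn S (t0, p) r} with hU
  have hBc : Convex ℝ B := (convex_Icc _ _).prod (convex_Icc _ _)
  have hSB : S ⊆ B := fun r hr => hr.1
  have cu := hu.cu.mono (box_sub (t0 := t0) (p := p) (q := q) ht1)
  have cut := hu.cut.mono (box_sub (t0 := t0) (p := p) (q := q) ht1)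
  have cux := hu.cux.mono (box_sub (t0 := t0) (p := p) (q := q) ht1)
  have cuxx := hu.cuxx.mono (box_sub (t0 := t0) (p := p) (q := q) ht1)
  have hSo : ∀ r ∈ S, ∃ ε > 0, Metric.ball r ε ∩ B ⊆ S := by
    intro r hr
    have hev : ∀ᶠ y in nhdsWithin r B, y ∈ S := by
      have hmem : ∀ᶠ y in nhdsWithin r B, y ∈ B := self_mem_nhdsWithin
      have h2 := hr.2
      by_cases h0 : u r.1 r.2 = 0
      · by_cases hx0 : ux r.1 r.2 = 0
        · have h3 : uxx r.1 r.2 ≠ 0 := fun h => h2 ⟨h0, hx0, h⟩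
          filter_upwards [(cuxx r hr.1).eventually_ne h3, hmem] with y hy hyB
          exact ⟨hyB, fun h => hy h.2.2⟩
        · filter_upwards [(cux r hr.1).eventually_ne hx0, hmem] with y hy hyB
          exact ⟨hyB, fun h => hy h.2.1⟩
      · filter_upwards [(cu r hr.1).eventually_ne h0, hmem] with y hy hyB
        exact ⟨hyB, fun h => hy h.1⟩
    exact Metric.mem_nhdsWithin_iff.1 hev
  have tri : ∀ r ∈ B, (∀ᶠ y in nhdsWithin r B, y ∈ U) ∨ (∀ᶠ y in nhdsWithin r B, y ∉ U) ∨
      (u r.1 r.2 = 0 ∧ ux r.1 r.2 = 0 ∧ uxx r.1 r.2 = 0) := by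
    intro r hr
    by_cases hrS : r ∈ S
    · by_cases hrU : JoinedIn S (t0, p) r
      · left
        exact Metric.mem_nhdsWithin_iff.2 (comp_open hBc hSB hSo hrU)
      · right; left
        have : r ∉ closure U := fun h => hrU (comp_closed hBc hSB hSo hrS h)
        have h2 : (closure U)ᶜ ∈ nhds r := isClosed_closure.isOpen_compl.mem_nhds this
        filter_upwards [mem_nhdsWithin_of_mem_nhds h2] with y hy hyU using hy (subset_closure hyU)
    · right; right
      by_contra h
      exact hrS ⟨hr, h⟩
  have hpos : ∀ t ∈ Icc t1 t0, 0 < t := fun t ht => lt_of_lt_of_le ht1 ht.1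
  have hut0 : ∀ r ∈ B, (u r.1 r.2 = 0 ∧ ux r.1 r.2 = 0 ∧ uxx r.1 r.2 = 0) → ut r.1 r.2 = 0 := by
    intro r hr h
    rw [hu.eq r.1 (hpos _ hr.1), h.1, h.2.1, h.2.2]; ring
  have tx : ∀ t ∈ Icc t1 t0, ∀ x ∈ Ioo p q,
      Tendsto (fun y => (t, y)) (nhds x) (nhdsWithin (t, x) B) := by
    intro t ht x hx
    refine tendsto_nhdsWithin_iff.2 ⟨(Continuous.prodMk_right t).tendsto x, ?_⟩
    filter_upwards [Ioo_mem_nhds hx.1 hx.2] with y hy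
    exact ⟨ht, Ioo_subset_Icc_self hy⟩
  have tt : ∀ t ∈ Ioo t1 t0, ∀ x ∈ Ioo p q,
      Tendsto (fun s => (s, x)) (nhds t) (nhdsWithin (t, x) B) := by
    intro t ht x hx
    refine tendsto_nhdsWithin_iff.2 ⟨(Continuous.prodMk_left x).tendsto t, ?_⟩
    filter_upwards [Ioo_mem_nhds ht.1 ht.2] with y hy
    exact ⟨Ioo_subset_Icc_self hy, Ioo_subset_Icc_self hx⟩
  let cutoff : (ℝ → ℝ → ℝ) → ℝ → ℝ → ℝ := fun f t x =>
    U.indicator (fun r : ℝ × ℝ => f r.1 r.2) (t, x)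
  have hone : ∀ r : ℝ × ℝ, (r ∈ U ∧ ∀ f, cutoff f r.1 r.2 = f r.1 r.2) ∨
      (r ∉ U ∧ ∀ f, cutoff f r.1 r.2 = 0) := by
    intro r
    by_cases h : r ∈ U
    · exact Or.inl ⟨h, fun f => indicator_of_mem h _⟩
    · exact Or.inr ⟨h, fun f => indicator_of_notMem h _⟩
  have hpB : (t0, p) ∈ S := ⟨⟨⟨ht.le, le_rfl⟩, le_rfl, hpq.le⟩, fun h => hp h.1⟩
  have hqB : (t0, q) ∈ S := ⟨⟨⟨ht.le, le_rfl⟩, hpq.le, le_rfl⟩, fun h => hq h.1⟩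
  have hpU : (t0, p) ∈ U := JoinedIn.refl hpB
  have ht0m : t0 ∈ Icc t1 t0 := ⟨ht.le, le_rfl⟩
  have tp : Tendsto (fun y => (t0, y)) (nhdsWithin p (Ioo p q)) (nhdsWithin (t0, p) B) := by
    refine tendsto_nhdsWithin_iff.2 ⟨((Continuous.prodMk_right t0).tendsto p).mono_left
      nhdsWithin_le_nhds, ?_⟩
    filter_upwards [self_mem_nhdsWithin] with y hy
    exact ⟨ht0m, Ioo_subset_Icc_self hy⟩
  have tq : Tendsto (fun y => (t0, y)) (nhdsWithin q (Ioo p q)) (nhdsWithin (t0, q) B) := by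
    refine tendsto_nhdsWithin_iff.2 ⟨((Continuous.prodMk_right t0).tendsto q).mono_left
      nhdsWithin_le_nhds, ?_⟩
    filter_upwards [self_mem_nhdsWithin] with y hy
    exact ⟨ht0m, Ioo_subset_Icc_self hy⟩
  have hevp0 : ∀ᶠ y in nhdsWithin (t0, p) B, y ∈ U :=
    Metric.mem_nhdsWithin_iff.2 (comp_open hBc hSB hSo hpU)
  have hevp : ∀ᶠ y in nhdsWithin (t0, p) B, y ∈ U ∧ u y.1 y.2 ≠ 0 :=
    hevp0.and ((cu (t0, p) hpB.1).eventually_ne hp)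
  have hevq : ∀ᶠ y in nhdsWithin (t0, q) B, y ∉ U := by
    rcases tri (t0, q) hqB.1 with h | h | h
    · exact absurd (h.self_of_nhdsWithin hqB.1) hnj
    · exact h
    · exact absurd h.1 hq
  have : (nhdsWithin p (Ioo p q)).NeBot := left_nhdsWithin_Ioo_neBot hpq
  have : (nhdsWithin q (Ioo p q)).NeBot := right_nhdsWithin_Ioo_neBot hpq
  obtain ⟨x0, hx0, hx0m⟩ := ((tp.eventually hevp).and self_mem_nhdsWithin).exists
  have hq1 : ∀ᶠ y in nhdsWithin q (Ioo p q), (t0, y) ∉ U := tq.eventually hevq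
  rw [nhdsWithin_Ioo_eq_nhdsLT hpq] at hq1
  obtain ⟨l, hl, hl2⟩ := (mem_nhdsLT_iff_exists_mem_Ico_Ioo_subset hpq).1 hq1
  have he : (l + q) / 2 ∈ Ioo l q := by
    constructor <;> linarith [hl.2]
  have hfin := thmE (t1 := t1) (t0 := t0) (A := p) (B := q) (δ := δ)
    (M := K) (e := (l + q) / 2) (a := a) (at' := a_t) (ax := a_x) (w := cutoff u) (wt := cutoff ut)
    (wx := cutoff ux)
    (wxx := cutoff uxx) ht hu.hδ hu.hK.le (ha_cont.mono (box_sub ht1))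
    (hat_cont.mono (box_sub ht1)) (hax_cont.mono (box_sub ht1))
    (ind_cont cu fun r hr => (tri r hr).imp id (Or.imp id fun h => h.1))
    (ind_cont cut fun r hr => (tri r hr).imp id (Or.imp id fun h => hut0 r hr h))
    (ind_cont cux fun r hr => (tri r hr).imp id (Or.imp id fun h => h.2.1))
    (ind_cont cuxx fun r hr => (tri r hr).imp id (Or.imp id fun h => h.2.2))
    (fun t ht z _ => ha_t t (hpos t ht) z) (fun t ht z _ => ha_x t (hpos t ht) z)
    (fun t h z hz => ?_)
    (fun t h z hz => ?_) (fun t h z hz => ?_)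
    (fun t ht z _ => hu.ha t (hpos t ht) z)
    (fun t ht z _ => (hb1 t (hpos t ht) z).trans hMK)
    (fun t ht z _ => (hb2 t (hpos t ht) z).trans hMK) ?_ ⟨hl.1.trans_lt he.1, he.2⟩ ?_ x0 hx0m
  · rcases hone (t0, x0) with h | h
    · exact hx0.2 ((h.2 u).symm.trans hfin)
    · exact h.1 hx0.1
  · have hm : (t, z) ∈ B := ⟨Ioo_subset_Icc_self h, Ioo_subset_Icc_self hz⟩
    refine ind_deriv (V := {s | (s, z) ∈ U}) (g := fun s => u s z)
      (hu.dt t (hpos t hm.1) z) ?_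
    rcases tri _ hm with h1 | h1 | h1
    · exact Or.inl ((tt t h z hz).eventually h1)
    · exact Or.inr (Or.inl ((tt t h z hz).eventually h1))
    · exact Or.inr (Or.inr ⟨h1.1, hut0 _ hm h1⟩)
  · have hm : (t, z) ∈ B := ⟨h, Ioo_subset_Icc_self hz⟩
    refine ind_deriv (V := {y | (t, y) ∈ U}) (g := fun y => u t y)
      (hu.dx t (hpos t hm.1) z) ?_
    rcases tri _ hm with h1 | h1 | h1
    · exact Or.inl ((tx t h z hz).eventually h1)
    · exact Or.inr (Or.inl ((tx t h z hz).eventually h1))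
    · exact Or.inr (Or.inr ⟨h1.1, h1.2.1⟩)
  · have hm : (t, z) ∈ B := ⟨h, Ioo_subset_Icc_self hz⟩
    refine ind_deriv (V := {y | (t, y) ∈ U}) (g := fun y => ux t y)
      (hu.dxx t (hpos t hm.1) z) ?_
    rcases tri _ hm with h1 | h1 | h1
    · exact Or.inl ((tx t h z hz).eventually h1)
    · exact Or.inr (Or.inl ((tx t h z hz).eventually h1))
    · exact Or.inr (Or.inr ⟨h1.2.1, h1.2.2⟩)
  · intro t ht z _
    rcases hone (t, z) with h1 | h1
    · simp only [h1.2]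
      have h := hu.eq t (hpos t ht) z
      have e1 : ut t z - a t z * uxx t z = b t z * ux t z + c t z * u t z := by linarith
      rw [e1]
      refine (abs_add_le _ _).trans ?_
      rw [abs_mul, abs_mul]
      nlinarith [mul_le_mul_of_nonneg_right (hu.hb t (hpos t ht) z) (abs_nonneg (ux t z)),
        mul_le_mul_of_nonneg_right (hu.hcK t (hpos t ht) z) (abs_nonneg (u t z))]
    · simp only [h1.2]
      simp
  · filter_upwards [Ioo_mem_nhds he.1 he.2] with y hy
    rcases hone (t0, y) with h | h
    · exact absurd h.1 (hl2 hy)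
    · exact h.2 u

theorem stmt0
    (δ : ℝ) (hδ : 0 < δ)
    (a b c a_t a_x : ℝ → ℝ → ℝ)
    (φ φ_t φ_x φ_xx : ℝ → ℝ → ℝ)
    (ha_cont : ContinuousOn (fun p : ℝ × ℝ => a p.1 p.2) (Set.Ioi 0 ×ˢ Set.univ))
    (hb_cont : ContinuousOn (fun p : ℝ × ℝ => b p.1 p.2) (Set.Ioi 0 ×ˢ Set.univ))
    (hc_cont : ContinuousOn (fun p : ℝ × ℝ => c p.1 p.2) (Set.Ioi 0 ×ˢ Set.univ))
    (hat_cont : ContinuousOn (fun p : ℝ × ℝ => a_t p.1 p.2) (Set.Ioi 0 ×ˢ Set.univ))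
    (hax_cont : ContinuousOn (fun p : ℝ × ℝ => a_x p.1 p.2) (Set.Ioi 0 ×ˢ Set.univ))
    (ha_t : ∀ t > (0:ℝ), ∀ x : ℝ, HasDerivAt (fun s => a s x) (a_t t x) t)
    (ha_x : ∀ t > (0:ℝ), ∀ x : ℝ, HasDerivAt (fun y => a t y) (a_x t x) x)
    (M : ℝ)
    (hbound : ∀ t > (0:ℝ), ∀ x : ℝ,
      |a t x| ≤ M ∧ |a_t t x| ≤ M ∧ |a_x t x| ≤ M ∧ |b t x| ≤ M ∧ |c t x| ≤ M)
    (ha_pos : ∀ t > (0:ℝ), ∀ x : ℝ, δ ≤ a t x)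
    (ha_per : ∀ t > (0:ℝ), ∀ x : ℝ, a t (x + 2 * Real.pi) = a t x)
    (hb_per : ∀ t > (0:ℝ), ∀ x : ℝ, b t (x + 2 * Real.pi) = b t x)
    (hc_per : ∀ t > (0:ℝ), ∀ x : ℝ, c t (x + 2 * Real.pi) = c t x)
    (hφ_per : ∀ t > (0:ℝ), ∀ x : ℝ, φ t (x + 2 * Real.pi) = φ t x)
    (hφ_cont : ContinuousOn (fun p : ℝ × ℝ => φ p.1 p.2) (Set.Ioi 0 ×ˢ Set.univ))
    (hφt_cont : ContinuousOn (fun p : ℝ × ℝ => φ_t p.1 p.2) (Set.Ioi 0 ×ˢ Set.univ))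
    (hφx_cont : ContinuousOn (fun p : ℝ × ℝ => φ_x p.1 p.2) (Set.Ioi 0 ×ˢ Set.univ))
    (hφxx_cont : ContinuousOn (fun p : ℝ × ℝ => φ_xx p.1 p.2) (Set.Ioi 0 ×ˢ Set.univ))
    (hφ_t : ∀ t > (0:ℝ), ∀ x : ℝ, HasDerivAt (fun s => φ s x) (φ_t t x) t)
    (hφ_x : ∀ t > (0:ℝ), ∀ x : ℝ, HasDerivAt (fun y => φ t y) (φ_x t x) x)
    (hφ_xx : ∀ t > (0:ℝ), ∀ x : ℝ, HasDerivAt (fun y => φ_x t y) (φ_xx t x) x)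
    (heq : ∀ t > (0:ℝ), ∀ x : ℝ,
      φ_t t x = a t x * φ_xx t x + b t x * φ_x t x + c t x * φ t x)
    (hnontriv : ∀ t > (0:ℝ), ∃ x : ℝ, φ t x ≠ 0) :
    ∀ t > (0:ℝ), zeroNum (φ t) < ⊤ := by
  intro t0 ht0
  unfold zeroNum
  rw [Set.encard_lt_top_iff]
  by_contra hinf0
  have hinf0 : {x ∈ Set.Ico (0 : ℝ) (2 * Real.pi) | φ t0 x = 0}.Infinite := hinf0
  have hM0 : 0 ≤ M := (abs_nonneg _).trans (hbound t0 ht0 0).1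
  set E : ℝ → ℝ := fun t => Real.exp (-M * t) with hE
  have hEpos : ∀ t, 0 < E t := fun t => Real.exp_pos _
  have hEd : ∀ t, HasDerivAt E (-M * E t) t := fun t => by
    have h1 : HasDerivAt (fun t : ℝ => -M * t) (-M) t := by
      simpa using (hasDerivAt_id t).const_mul (-M)
    exact h1.exp.congr_deriv (by simp only [hE]; ring)
  have hEc : Continuous (fun p : ℝ × ℝ => E p.1) := by
    simp only [hE]; fun_prop
  have hsol : Sol δ (2 * M + 1) a b (fun t x => c t x - M) (fun t x => E t * φ t x)
      (fun t x => E t * (φ_t t x - M * φ t x)) (fun t x => E t * φ_x t x)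
      (fun t x => E t * φ_xx t x) :=
    { hδ := hδ
      hK := by linarith
      ha := ha_pos
      hb := fun t ht x => by linarith [(hbound t ht x).2.2.2.1]
      hc0 := fun t ht x => by linarith [(abs_le.1 (hbound t ht x).2.2.2.2).2]
      hcK := fun t ht x => by
        have := abs_le.1 (hbound t ht x).2.2.2.2
        rw [abs_le]; constructor <;> linarith
      cu := hEc.continuousOn.mul hφ_cont
      cut := hEc.continuousOn.mul (hφt_cont.sub (continuousOn_const.mul hφ_cont))
      cux := hEc.continuousOn.mul hφx_cont
      cuxx := hEc.continuousOn.mul hφxx_cont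
      dt := fun t ht x => ((hEd t).fun_mul (hφ_t t ht x)).congr_deriv (by ring)
      dx := fun t ht x => (hφ_x t ht x).const_mul (E t)
      dxx := fun t ht x => (hφ_xx t ht x).const_mul (E t)
      eq := fun t ht x => by rw [heq t ht x]; ring }
  have hEne : ∀ t x, E t * φ t x = 0 ↔ φ t x = 0 := fun t x => by
    simp [(hEpos t).ne']
  obtain ⟨p, hp⟩ := hnontriv t0 ht0
  have hp' : E t0 * φ t0 p ≠ 0 := fun h => hp ((hEne _ _).1 h)
  have hno := noint (M := M) hsol (by linarith) ha_cont hat_cont hax_cont ha_t ha_x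
    (fun t ht x => (hbound t ht x).2.1) (fun t ht x => (hbound t ht x).2.2.1) ht0 hp'
  have h2pi : (0:ℝ) < 2 * Real.pi := by positivity
  have hper : Function.Periodic (φ t0) (2 * Real.pi) := fun x => hφ_per t0 ht0 x
  have hinf : {x ∈ Ioo p (p + 2 * Real.pi) | E t0 * φ t0 x = 0}.Infinite := by
    refine (hinf0.image (f := toIcoMod h2pi p) ?_).mono ?_
    · intro x hx y hy hxy
      have h1 : toIcoMod h2pi 0 (toIcoMod h2pi p x) = toIcoMod h2pi 0 (toIcoMod h2pi p y) := by
        rw [hxy]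
      rw [toIcoMod_toIcoMod, toIcoMod_toIcoMod,
        (toIcoMod_eq_self h2pi).2 (by simpa using hx.1),
        (toIcoMod_eq_self h2pi).2 (by simpa using hy.1)] at h1
      exact h1
    · rintro _ ⟨x, hx, rfl⟩
      have hz : φ t0 (toIcoMod h2pi p x) = 0 := by
        have : toIcoMod h2pi p x = x - toIcoDiv h2pi p x • (2 * Real.pi) := rfl
        rw [this, hper.sub_zsmul_eq, hx.2]
      have hm := toIcoMod_mem_Ico h2pi p x
      refine ⟨⟨lt_of_le_of_ne hm.1 ?_, hm.2⟩, (hEne _ _).2 hz⟩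
      intro h
      rw [← h] at hz
      exact hp hz
  have hq' : E t0 * φ t0 (p + 2 * Real.pi) ≠ 0 := by rw [hφ_per t0 ht0]; exact hp'
  have hcp : ContinuousAt (fun t => E t * φ t p) t0 := (hsol.dt t0 ht0 p).continuousAt
  obtain ⟨t1, h1, h2, h3, h4⟩ : ∃ t1, 0 < t1 ∧ t1 < t0 ∧ (2 * M + 1) * (t0 - t1) < 1 ∧
      ((∀ t ∈ Icc t1 t0, 0 < E t * φ t p) ∨ (∀ t ∈ Icc t1 t0, E t * φ t p < 0)) := by
    have hs : ∃ ε > 0, (∀ t ∈ Metric.ball t0 ε, 0 < E t * φ t p) ∨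
        (∀ t ∈ Metric.ball t0 ε, E t * φ t p < 0) := by
      rcases lt_or_gt_of_ne hp' with h | h
      · obtain ⟨ε, hε, he⟩ := Metric.eventually_nhds_iff_ball.1 (hcp.eventually_lt_const h)
        exact ⟨ε, hε, Or.inr he⟩
      · obtain ⟨ε, hε, he⟩ := Metric.eventually_nhds_iff_ball.1 (hcp.eventually_const_lt h)
        exact ⟨ε, hε, Or.inl he⟩
    obtain ⟨ε, hε, he⟩ := hs
    have hk : (0:ℝ) < 1 / (2 * M + 1) := by positivity
    set d := min (min (ε / 2) (t0 / 2)) (1 / (2 * M + 1) / 2) with hd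
    have hd0 : 0 < d := by rw [hd]; positivity
    have hd1 : d ≤ ε / 2 := (min_le_left _ _).trans (min_le_left _ _)
    have hd2 : d ≤ t0 / 2 := (min_le_left _ _).trans (min_le_right _ _)
    have hd3 : d < 1 / (2 * M + 1) := lt_of_le_of_lt (min_le_right _ _) (by linarith)
    have hsub : ∀ t ∈ Icc (t0 - d) t0, t ∈ Metric.ball t0 ε := fun t ht => by
      rw [Metric.mem_ball, Real.dist_eq, abs_lt]
      constructor <;> linarith [ht.1, ht.2]
    refine ⟨t0 - d, by linarith, by linarith, ?_, ?_⟩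
    · rw [lt_div_iff₀ (by linarith)] at hd3
      linarith
    · exact he.imp (fun h t ht => h t (hsub t ht)) (fun h t ht => h t (hsub t ht))
  refine notjoined hsol h1 h2 h3 (p := p) (q := p + 2 * Real.pi) ?_ hinf hno
    (core (M := M) hsol (by linarith) ha_cont hat_cont hax_cont ha_t ha_x
      (fun t ht x => (hbound t ht x).2.1) (fun t ht x => (hbound t ht x).2.2.1) h1 h2
      (by linarith) hp' hq')
  rintro s (rfl | rfl)
  · exact h4
  · have hpt : ∀ t ∈ Icc t1 t0, φ t (p + 2 * Real.pi) = φ t p := fun t ht =>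
      hφ_per t (lt_of_lt_of_le h1 ht.1) p
    refine h4.imp (fun h t ht => ?_) (fun h t ht => ?_)
    · simp only [hpt t ht]; exact h t ht
    · simp only [hpt t ht]; exact h t ht
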